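/- Let A be a real symmetric positive-definite 3×3 matrix. Let a = (a₁,a₂,a₃) ∈ ℝ³ with |a| = 1 and aA = (s₀,0,0) for some s₀ > 0, let b = (b₁,b₂,b₃) ∈ ℝ³ with |b| < √3 and ⟨a,b⟩ = 0, set δ₀ = (1/a₁)(1/2 − b₁), and for ρ ∈ ℝ let k = (δ₀ + iρ)a + b ∈ ℂ³. Let w be a (2πℤ)³-periodic measurable function on ℝ³ with w ≥ c_w for some constant c_w > 0, integrable on Ω, with ‖w‖_{F(𝕋³)} < ∞, and suppose there is a constant C_{A₂} such that for almost every (x₂,x₃) the function x₁ ↦ w(x₁,x₂,x₃) satisfies sup over bounded intervals I ⊂ ℝ of ( |I|^{−1} ∫_I w dx₁ )( |I|^{−1} ∫_I w^{−1} dx₁ ) ≤ C_{A₂}. Then there is a constant C (depending only on A and C_{A₂}, and independent of ρ and c_w) such that for every ρ with |ρ| ≥ 1 and every finitely supported family (c_n)_{n∈ℤ³} of complex coefficients, ∫_Ω | Σ_n c_n e^{in·x} / ((n+k)A(n+k)ᵀ) |² w(x) dx ≤ C ‖w‖²_{F(𝕋³)} ∫_Ω | Σ_n c_n e^{in·x}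 |² w(x)^{−1} dx. -/

import Mathlib

open MeasureTheory ENNReal NNReal Real Filter
open scoped Classical

noncomputable section

abbrev E3 : Type := EuclideanSpace ℝ (Fin 3)

/-- The axis-parallel cube in `ℝ³` centered at `z` with side length `r`. -/
def cube3 (z : E3) (r : ℝ) : Set E3 := {x : E3 | ∀ i, |x i - z i| ≤ r / 2}

/-- The Kerman–Sawyer ratio for the cube `Q(z,r)`. -/
def ksRatio (w : E3 → ℝ≥0∞) (z : E3) (r : ℝ) : ℝ≥0∞ :=
  (∫⁻ x in cube3 z r, w x)⁻¹ *
    ∫⁻ x in cube3 z r, ∫⁻ y in cube3 z r, w x * w y / edist x y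

/-- The Kerman–Sawyer norm `‖w‖_F` on `ℝ³`. -/
def ksNorm (w : E3 → ℝ≥0∞) : ℝ≥0∞ :=
  ⨆ (z : E3) (r : ℝ) (_ : 0 < r), ksRatio w z r

/-- Fractional integral of order 1 on `ℝ³`: `I₁ f x = ∫ f y / |x-y|² dy`. -/
def I1 (f : E3 → ℝ≥0∞) (x : E3) : ℝ≥0∞ := ∫⁻ y, f y / (edist x y) ^ 2

/-- Fractional integral of order 2 on `ℝ³`: `I₂ f x = ∫ f y / |x-y| dy`. -/
def I2 (f : E3 → ℝ≥0∞) (x : E3) : ℝ≥0∞ := ∫⁻ y, f y / edist x y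

/-- The fundamental cell `Ω = [0, 2π)³`. -/
def Ω3 : Set E3 := {x : E3 | ∀ i, 0 ≤ x i ∧ x i < 2 * π}

/-- Periodicity with respect to the lattice `(2πℤ)³`. -/
def Periodic3 {α : Type*} (w : E3 → α) : Prop :=
  ∀ (x : E3) (n : Fin 3 → ℤ),
    w (x + (WithLp.equiv 2 (Fin 3 → ℝ)).symm (fun i => 2 * π * n i)) = w x

/-- The Kerman–Sawyer norm on the torus. -/
def ksNormT (w : E3 → ℝ≥0∞) : ℝ≥0∞ :=
  ⨆ (z : E3) (_ : z ∈ Ω3) (r : ℝ) (_ : 0 < r) (_ : r < 4 * π), ksRatio w z r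

/-- Euclidean norm of a vector in `Fin 3 → ℝ`. -/
def norm3 (v : Fin 3 → ℝ) : ℝ := Real.sqrt (∑ i, (v i) ^ 2)

/-- The character `e^{i n·x}`. -/
def ewave (n : Fin 3 → ℤ) (x : E3) : ℂ :=
  Complex.exp (Complex.I * ((∑ i, (n i : ℝ) * x i : ℝ) : ℂ))

/-- The real quadratic form `v A vᵀ`. -/
def qA (A : Matrix (Fin 3) (Fin 3) ℝ) (v : Fin 3 → ℝ) : ℝ := ∑ i, ∑ j, v i * A i j * v j

/-- The point `(x₁, x₂, x₃)` of `ℝ³`. -/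
def mk3 (x₁ x₂ x₃ : ℝ) : E3 := (WithLp.equiv 2 (Fin 3 → ℝ)).symm ![x₁, x₂, x₃]

/-! ### Elementary hyperbolic estimates -/

lemma sinh_le_mul_cosh {x : ℝ} (hx : 0 ≤ x) : Real.sinh x ≤ x * Real.cosh x := by
  have hmono : MonotoneOn (fun y : ℝ => y * Real.cosh y - Real.sinh y) (Set.Ici 0) := by
    apply monotoneOn_of_deriv_nonneg (convex_Ici 0)
    · fun_prop
    · fun_prop
    · intro y hy
      simp only [interior_Ici, Set.mem_Ioi] at hy
      have h : HasDerivAt (fun y : ℝ => y * Real.cosh y - Real.sinh y)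
          (1 * Real.cosh y + y * Real.sinh y - Real.cosh y) y :=
        ((hasDerivAt_id y).mul (Real.hasDerivAt_cosh y)).sub (Real.hasDerivAt_sinh y)
      rw [h.deriv]
      have := mul_nonneg hy.le (Real.sinh_nonneg_iff.2 hy.le)
      linarith
  have := hmono (Set.mem_Ici.2 le_rfl) (Set.mem_Ici.2 hx) hx
  simp at this
  linarith

lemma mul_exp_le_sinh {x : ℝ} (hx : 0 ≤ x) :
    x * Real.exp (3 * x / 4) ≤ 4 * Real.sinh x := by
  have h1 : x / 4 ≤ Real.sinh (x / 4) := Real.self_le_sinh_iff.2 (by linarith)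
  have h2 : Real.exp (3 * x / 4) * Real.sinh (x / 4) ≤ Real.sinh x := by
    rw [Real.sinh_eq, Real.sinh_eq]
    have e1 : Real.exp x = Real.exp (3 * x / 4) * Real.exp (x / 4) := by
      rw [← Real.exp_add]; congr 1; ring
    have e2 : Real.exp (-x) ≤ Real.exp (3 * x / 4) * Real.exp (-(x / 4)) := by
      rw [← Real.exp_add]; apply Real.exp_le_exp.2; linarith
    rw [e1]; linarith
  have := mul_le_mul_of_nonneg_left h1 (Real.exp_pos (3 * x / 4)).le
  linarith

lemma exp_cosh_mul_le {x b : ℝ} (hx : 0 ≤ x) (hb : b ^ 2 ≤ 1) :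
    Real.exp (x / 2) * Real.cosh x * (x ^ 2 + b ^ 2) ≤ 20 * (Real.sinh x ^ 2 + b ^ 2) := by
  have hc : Real.cosh x ≤ Real.exp x := by
    have := Real.cosh_add_sinh x
    have := Real.sinh_nonneg_iff.2 hx
    linarith
  have h0 : Real.exp (x / 2) * Real.cosh x ≤ Real.exp (3 * x / 4) ^ 2 := by
    rw [← Real.exp_nat_mul]
    calc _ ≤ Real.exp (x / 2) * Real.exp x := by gcongr
      _ = _ := by rw [← Real.exp_add]; congr 1; push_cast; ring
  have h1 : x ^ 2 * Real.exp (3 * x / 4) ^ 2 ≤ 16 * Real.sinh x ^ 2 := by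
    have := mul_exp_le_sinh hx
    have h3 : 0 ≤ x * Real.exp (3 * x / 4) := by positivity
    nlinarith
  have h2 : Real.exp (3 * x / 4) ^ 2 ≤ 4 * Real.sinh x ^ 2 + 2 := by
    have e : Real.exp (3 * x / 4) ^ 2 ≤ Real.exp x ^ 2 := by
      gcongr; linarith
    have := Real.cosh_add_sinh x
    have := Real.cosh_sq x
    rw [← Real.cosh_add_sinh x] at e
    nlinarith [sq_nonneg (Real.cosh x - Real.sinh x)]
  have hx2 := sq_nonneg x
  have hb2 := sq_nonneg b
  calc _ ≤ Real.exp (3 * x / 4) ^ 2 * (x ^ 2 + b ^ 2) := by gcongr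
    _ = x ^ 2 * Real.exp (3 * x / 4) ^ 2 + b ^ 2 * Real.exp (3 * x / 4) ^ 2 := by ring
    _ ≤ 16 * Real.sinh x ^ 2 + b ^ 2 * (4 * Real.sinh x ^ 2 + 2) := by gcongr
    _ ≤ _ := by nlinarith [sq_nonneg (Real.sinh x)]

/-- The even profile `cosh x / (sinh² x + b²)` with its weighted bound. -/
lemma cosh_div_le {x b : ℝ} (hx : 0 < x) (hb : b ^ 2 ≤ 1) :
    Real.cosh x / (Real.sinh x ^ 2 + b ^ 2) ≤ 20 * Real.exp (-(x / 2)) / (x ^ 2 + b ^ 2) := by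
  have hs : 0 < Real.sinh x := Real.sinh_pos_iff.2 hx
  rw [div_le_div_iff₀ (by positivity) (by positivity)]
  have h := exp_cosh_mul_le hx.le hb
  have h2 := mul_le_mul_of_nonneg_left h (Real.exp_pos (-(x / 2))).le
  have e : Real.exp (-(x / 2)) * Real.exp (x / 2) = 1 := by rw [← Real.exp_add]; simp
  calc _ = (Real.exp (-(x / 2)) * Real.exp (x / 2)) * (Real.cosh x * (x ^ 2 + b ^ 2)) := by
        rw [e]; ring
    _ = Real.exp (-(x / 2)) * (Real.exp (x / 2) * Real.cosh x * (x ^ 2 + b ^ 2)) := by ring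
    _ ≤ _ := h2
    _ = _ := by ring

lemma abs_div_pi_le_abs_sin {t : ℝ} (ht : |t| ≤ π) : |t| / π ≤ |Real.sin (t / 2)| := by
  have h := Real.mul_abs_le_abs_sin (x := t / 2) (by rw [abs_div]; simp; linarith)
  have e : |t| / π = 2 / π * |t / 2| := by rw [abs_div]; simp
  rw [e]; exact h

/-- `(s/2)² + sin²(t/2)` is comparable to `s² + t²` for `|t| ≤ π`. -/
lemma sq_add_sin_sq_ge {s t : ℝ} (ht : |t| ≤ π) :
    (s ^ 2 + t ^ 2) / 10 ≤ (s / 2) ^ 2 + Real.sin (t / 2) ^ 2 := by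
  have h := abs_div_pi_le_abs_sin ht
  have h2 : (|t| / π) ^ 2 ≤ Real.sin (t / 2) ^ 2 := by
    rw [← sq_abs (Real.sin _)]; gcongr
  rw [div_pow, sq_abs] at h2
  have hp : π ^ 2 ≤ 10 := by nlinarith [Real.pi_lt_d2, Real.pi_pos]
  have h3 : t ^ 2 / 10 ≤ t ^ 2 / π ^ 2 := by gcongr
  nlinarith [sq_nonneg s]

/-- The profile of the resolvent kernel on the cylinder, as a function of `t` and the radius. -/
def resProfile (κ t s : ℝ) : ℝ :=
  (Real.cos (κ * s) * Real.sinh (s / 2) * Real.cos (t / 2)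
      + Real.sin (κ * s) * Real.cosh (s / 2) * Real.sin (t / 2))
    / (2 * s * (Real.sinh (s / 2) ^ 2 + Real.sin (t / 2) ^ 2))

lemma measurable_resProfile (κ : ℝ) : Measurable (fun p : ℝ × ℝ => resProfile κ p.1 p.2) := by
  unfold resProfile; fun_prop

/-- The decreasing amplitude of the oscillatory part of `resProfile`. -/
def oscAmp (b s : ℝ) : ℝ := Real.cosh (s / 2) / (Real.sinh (s / 2) ^ 2 + b ^ 2)

lemma resProfile_eq (κ t s : ℝ) (hs : 0 < s) :
    resProfile κ t s =
      Real.cos (κ * s) * Real.cos (t / 2) * (Real.sinh (s / 2) /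
        (2 * s * (Real.sinh (s / 2) ^ 2 + Real.sin (t / 2) ^ 2)))
      + (Real.sin (t / 2) / 2) * (Real.sin (κ * s) / s * oscAmp (Real.sin (t / 2)) s) := by
  have : 0 < Real.sinh (s / 2) := Real.sinh_pos_iff.2 (by linarith)
  unfold resProfile oscAmp
  field_simp

lemma oscAmp_nonneg (b s : ℝ) : 0 ≤ oscAmp b s := by
  unfold oscAmp; positivity

lemma oscAmp_le {t s : ℝ} (hs : 0 < s) (ht : |t| ≤ π) :
    oscAmp (Real.sin (t / 2)) s ≤ 200 * Real.exp (-(s / 4)) / (s ^ 2 + t ^ 2) := by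
  have hb : Real.sin (t / 2) ^ 2 ≤ 1 := Real.sin_sq_le_one _
  have h := cosh_div_le (x := s / 2) (by linarith) hb
  have h2 := sq_add_sin_sq_ge (s := s) ht
  unfold oscAmp
  calc _ ≤ _ := h
    _ ≤ 20 * Real.exp (-(s / 2 / 2)) / ((s ^ 2 + t ^ 2) / 10) := by gcongr
    _ = _ := by rw [show s / 2 / 2 = s / 4 by ring]; field_simp; ring

lemma oscAmp_sin_le {t s : ℝ} (hs : 0 < s) (ht : |t| ≤ π) :
    |Real.sin (t / 2)| * oscAmp (Real.sin (t / 2)) s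
      ≤ 80 * Real.exp (-(s / 4)) / Real.sqrt (s ^ 2 + t ^ 2) := by
  have hb : Real.sin (t / 2) ^ 2 ≤ 1 := Real.sin_sq_le_one _
  have h := cosh_div_le (x := s / 2) (by linarith) hb
  have h2 := sq_add_sin_sq_ge (s := s) ht
  set D := (s / 2) ^ 2 + Real.sin (t / 2) ^ 2 with hD
  have hDpos : 0 < D := by positivity
  have hbD : |Real.sin (t / 2)| ≤ Real.sqrt D := Real.abs_le_sqrt (by rw [hD]; nlinarith [sq_nonneg s])
  have hsq : Real.sqrt (s ^ 2 + t ^ 2) ≤ 4 * Real.sqrt D := by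
    rw [Real.sqrt_le_left (by positivity), mul_pow, Real.sq_sqrt hDpos.le]; linarith
  have hpos : 0 < Real.sqrt (s ^ 2 + t ^ 2) := by positivity
  unfold oscAmp
  calc _ ≤ Real.sqrt D * (20 * Real.exp (-(s / 2 / 2)) / D) := by gcongr
    _ = 20 * Real.exp (-(s / 4)) / Real.sqrt D := by
      rw [show s / 2 / 2 = s / 4 by ring]
      have : D = Real.sqrt D * Real.sqrt D := (Real.mul_self_sqrt hDpos.le).symm
      have h0 : 0 < Real.sqrt D := Real.sqrt_pos.2 hDpos
      conv_lhs => rw [this]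
      rw [← this] 
      field_simp
      rw [Real.sq_sqrt hDpos.le]
    _ = 80 * Real.exp (-(s / 4)) / (4 * Real.sqrt D) := by
      have h0 : 0 < Real.sqrt D := Real.sqrt_pos.2 hDpos
      field_simp; norm_num
    _ ≤ _ := by gcongr

/-- Bound for the non-oscillatory part. -/
lemma sinhPart_le {t s : ℝ} (hs : 0 < s) (ht : |t| ≤ π) :
    Real.sinh (s / 2) / (2 * s * (Real.sinh (s / 2) ^ 2 + Real.sin (t / 2) ^ 2))
      ≤ 50 * Real.exp (-(s / 4)) / (s ^ 2 + t ^ 2) := by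
  have h1 := sinh_le_mul_cosh (x := s / 2) (by linarith)
  have h2 := oscAmp_le hs ht
  have hsh : 0 < Real.sinh (s / 2) := Real.sinh_pos_iff.2 (by linarith)
  unfold oscAmp at h2
  calc _ ≤ (s / 2 * Real.cosh (s / 2)) /
        (2 * s * (Real.sinh (s / 2) ^ 2 + Real.sin (t / 2) ^ 2)) := by gcongr
    _ = (1 / 4) * (Real.cosh (s / 2) / (Real.sinh (s / 2) ^ 2 + Real.sin (t / 2) ^ 2)) := by
      field_simp; norm_num
    _ ≤ (1 / 4) * (200 * Real.exp (-(s / 4)) / (s ^ 2 + t ^ 2)) := by gcongr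
    _ = _ := by ring

lemma abs_resProfile_le {κ t s : ℝ} (hs : 0 < s) (ht : |t| ≤ π) :
    |resProfile κ t s| ≤ 90 * Real.exp (-(s / 4)) / s ^ 2 := by
  rw [resProfile_eq κ t s hs]
  have h1 := sinhPart_le hs ht
  have h2 := oscAmp_sin_le hs ht
  have hsh : 0 < Real.sinh (s / 2) := Real.sinh_pos_iff.2 (by linarith)
  have hS : s ≤ Real.sqrt (s ^ 2 + t ^ 2) := Real.le_sqrt_of_sq_le (by nlinarith [sq_nonneg t])
  refine (abs_add_le _ _).trans ?_
  have a1 : |Real.cos (κ * s) * Real.cos (t / 2) * (Real.sinh (s / 2) /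
        (2 * s * (Real.sinh (s / 2) ^ 2 + Real.sin (t / 2) ^ 2)))|
        ≤ 50 * Real.exp (-(s / 4)) / s ^ 2 := by
    rw [abs_mul, abs_mul]
    calc _ ≤ 1 * 1 * |Real.sinh (s / 2) /
        (2 * s * (Real.sinh (s / 2) ^ 2 + Real.sin (t / 2) ^ 2))| := by
          gcongr
          · exact Real.abs_cos_le_one _
          · exact Real.abs_cos_le_one _
      _ = Real.sinh (s / 2) /
        (2 * s * (Real.sinh (s / 2) ^ 2 + Real.sin (t / 2) ^ 2)) := by
          rw [abs_of_nonneg (by positivity)]; ring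
      _ ≤ _ := h1
      _ ≤ _ := by
        gcongr
        nlinarith [sq_nonneg t]
  have a2 : |(Real.sin (t / 2) / 2) * (Real.sin (κ * s) / s * oscAmp (Real.sin (t / 2)) s)|
      ≤ 40 * Real.exp (-(s / 4)) / s ^ 2 := by
    have e : |(Real.sin (t / 2) / 2) * (Real.sin (κ * s) / s * oscAmp (Real.sin (t / 2)) s)|
        = |Real.sin (κ * s)| / (2 * s) * (|Real.sin (t / 2)| * oscAmp (Real.sin (t / 2)) s) := by
      rw [abs_mul, abs_mul, abs_div, abs_div, abs_of_pos hs, abs_of_nonneg (oscAmp_nonneg _ _),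
        abs_of_pos (by norm_num : (0:ℝ) < 2)]
      field_simp
    rw [e]
    calc _ ≤ 1 / (2 * s) * (80 * Real.exp (-(s / 4)) / s) := by
          gcongr
          · exact mul_nonneg (abs_nonneg _) (oscAmp_nonneg _ _)
          · exact Real.abs_sin_le_one _
          · exact h2.trans (by gcongr)
      _ = _ := by field_simp; norm_num
  calc _ ≤ _ := add_le_add a1 a2
    _ = _ := by ring

/-! ### The oscillatory integral -/

lemma hasDerivAt_sqrt_add_sq {r : ℝ} (hr : 0 < r) (x : ℝ) :
    HasDerivAt (fun x : ℝ => Real.sqrt (r ^ 2 + x ^ 2)) (x / Real.sqrt (r ^ 2 + x ^ 2)) x := by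
  have h : HasDerivAt (fun x : ℝ => r ^ 2 + x ^ 2) (2 * x) x := by
    simpa using ((hasDerivAt_pow 2 x).const_add (r ^ 2))
  have := h.sqrt (by positivity)
  convert this using 1
  field_simp

lemma oscillatory_Ioi_bound {κ r : ℝ} (hκ : 0 < κ) (hr : 0 < r) {g g' : ℝ → ℝ}
    (hg : ∀ s, 0 < s → HasDerivAt g (g' s) s) (hg' : ∀ s, 0 < s → g' s ≤ 0)
    (hg0 : ∀ s, 0 ≤ g s)
    (hInt : Integrable (fun x : ℝ => Real.sin (κ * Real.sqrt (r ^ 2 + x ^ 2))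
      / Real.sqrt (r ^ 2 + x ^ 2) * g (Real.sqrt (r ^ 2 + x ^ 2)))) :
    |∫ x in Set.Ioi (0 : ℝ), Real.sin (κ * Real.sqrt (r ^ 2 + x ^ 2))
      / Real.sqrt (r ^ 2 + x ^ 2) * g (Real.sqrt (r ^ 2 + x ^ 2))| ≤ 3 * g r := by
  set F : ℝ → ℝ := fun x => Real.sin (κ * Real.sqrt (r ^ 2 + x ^ 2))
      / Real.sqrt (r ^ 2 + x ^ 2) * g (Real.sqrt (r ^ 2 + x ^ 2)) with hF
  have hspos : ∀ x : ℝ, 0 < Real.sqrt (r ^ 2 + x ^ 2) := fun x => by positivity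
  have hsr : ∀ x : ℝ, r ≤ Real.sqrt (r ^ 2 + x ^ 2) := fun x =>
    Real.le_sqrt_of_sq_le (by nlinarith [sq_nonneg x])
  have hanti : AntitoneOn g (Set.Ioi 0) := by
    apply antitoneOn_of_deriv_nonpos (convex_Ioi 0)
    · exact fun s hs => (hg s hs).continuousAt.continuousWithinAt
    · intro s hs
      rw [interior_Ioi] at hs
      exact (hg s hs).differentiableAt.differentiableWithinAt
    · intro s hs
      rw [interior_Ioi] at hs
      rw [(hg s hs).deriv]; exact hg' s hs
  have hgr : ∀ x : ℝ, g (Real.sqrt (r ^ 2 + x ^ 2)) ≤ g r := fun x =>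
    hanti hr (hspos x) (hsr x)
  set X : ℝ := 1 / κ with hX
  have hXpos : 0 < X := by positivity
  -- near part
  have hnear : |∫ x in Set.Ioc 0 X, F x| ≤ g r := by
    have h := norm_setIntegral_le_of_norm_le_const (μ := volume) (s := Set.Ioc 0 X) (f := F)
      (C := κ * g r) (by simp) (fun x _ => by
        rw [Real.norm_eq_abs, hF]
        simp only
        rw [abs_mul, abs_of_nonneg (hg0 _), abs_div, abs_of_pos (hspos x)]
        have h1 : |Real.sin (κ * Real.sqrt (r ^ 2 + x ^ 2))| / Real.sqrt (r ^ 2 + x ^ 2) ≤ κ := by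
          rw [div_le_iff₀ (hspos x)]
          refine Real.abs_sin_le_abs.trans ?_
          rw [abs_of_pos (mul_pos hκ (hspos x))]
        exact mul_le_mul h1 (hgr x) (hg0 _) hκ.le)
    rw [Real.norm_eq_abs] at h
    refine h.trans (le_of_eq ?_)
    simp only [Measure.real, Real.volume_Ioc, sub_zero]
    rw [ENNReal.toReal_ofReal hXpos.le, hX]
    field_simp
  -- far part
  set h : ℝ → ℝ := fun x => g (Real.sqrt (r ^ 2 + x ^ 2)) / (κ * x) with hh
  set h' : ℝ → ℝ := fun x =>
    (g' (Real.sqrt (r ^ 2 + x ^ 2)) * (x / Real.sqrt (r ^ 2 + x ^ 2)) * (κ * x)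
      - g (Real.sqrt (r ^ 2 + x ^ 2)) * (κ * 1)) / (κ * x) ^ 2 with hh'
  have hder : ∀ x ∈ Set.Ici X, HasDerivAt h (h' x) x := by
    intro x hx
    have hx0 : 0 < x := hXpos.trans_le hx
    exact ((hg _ (hspos x)).comp x (hasDerivAt_sqrt_add_sq hr x)).div
      ((hasDerivAt_id x).const_mul κ) (by simp; exact ⟨hκ.ne', hx0.ne'⟩)
  have hneg : ∀ x ∈ Set.Ioi X, h' x ≤ 0 := by
    intro x hx
    have hx0 : 0 < x := hXpos.trans hx
    apply div_nonpos_of_nonpos_of_nonneg _ (sq_nonneg _)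
    have h1 : g' (Real.sqrt (r ^ 2 + x ^ 2)) * (x / Real.sqrt (r ^ 2 + x ^ 2)) * (κ * x) ≤ 0 := by
      rw [mul_assoc]
      exact mul_nonpos_of_nonpos_of_nonneg (hg' _ (hspos x)) (by have := hspos x; positivity)
    have h2 : 0 ≤ g (Real.sqrt (r ^ 2 + x ^ 2)) * (κ * 1) := mul_nonneg (hg0 _) (by linarith)
    linarith
  have hlim : Tendsto h atTop (nhds 0) := by
    have h1 : Tendsto (fun x : ℝ => g r / κ * x⁻¹) atTop (nhds 0) := by
      simpa using tendsto_inv_atTop_zero.const_mul (g r / κ)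
    refine squeeze_zero' ?_ ?_ h1
    · filter_upwards [eventually_gt_atTop 0] with x hx
      exact div_nonneg (hg0 _) (by positivity)
    · filter_upwards [eventually_gt_atTop 0] with x hx
      show g _ / (κ * x) ≤ _
      rw [show g r / κ * x⁻¹ = g r / (κ * x) by field_simp]
      gcongr; exact hgr x
  have hInt' := integrableOn_Ioi_deriv_of_nonpos' hder hneg hlim
  have hval := integral_Ioi_of_hasDerivAt_of_nonpos' hder hneg hlim
  have hcosint : IntegrableOn
      (fun x => Real.cos (κ * Real.sqrt (r ^ 2 + x ^ 2)) * h' x) (Set.Ioi X) := by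
    refine Integrable.bdd_mul (c := 1) hInt' (by fun_prop) ?_
    filter_upwards with x
    rw [Real.norm_eq_abs]; exact Real.abs_cos_le_one _
  have hφ : ∀ x ∈ Set.Ici X, HasDerivAt
      (fun x => -Real.cos (κ * Real.sqrt (r ^ 2 + x ^ 2)) * h x)
      (F x - Real.cos (κ * Real.sqrt (r ^ 2 + x ^ 2)) * h' x) x := by
    intro x hx
    have hx0 : 0 < x := hXpos.trans_le hx
    have hc := (((hasDerivAt_sqrt_add_sq hr x).const_mul κ).cos.neg).mul (hder x hx)
    refine HasDerivAt.congr_deriv (f := fun x => -Real.cos (κ * Real.sqrt (r ^ 2 + x ^ 2)) * h x)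
      hc ?_
    have := hspos x
    simp only [hF, hh, Pi.neg_apply]
    field_simp
    ring
  have hFint : IntegrableOn F (Set.Ioi X) := hInt.integrableOn
  have hlimφ : Tendsto (fun x => -Real.cos (κ * Real.sqrt (r ^ 2 + x ^ 2)) * h x) atTop
      (nhds 0) := by
    refine squeeze_zero_norm' ?_ hlim
    filter_upwards [eventually_gt_atTop 0] with x hx
    have hhx : 0 ≤ h x := div_nonneg (hg0 _) (by positivity)
    rw [norm_mul, norm_neg, Real.norm_eq_abs, Real.norm_eq_abs, abs_of_nonneg hhx]
    exact mul_le_of_le_one_left hhx (Real.abs_cos_le_one _)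
  have hftc := integral_Ioi_of_hasDerivAt_of_tendsto' hφ (hFint.sub hcosint) hlimφ
  have hsub := integral_sub hFint hcosint
  have hhX : 0 ≤ h X ∧ h X ≤ g r := by
    show 0 ≤ g _ / (κ * X) ∧ g _ / (κ * X) ≤ g r
    rw [show κ * X = 1 by rw [hX]; field_simp, div_one]
    exact ⟨hg0 _, hgr X⟩
  have hcosb : |∫ x in Set.Ioi X, Real.cos (κ * Real.sqrt (r ^ 2 + x ^ 2)) * h' x| ≤ g r := by
    rw [← Real.norm_eq_abs]
    refine (norm_integral_le_of_norm_le (g := fun x => - h' x) hInt'.neg ?_).trans ?_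
    · filter_upwards [ae_restrict_mem measurableSet_Ioi] with x hx
      rw [norm_mul, Real.norm_eq_abs, Real.norm_eq_abs, abs_of_nonpos (hneg x hx)]
      exact mul_le_of_le_one_left (by linarith [hneg x hx]) (Real.abs_cos_le_one _)
    · rw [integral_neg, hval]; linarith [hhX.2]
  have hfar : |∫ x in Set.Ioi X, F x| ≤ 2 * g r := by
    have e : ∫ x in Set.Ioi X, F x = Real.cos (κ * Real.sqrt (r ^ 2 + X ^ 2)) * h X
        + ∫ x in Set.Ioi X, Real.cos (κ * Real.sqrt (r ^ 2 + x ^ 2)) * h' x := by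
      have : ∫ x in Set.Ioi X, (F x - Real.cos (κ * Real.sqrt (r ^ 2 + x ^ 2)) * h' x)
        = 0 - -Real.cos (κ * Real.sqrt (r ^ 2 + X ^ 2)) * h X := hftc
      rw [hsub] at this
      linarith
    rw [e]
    refine (abs_add_le _ _).trans ?_
    have : |Real.cos (κ * Real.sqrt (r ^ 2 + X ^ 2)) * h X| ≤ g r := by
      rw [abs_mul, abs_of_nonneg hhX.1]
      exact (mul_le_of_le_one_left hhX.1 (Real.abs_cos_le_one _)).trans hhX.2
    linarith
  have hsplit : ∫ x in Set.Ioi 0, F x = (∫ x in Set.Ioc 0 X, F x) + ∫ x in Set.Ioi X, F x := by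
    rw [← Set.Ioc_union_Ioi_eq_Ioi hXpos.le]
    exact setIntegral_union (Set.disjoint_left.2 fun x hx hx' => not_lt.2 hx.2 hx')
      measurableSet_Ioi hInt.integrableOn hInt.integrableOn
  rw [hsplit]
  refine (abs_add_le _ _).trans ?_
  linarith

lemma oscillatory_bound {r : ℝ} (κ : ℝ) (hr : 0 < r) {g g' : ℝ → ℝ}
    (hg : ∀ s, 0 < s → HasDerivAt g (g' s) s) (hg' : ∀ s, 0 < s → g' s ≤ 0)
    (hg0 : ∀ s, 0 ≤ g s)
    (hInt : ∀ κ : ℝ, Integrable (fun x : ℝ => Real.sin (κ * Real.sqrt (r ^ 2 + x ^ 2))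
      / Real.sqrt (r ^ 2 + x ^ 2) * g (Real.sqrt (r ^ 2 + x ^ 2)))) :
    |∫ x : ℝ, Real.sin (κ * Real.sqrt (r ^ 2 + x ^ 2))
      / Real.sqrt (r ^ 2 + x ^ 2) * g (Real.sqrt (r ^ 2 + x ^ 2))| ≤ 6 * g r := by
  have key : ∀ κ : ℝ, 0 < κ → |∫ x : ℝ, Real.sin (κ * Real.sqrt (r ^ 2 + x ^ 2))
      / Real.sqrt (r ^ 2 + x ^ 2) * g (Real.sqrt (r ^ 2 + x ^ 2))| ≤ 6 * g r := by
    intro κ hκ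
    have h := oscillatory_Ioi_bound hκ hr hg hg' hg0 (hInt κ)
    have e := integral_comp_abs (f := fun x => Real.sin (κ * Real.sqrt (r ^ 2 + x ^ 2))
      / Real.sqrt (r ^ 2 + x ^ 2) * g (Real.sqrt (r ^ 2 + x ^ 2)))
    simp only [sq_abs] at e
    rw [e, abs_mul, abs_of_pos (by norm_num : (0 : ℝ) < 2)]
    linarith
  rcases lt_trichotomy κ 0 with h | h | h
  · have h1 := key (-κ) (by linarith)
    have e : ∀ x : ℝ, Real.sin (-κ * Real.sqrt (r ^ 2 + x ^ 2))
      / Real.sqrt (r ^ 2 + x ^ 2) * g (Real.sqrt (r ^ 2 + x ^ 2))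
      = -(Real.sin (κ * Real.sqrt (r ^ 2 + x ^ 2))
      / Real.sqrt (r ^ 2 + x ^ 2) * g (Real.sqrt (r ^ 2 + x ^ 2))) := by
      intro x; rw [neg_mul, Real.sin_neg]; ring
    simp_rw [e] at h1
    rwa [integral_neg, abs_neg] at h1
  · subst h; simp; exact hg0 r
  · exact key κ h

lemma hasDerivAt_oscAmp (b : ℝ) {s : ℝ} (hs : 0 < s) :
    HasDerivAt (oscAmp b)
      ((Real.sinh (s / 2) * (1 / 2) * (Real.sinh (s / 2) ^ 2 + b ^ 2)
        - Real.cosh (s / 2) * (2 * Real.sinh (s / 2) * (Real.cosh (s / 2) * (1 / 2))))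
        / (Real.sinh (s / 2) ^ 2 + b ^ 2) ^ 2) s := by
  have hsh : 0 < Real.sinh (s / 2) := Real.sinh_pos_iff.2 (by linarith)
  have h0 : HasDerivAt (fun s : ℝ => s / 2) (1 / 2) s := (hasDerivAt_id s).div_const 2
  have h1 := h0.cosh
  have h2 : HasDerivAt (fun s : ℝ => Real.sinh (s / 2) ^ 2 + b ^ 2)
      (2 * Real.sinh (s / 2) * (Real.cosh (s / 2) * (1 / 2))) s := by
    have := (h0.sinh.pow 2).add_const (b ^ 2)
    simpa using this
  exact h1.div h2 (by positivity)

lemma oscAmp_deriv_nonpos {b : ℝ} (hb : b ^ 2 ≤ 1) {s : ℝ} (hs : 0 < s) :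
    (Real.sinh (s / 2) * (1 / 2) * (Real.sinh (s / 2) ^ 2 + b ^ 2)
        - Real.cosh (s / 2) * (2 * Real.sinh (s / 2) * (Real.cosh (s / 2) * (1 / 2))))
        / (Real.sinh (s / 2) ^ 2 + b ^ 2) ^ 2 ≤ 0 := by
  have hsh : 0 < Real.sinh (s / 2) := Real.sinh_pos_iff.2 (by linarith)
  apply div_nonpos_of_nonpos_of_nonneg _ (sq_nonneg _)
  have := Real.cosh_sq (s / 2)
  have e : Real.sinh (s / 2) * (1 / 2) * (Real.sinh (s / 2) ^ 2 + b ^ 2)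
        - Real.cosh (s / 2) * (2 * Real.sinh (s / 2) * (Real.cosh (s / 2) * (1 / 2)))
      = Real.sinh (s / 2) / 2 * (Real.sinh (s / 2) ^ 2 + b ^ 2 - 2 * Real.cosh (s / 2) ^ 2) := by
    ring
  rw [e, this]
  apply mul_nonpos_of_nonneg_of_nonpos (by linarith)
  nlinarith [sq_nonneg (Real.sinh (s / 2))]

lemma integrable_inv_add_sq {c : ℝ} (hc : 0 < c) :
    Integrable (fun x : ℝ => (c ^ 2 + x ^ 2)⁻¹) ∧ ∫ x : ℝ, (c ^ 2 + x ^ 2)⁻¹ = π / c := by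
  have e : (fun x : ℝ => (c ^ 2 + x ^ 2)⁻¹) = fun x => (c ^ 2)⁻¹ * (1 + (c⁻¹ * x) ^ 2)⁻¹ := by
    funext x; rw [← mul_inv]; congr 1; field_simp
  have hi := (integrable_inv_one_add_sq.comp_mul_left' (inv_ne_zero hc.ne')).const_mul (c ^ 2)⁻¹
  refine ⟨by rw [e]; exact hi, ?_⟩
  rw [e, integral_const_mul, Measure.integral_comp_mul_left (fun x => (1 + x ^ 2)⁻¹),
    integral_univ_inv_one_add_sq]
  simp [abs_of_pos hc]
  field_simp

/-- The resolvent kernel on the cylinder. -/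
def resKernel (κ t r : ℝ) : ℝ := ∫ x : ℝ, resProfile κ t (Real.sqrt (r ^ 2 + x ^ 2))

lemma abs_resKernel_le {κ t r : ℝ} (hr : 0 < r) (ht : |t| ≤ π) :
    |resKernel κ t r| ≤ 400 * Real.exp (-(r / 4)) / Real.sqrt (r ^ 2 + t ^ 2) := by
  set R := Real.sqrt (r ^ 2 + t ^ 2) with hR
  have hRpos : 0 < R := by positivity
  have hR2 : R ^ 2 = r ^ 2 + t ^ 2 := Real.sq_sqrt (by positivity)
  have hspos : ∀ x : ℝ, 0 < Real.sqrt (r ^ 2 + x ^ 2) := fun x => by positivity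
  have hs2 : ∀ x : ℝ, Real.sqrt (r ^ 2 + x ^ 2) ^ 2 = r ^ 2 + x ^ 2 := fun x =>
    Real.sq_sqrt (by positivity)
  have hsr : ∀ x : ℝ, r ≤ Real.sqrt (r ^ 2 + x ^ 2) := fun x =>
    Real.le_sqrt_of_sq_le (by nlinarith [sq_nonneg x])
  obtain ⟨hi, hiv⟩ := integrable_inv_add_sq hRpos
  set b := Real.sin (t / 2) with hb
  set E := Real.exp (-(r / 4)) with hE
  have hexp : ∀ x : ℝ, Real.exp (-(Real.sqrt (r ^ 2 + x ^ 2) / 4)) ≤ E := fun x => by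
    apply Real.exp_le_exp.2; linarith [hsr x]
  have hden : ∀ x : ℝ, Real.sqrt (r ^ 2 + x ^ 2) ^ 2 + t ^ 2 = R ^ 2 + x ^ 2 := fun x => by
    rw [hs2, hR2]; ring
  -- the first part
  set P : ℝ → ℝ := fun x => Real.cos (κ * Real.sqrt (r ^ 2 + x ^ 2)) * Real.cos (t / 2) *
    (Real.sinh (Real.sqrt (r ^ 2 + x ^ 2) / 2) / (2 * Real.sqrt (r ^ 2 + x ^ 2) *
      (Real.sinh (Real.sqrt (r ^ 2 + x ^ 2) / 2) ^ 2 + b ^ 2))) with hP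
  have hPb : ∀ x, ‖P x‖ ≤ 50 * E * (R ^ 2 + x ^ 2)⁻¹ := by
    intro x
    have h1 := sinhPart_le (hspos x) ht
    have hsh : 0 < Real.sinh (Real.sqrt (r ^ 2 + x ^ 2) / 2) :=
      Real.sinh_pos_iff.2 (by linarith [hspos x])
    rw [hden] at h1
    rw [hP, Real.norm_eq_abs]; simp only
    rw [abs_mul, abs_mul]
    calc _ ≤ 1 * 1 * |Real.sinh (Real.sqrt (r ^ 2 + x ^ 2) / 2) / (2 * Real.sqrt (r ^ 2 + x ^ 2) *
      (Real.sinh (Real.sqrt (r ^ 2 + x ^ 2) / 2) ^ 2 + b ^ 2))| := by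
          gcongr
          · exact Real.abs_cos_le_one _
          · exact Real.abs_cos_le_one _
      _ ≤ 50 * Real.exp (-(Real.sqrt (r ^ 2 + x ^ 2) / 4)) / (R ^ 2 + x ^ 2) := by
          rw [abs_of_nonneg (by have := hspos x; positivity)]; simpa using h1
      _ ≤ 50 * E / (R ^ 2 + x ^ 2) := by gcongr; exact hexp x
      _ = _ := by rw [div_eq_mul_inv]
  have hPm : Measurable P := by rw [hP]; fun_prop
  have hPi : Integrable P := by
    refine Integrable.mono' (hi.const_mul (50 * E)) hPm.aestronglyMeasurable ?_
    filter_upwards with x using hPb x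
  have hPint : |∫ x, P x| ≤ 50 * E * (π / R) := by
    rw [← Real.norm_eq_abs, ← hiv, ← integral_const_mul]
    exact norm_integral_le_of_norm_le (hi.const_mul _) (Eventually.of_forall hPb)
  -- the oscillatory part
  have hamp : Measurable (oscAmp b) := by unfold oscAmp; fun_prop
  have hInt : ∀ κ : ℝ, Integrable (fun x : ℝ => Real.sin (κ * Real.sqrt (r ^ 2 + x ^ 2))
      / Real.sqrt (r ^ 2 + x ^ 2) * oscAmp b (Real.sqrt (r ^ 2 + x ^ 2))) := by
    intro κ
    refine Integrable.mono' (hi.const_mul (200 * E / r)) (by fun_prop) ?_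
    filter_upwards with x
    have h1 := oscAmp_le (hspos x) ht
    rw [hden] at h1
    rw [norm_mul, norm_div, Real.norm_eq_abs, Real.norm_eq_abs, Real.norm_eq_abs,
      abs_of_pos (hspos x), abs_of_nonneg (oscAmp_nonneg _ _)]
    calc _ ≤ 1 / r * (200 * E / (R ^ 2 + x ^ 2)) := by
          gcongr
          · exact oscAmp_nonneg _ _
          · exact Real.abs_sin_le_one _
          · exact hsr x
          · refine h1.trans ?_
            gcongr
            exact hexp x
      _ = _ := by field_simp
  have hosc := oscillatory_bound κ hr (fun s hs => hasDerivAt_oscAmp b hs)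
    (fun s hs => oscAmp_deriv_nonpos (Real.sin_sq_le_one _) hs) (oscAmp_nonneg b) hInt
  have hsplit : resKernel κ t r = (∫ x, P x) + b / 2 *
      ∫ x : ℝ, Real.sin (κ * Real.sqrt (r ^ 2 + x ^ 2))
      / Real.sqrt (r ^ 2 + x ^ 2) * oscAmp b (Real.sqrt (r ^ 2 + x ^ 2)) := by
    unfold resKernel
    rw [← integral_const_mul, ← integral_add hPi ((hInt κ).const_mul _)]
    congr 1; funext x
    rw [resProfile_eq κ t _ (hspos x)]
  rw [hsplit]
  refine (abs_add_le _ _).trans ?_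
  rw [abs_mul]
  have h3 := oscAmp_sin_le hr ht
  rw [← hR, ← hE, ← hb] at h3
  have h4 : |b / 2| * |∫ x : ℝ, Real.sin (κ * Real.sqrt (r ^ 2 + x ^ 2))
      / Real.sqrt (r ^ 2 + x ^ 2) * oscAmp b (Real.sqrt (r ^ 2 + x ^ 2))| ≤ 240 * E / R := by
    calc _ ≤ |b / 2| * (6 * oscAmp b r) := by gcongr
      _ = 3 * (|b| * oscAmp b r) := by rw [abs_div, abs_of_pos (by norm_num : (0:ℝ) < 2)]; ring
      _ ≤ 3 * (80 * E / R) := by gcongr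
      _ = _ := by ring
  have h5 : 50 * E * (π / R) ≤ 160 * E / R := by
    rw [mul_div_assoc', div_le_div_iff_of_pos_right hRpos]
    have : 0 < E := Real.exp_pos _
    nlinarith [Real.pi_lt_d2]
  calc _ ≤ 160 * E / R + 240 * E / R := add_le_add (hPint.trans h5) h4
    _ = _ := by ring

/-! ### Fourier coefficients of the profile in the periodic variable -/

lemma setIntegral_exp_int (m : ℤ) :
    ∫ t in Set.Ioo (-π) π, Complex.exp (Complex.I * (m : ℂ) * (t : ℂ)) =
      if m = 0 then 2 * (π : ℂ) else 0 := by
  rw [← integral_Ioc_eq_integral_Ioo,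
    ← intervalIntegral.integral_of_le (by linarith [Real.pi_pos])]
  split_ifs with h
  · subst h; simp; ring
  · have hm : (Complex.I * (m : ℂ)) ≠ 0 := mul_ne_zero Complex.I_ne_zero (by exact_mod_cast h)
    rw [integral_exp_mul_complex hm]
    have e : Complex.exp (Complex.I * (m : ℂ) * (π : ℝ)) =
        Complex.exp (Complex.I * (m : ℂ) * ((-π : ℝ) : ℂ)) := by
      rw [Complex.exp_eq_exp_iff_exists_int]
      exact ⟨m, by push_cast; ring⟩
    rw [e, sub_self, zero_div]

/-- The terms of the exponential expansion of `2 s · resProfile`. -/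
def profileTerm (κ s : ℝ) (j : ℕ) (t : ℝ) : ℂ :=
  Complex.exp (-((j : ℂ) + 1 / 2) * s) *
    (Complex.exp (-Complex.I * κ * s) * Complex.exp (Complex.I * ((j : ℂ) + 1 / 2) * t)
      + Complex.exp (Complex.I * κ * s) * Complex.exp (-Complex.I * ((j : ℂ) + 1 / 2) * t))

lemma HasSum.congr_of_eq {f g : ℕ → ℂ} {x y : ℂ} (h : HasSum f x) (hf : ∀ j, g j = f j)
    (hxy : y = x) : HasSum g y := by
  rw [funext hf, hxy]; exact h

lemma hasSum_exp_half {w : ℂ} (hw : 0 < w.re) :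
    HasSum (fun j : ℕ => Complex.exp (-((j : ℂ) + 1 / 2) * w)) (1 / (2 * Complex.sinh (w / 2))) := by
  have hq : ‖Complex.exp (-w)‖ < 1 := by
    rw [Complex.norm_exp]; simpa using hw
  have h := (hasSum_geometric_of_norm_lt_one hq).mul_left (Complex.exp (-(w / 2)))
  refine h.congr_of_eq (fun j => ?_) ?_
  · rw [← Complex.exp_nat_mul, ← Complex.exp_add]; congr 1; ring
  · have h1 : (1 - Complex.exp (-w)) = Complex.exp (-(w / 2)) * (2 * Complex.sinh (w / 2)) := by
      rw [Complex.sinh, mul_div_cancel₀ _ two_ne_zero, mul_sub, ← Complex.exp_add,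
        ← Complex.exp_add]
      congr 1
      · simp
      · congr 1; ring
    rw [h1, mul_inv, ← mul_assoc, mul_inv_cancel₀ (Complex.exp_ne_zero _)]
    simp

lemma hasSum_profileTerm (κ t : ℝ) {s : ℝ} (hs : 0 < s) :
    HasSum (fun j => profileTerm κ s j t) ((2 * s * resProfile κ t s : ℝ) : ℂ) := by
  have h1 := (hasSum_exp_half (w := (s : ℂ) - Complex.I * t) (by simpa using hs)).mul_left
    (Complex.exp (-Complex.I * κ * s))
  have h2 := (hasSum_exp_half (w := (s : ℂ) + Complex.I * t) (by simpa using hs)).mul_left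
    (Complex.exp (Complex.I * κ * s))
  refine (h1.add h2).congr_of_eq (fun j => ?_) ?_
  · unfold profileTerm
    rw [mul_add]
    congr 1
    · rw [← Complex.exp_add, ← Complex.exp_add, ← Complex.exp_add]; congr 1; ring
    · rw [← Complex.exp_add, ← Complex.exp_add, ← Complex.exp_add]; congr 1; ring
  · have hsh : 0 < Real.sinh (s / 2) := Real.sinh_pos_iff.2 (by linarith)
    set S : ℝ := Real.sinh (s / 2) with hS
    set Ch : ℝ := Real.cosh (s / 2) with hCh
    set c : ℝ := Real.cos (t / 2) with hc
    set d : ℝ := Real.sin (t / 2) with hd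
    have hrel : S ^ 2 + d ^ 2 = S ^ 2 * c ^ 2 + Ch ^ 2 * d ^ 2 := by
      have e1 := Real.cosh_sq (s / 2)
      have e2 := Real.sin_sq_add_cos_sq (t / 2)
      rw [← hS, ← hCh] at e1; rw [← hc, ← hd] at e2
      rw [e1]; linear_combination (-S ^ 2) * e2
    have a1 : Complex.sinh (((s : ℂ) - Complex.I * t) / 2) = S * c - Ch * d * Complex.I := by
      rw [show ((s : ℂ) - Complex.I * t) / 2 = ((s / 2 : ℝ) : ℂ) - ((t / 2 : ℝ) : ℂ) * Complex.I by
        push_cast; ring, Complex.sinh_sub, Complex.cosh_mul_I, Complex.sinh_mul_I]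
      rw [← Complex.ofReal_sinh, ← Complex.ofReal_cosh, ← Complex.ofReal_sin, ← Complex.ofReal_cos]
      ring
    have a2 : Complex.sinh (((s : ℂ) + Complex.I * t) / 2) = S * c + Ch * d * Complex.I := by
      rw [show ((s : ℂ) + Complex.I * t) / 2 = ((s / 2 : ℝ) : ℂ) + ((t / 2 : ℝ) : ℂ) * Complex.I by
        push_cast; ring, Complex.sinh_add, Complex.cosh_mul_I, Complex.sinh_mul_I]
      rw [← Complex.ofReal_sinh, ← Complex.ofReal_cosh, ← Complex.ofReal_sin, ← Complex.ofReal_cos]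
      ring
    have e1 : Complex.exp (-Complex.I * κ * s) =
        Real.cos (κ * s) - Real.sin (κ * s) * Complex.I := by
      rw [show -Complex.I * κ * s = ((-(κ * s) : ℝ) : ℂ) * Complex.I by push_cast; ring,
        Complex.exp_mul_I, ← Complex.ofReal_cos, ← Complex.ofReal_sin, Real.cos_neg, Real.sin_neg]
      push_cast; ring
    have e2 : Complex.exp (Complex.I * κ * s) =
        Real.cos (κ * s) + Real.sin (κ * s) * Complex.I := by
      rw [show Complex.I * κ * s = ((κ * s : ℝ) : ℂ) * Complex.I by push_cast; ring,
        Complex.exp_mul_I, ← Complex.ofReal_cos, ← Complex.ofReal_sin]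
    have hD : (0 : ℝ) < S ^ 2 + d ^ 2 := by positivity
    have hprod : ((S : ℂ) * c - Ch * d * Complex.I) * (S * c + Ch * d * Complex.I) =
        ((S ^ 2 + d ^ 2 : ℝ) : ℂ) := by
      rw [hrel]; push_cast; linear_combination (-(Ch : ℂ) ^ 2 * d ^ 2) * Complex.I_sq
    have hne : ((S ^ 2 + d ^ 2 : ℝ) : ℂ) ≠ 0 := by exact_mod_cast hD.ne'
    have hz1 : ((S : ℂ) * c - Ch * d * Complex.I) ≠ 0 := fun h => by
      rw [h, zero_mul] at hprod; exact hne hprod.symm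
    have hz2 : ((S : ℂ) * c + Ch * d * Complex.I) ≠ 0 := fun h => by
      rw [h, mul_zero] at hprod; exact hne hprod.symm
    rw [a1, a2, e1, e2]
    have hval : 2 * s * resProfile κ t s =
        (Real.cos (κ * s) * S * c + Real.sin (κ * s) * Ch * d) / (S ^ 2 + d ^ 2) := by
      unfold resProfile
      rw [← hS, ← hCh, ← hc, ← hd]
      field_simp
    rw [hval, Complex.ofReal_div, ← hprod]
    field_simp
    push_cast
    linear_combination (2 * Complex.sin (κ * s) * Ch * d) * Complex.I_sq

lemma setIntegral_resProfile (κ : ℝ) (l : ℤ) {s : ℝ} (hs : 0 < s) {μ : ℂ}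
    (hμ : μ = if 0 ≤ l then ((l : ℂ) + 1 / 2) + Complex.I * κ
      else -(((l : ℂ) + 1 / 2) + Complex.I * κ)) :
    ∫ t in Set.Ioo (-π) π, (resProfile κ t s : ℂ) *
        Complex.exp (-Complex.I * ((l : ℂ) + 1 / 2) * t) =
      (π / s : ℝ) * Complex.exp (-μ * s) := by
  set F : ℕ → ℝ → ℂ := fun j t => profileTerm κ s j t *
    Complex.exp (-Complex.I * ((l : ℂ) + 1 / 2) * t) with hF
  have hcont : ∀ j, Continuous (F j) := fun j => by
    simp only [hF, profileTerm]; fun_prop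
  have hInt : ∀ j, Integrable (F j) (volume.restrict (Set.Ioo (-π) π)) := fun j =>
    ((hcont j).integrableOn_Icc (a := -π) (b := π)).mono_set Set.Ioo_subset_Icc_self
  have hnorm : ∀ j t, ‖F j t‖ ≤ 2 * Real.exp (-(s / 2)) * Real.exp (-s) ^ j := by
    intro j t
    simp only [hF, profileTerm]
    rw [norm_mul, norm_mul]
    have n1 : ∀ x : ℝ, ∀ z : ℂ, z = x * Complex.I → ‖Complex.exp z‖ = 1 := by
      rintro x z rfl; exact Complex.norm_exp_ofReal_mul_I x
    rw [n1 (-(l + 1 / 2) * t) (-Complex.I * ((l : ℂ) + 1 / 2) * t) (by push_cast; ring), mul_one]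
    have n2 : ‖Complex.exp (-((j : ℂ) + 1 / 2) * s)‖ = Real.exp (-(s / 2)) * Real.exp (-s) ^ j := by
      rw [← Real.exp_nat_mul, ← Real.exp_add, Complex.norm_exp]
      congr 1
      rw [show -((j : ℂ) + 1 / 2) * s = ((-(j + 1 / 2) * s : ℝ) : ℂ) by push_cast; ring,
        Complex.ofReal_re]
      ring
    rw [n2]
    have n3 : ‖Complex.exp (-Complex.I * κ * s) * Complex.exp (Complex.I * ((j : ℂ) + 1 / 2) * t)
      + Complex.exp (Complex.I * κ * s) * Complex.exp (-Complex.I * ((j : ℂ) + 1 / 2) * t)‖ ≤ 2 := by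
      refine (norm_add_le _ _).trans ?_
      rw [norm_mul, norm_mul, n1 (-κ * s) _ (by push_cast; ring),
        n1 ((j + 1 / 2) * t) _ (by push_cast; ring), n1 (κ * s) _ (by push_cast; ring),
        n1 (-(j + 1 / 2) * t) _ (by push_cast; ring)]
      norm_num
    calc _ ≤ Real.exp (-(s / 2)) * Real.exp (-s) ^ j * 2 := by gcongr
      _ = _ := by ring
  have hsum : Summable fun j => ∫ t, ‖F j t‖ ∂(volume.restrict (Set.Ioo (-π) π)) := by
    have hg : Summable fun j : ℕ => 2 * Real.exp (-(s / 2)) * Real.exp (-s) ^ j * (2 * π) :=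
      ((summable_geometric_of_lt_one (Real.exp_pos _).le
        (by simpa using hs)).mul_left _).mul_right _
    refine Summable.of_nonneg_of_le (fun j => integral_nonneg fun t => norm_nonneg _) ?_ hg
    intro j
    calc _ ≤ ∫ t in Set.Ioo (-π) π, 2 * Real.exp (-(s / 2)) * Real.exp (-s) ^ j :=
          integral_mono (hInt j).norm (integrable_const _) (fun t => hnorm j t)
      _ = _ := by
        rw [setIntegral_const]
        simp only [Measure.real, Real.volume_Ioo, smul_eq_mul]
        rw [ENNReal.toReal_ofReal (by linarith [Real.pi_pos])]; ring
  have key := hasSum_integral_of_summable_integral_norm hInt hsum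
  have hval : ∀ j, ∫ t in Set.Ioo (-π) π, F j t =
      Complex.exp (-((j : ℂ) + 1 / 2) * s) *
        (Complex.exp (-Complex.I * κ * s) * (if (j : ℤ) - l = 0 then 2 * (π : ℂ) else 0)
        + Complex.exp (Complex.I * κ * s) * (if -(j : ℤ) - 1 - l = 0 then 2 * (π : ℂ) else 0)) := by
    intro j
    rw [← setIntegral_exp_int, ← setIntegral_exp_int, ← integral_const_mul, ← integral_const_mul,
      ← integral_add, ← integral_const_mul]
    · congr 1; funext t
      simp only [hF, profileTerm]
      rw [mul_add (Complex.exp _), add_mul _ _ (Complex.exp _), mul_add (Complex.exp _)]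
      simp only [← Complex.exp_add]
      push_cast
      ring_nf
    · exact (Continuous.integrableOn_Icc (by fun_prop) (a := -π) (b := π)).mono_set
        Set.Ioo_subset_Icc_self
    · exact (Continuous.integrableOn_Icc (by fun_prop) (a := -π) (b := π)).mono_set
        Set.Ioo_subset_Icc_self
  have htsum : ∀ t, ∑' j, F j t = ((2 * s * resProfile κ t s : ℝ) : ℂ) *
      Complex.exp (-Complex.I * ((l : ℂ) + 1 / 2) * t) := fun t =>
    ((hasSum_profileTerm κ t hs).mul_right _).tsum_eq
  simp_rw [htsum, hval] at key
  have hmain : (∫ t in Set.Ioo (-π) π, ((2 * s * resProfile κ t s : ℝ) : ℂ) *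
      Complex.exp (-Complex.I * ((l : ℂ) + 1 / 2) * t)) = 2 * π * Complex.exp (-μ * s) := by
    rcases le_or_gt 0 l with hl | hl
    · obtain ⟨m, rfl⟩ := Int.eq_ofNat_of_zero_le hl
      rw [if_pos hl] at hμ
      refine key.unique ?_
      convert hasSum_single m ?_ using 1
      · simp only [sub_self, if_true]
        rw [if_neg (by omega), hμ, mul_zero, add_zero, ← mul_assoc, ← Complex.exp_add, mul_comm]
        congr 2; push_cast; ring
      · intro j hj
        rw [if_neg (by omega), if_neg (by omega)]; simp
    · obtain ⟨m, hm⟩ := Int.eq_ofNat_of_zero_le (show 0 ≤ -l - 1 by omega)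
      rw [if_neg (by omega)] at hμ
      refine key.unique ?_
      convert hasSum_single m ?_ using 1
      · have hl' : l = -(m : ℤ) - 1 := by omega
        rw [if_neg (by omega), if_pos (by omega), hμ, mul_zero, zero_add, ← mul_assoc,
          ← Complex.exp_add, mul_comm, hl']
        congr 2; push_cast; ring
      · intro j hj
        rw [if_neg (by omega), if_neg (by omega)]; simp
  have e : ∀ t, (resProfile κ t s : ℂ) * Complex.exp (-Complex.I * ((l : ℂ) + 1 / 2) * t) =
      (1 / (2 * s) : ℂ) * (((2 * s * resProfile κ t s : ℝ) : ℂ) *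
      Complex.exp (-Complex.I * ((l : ℂ) + 1 / 2) * t)) := fun t => by
    have : (s : ℂ) ≠ 0 := by exact_mod_cast hs.ne'
    push_cast; field_simp
  simp_rw [e]
  rw [integral_const_mul, hmain]
  have : (s : ℂ) ≠ 0 := by exact_mod_cast hs.ne'
  push_cast; field_simp

/-! ### The Fourier transform of the Yukawa potential -/

instance : (volume : Measure (ℂ × ℝ)).IsAddHaarMeasure :=
  inferInstanceAs ((volume : Measure ℂ).prod (volume : Measure ℝ)).IsAddHaarMeasure

/-- The Euclidean radius on `ℂ × ℝ`. -/
def radius (X : ℂ × ℝ) : ℝ := Real.sqrt (‖X.1‖ ^ 2 + X.2 ^ 2)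

lemma measurable_radius : Measurable radius := by unfold radius; fun_prop

lemma norm_le_radius (X : ℂ × ℝ) : ‖X‖ ≤ radius X := by
  unfold radius
  rw [Prod.norm_def]
  apply max_le
  · exact Real.le_sqrt_of_sq_le (by nlinarith [sq_nonneg X.2])
  · rw [Real.norm_eq_abs]; exact Real.abs_le_sqrt (by nlinarith [sq_nonneg ‖X.1‖])

lemma integrable_exp_div_sq {c : ℝ} (hc : 0 < c) :
    Integrable (fun X : ℂ × ℝ => Real.exp (-(c * ‖X‖)) / ‖X‖ ^ 2) := by
  rw [integrable_fun_norm_addHaar volume (f := fun y => Real.exp (-(c * y)) / y ^ 2)]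
  have hd : Module.finrank ℝ (ℂ × ℝ) = 3 := by
    rw [Module.finrank_prod, Complex.finrank_real_complex, Module.finrank_self]
  rw [hd]
  refine (exp_neg_integrableOn_Ioi 0 hc).congr_fun (fun y hy => ?_) measurableSet_Ioi
  have : (0 : ℝ) < y := hy
  simp only [Nat.add_one_sub_one, smul_eq_mul, neg_mul]
  field_simp

lemma integrable_exp_radius_div_sq {c : ℝ} (hc : 0 < c) :
    Integrable (fun X : ℂ × ℝ => Real.exp (-(c * radius X)) / radius X ^ 2) := by
  have := measurable_radius
  refine (integrable_exp_div_sq hc).mono' (Measurable.aestronglyMeasurable (by fun_prop)) ?_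
  filter_upwards with X
  rw [Real.norm_eq_abs, abs_of_nonneg (by positivity)]
  have h := norm_le_radius X
  rcases (norm_nonneg X).eq_or_lt with h0 | h0
  · have : X = 0 := norm_eq_zero.1 h0.symm
    subst this; simp [radius]
  · gcongr

lemma integral_radial_yukawa {μ : ℂ} (hμ : 0 < μ.re) (a : ℝ) :
    ∫ R in Set.Ioi (0 : ℝ), (R : ℂ) * (Complex.exp (-μ * Real.sqrt (a ^ 2 + R ^ 2)) /
      (Real.sqrt (a ^ 2 + R ^ 2) : ℝ)) = Complex.exp (-μ * |a|) / μ := by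
  have hμ0 : μ ≠ 0 := fun h => by simp [h] at hμ
  have hpos : ∀ R : ℝ, 0 < R → 0 < Real.sqrt (a ^ 2 + R ^ 2) := fun R hR => by positivity
  have hder : ∀ R ∈ Set.Ioi (0 : ℝ), HasDerivAt
      (fun R : ℝ => -(Complex.exp (-μ * Real.sqrt (a ^ 2 + R ^ 2)) / μ))
      ((R : ℂ) * (Complex.exp (-μ * Real.sqrt (a ^ 2 + R ^ 2)) /
      (Real.sqrt (a ^ 2 + R ^ 2) : ℝ))) R := by
    intro R hR
    have hR' : (0 : ℝ) < R := hR
    have h1 : HasDerivAt (fun R : ℝ => Real.sqrt (a ^ 2 + R ^ 2))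
        (R / Real.sqrt (a ^ 2 + R ^ 2)) R := by
      have h : HasDerivAt (fun x : ℝ => a ^ 2 + x ^ 2) (2 * R) R := by
        simpa using ((hasDerivAt_pow 2 R).const_add (a ^ 2))
      refine (h.sqrt (by positivity)).congr_deriv ?_
      field_simp
    have h2 := (((h1.ofReal_comp).const_mul (-μ)).cexp.div_const μ).neg
    refine h2.congr_deriv ?_
    have := hpos R hR'
    have h3 : ((Real.sqrt (a ^ 2 + R ^ 2) : ℝ) : ℂ) ≠ 0 := by exact_mod_cast this.ne'
    push_cast
    field_simp
  have hInt : IntegrableOn (fun R : ℝ => (R : ℂ) * (Complex.exp (-μ * Real.sqrt (a ^ 2 + R ^ 2)) /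
      (Real.sqrt (a ^ 2 + R ^ 2) : ℝ))) (Set.Ioi 0) := by
    refine Integrable.mono' (exp_neg_integrableOn_Ioi 0 hμ)
      (Measurable.aestronglyMeasurable (by fun_prop)) ?_
    filter_upwards [ae_restrict_mem measurableSet_Ioi] with R hR
    have hR' : (0 : ℝ) < R := hR
    have hs := hpos R hR'
    have hle : R ≤ Real.sqrt (a ^ 2 + R ^ 2) := Real.le_sqrt_of_sq_le (by nlinarith [sq_nonneg a])
    rw [norm_mul, norm_div, Complex.norm_real, Complex.norm_real, Real.norm_eq_abs,
      Real.norm_eq_abs, abs_of_pos hR', abs_of_pos hs, Complex.norm_exp]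
    rw [show (-μ * (Real.sqrt (a ^ 2 + R ^ 2) : ℝ)).re = -μ.re * Real.sqrt (a ^ 2 + R ^ 2) by
      simp]
    rw [mul_div_assoc', div_le_iff₀ hs, mul_comm]
    apply mul_le_mul _ hle hR'.le (Real.exp_pos _).le
    apply Real.exp_le_exp.2
    nlinarith
  have hlim : Tendsto (fun R : ℝ => -(Complex.exp (-μ * Real.sqrt (a ^ 2 + R ^ 2)) / μ)) atTop
      (nhds 0) := by
    have h1 : Tendsto (fun R : ℝ => Real.exp (-μ.re * R) / ‖μ‖) atTop (nhds 0) := by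
      have : Tendsto (fun R : ℝ => Real.exp (-μ.re * R)) atTop (nhds 0) :=
        Real.tendsto_exp_atBot.comp (tendsto_id.const_mul_atTop_of_neg (by linarith))
      simpa using this.div_const ‖μ‖
    refine squeeze_zero_norm' ?_ h1
    filter_upwards [eventually_gt_atTop 0] with R hR
    have hle : R ≤ Real.sqrt (a ^ 2 + R ^ 2) := Real.le_sqrt_of_sq_le (by nlinarith [sq_nonneg a])
    rw [norm_neg, norm_div, Complex.norm_exp]
    rw [show (-μ * (Real.sqrt (a ^ 2 + R ^ 2) : ℝ)).re = -μ.re * Real.sqrt (a ^ 2 + R ^ 2) by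
      simp]
    gcongr ?_ / _
    apply Real.exp_le_exp.2
    nlinarith
  have h := integral_Ioi_of_hasDerivAt_of_tendsto
    (Continuous.continuousWithinAt (by fun_prop)) hder hInt hlim
  rw [h]
  simp [Real.sqrt_sq_eq_abs]

lemma integral_plane_yukawa {μ : ℂ} (hμ : 0 < μ.re) (a : ℝ) :
    ∫ p : ℝ × ℝ, Complex.exp (-μ * Real.sqrt (a ^ 2 + (p.1 ^ 2 + p.2 ^ 2))) /
      (Real.sqrt (a ^ 2 + (p.1 ^ 2 + p.2 ^ 2)) : ℝ) = 2 * π / μ * Complex.exp (-μ * |a|) := by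
  rw [← integral_comp_polarCoord_symm, polarCoord_target]
  have e : ∀ p : ℝ × ℝ, (p.1 • (Complex.exp (-μ * Real.sqrt (a ^ 2 +
      ((polarCoord.symm p).1 ^ 2 + (polarCoord.symm p).2 ^ 2))) /
      (Real.sqrt (a ^ 2 + ((polarCoord.symm p).1 ^ 2 + (polarCoord.symm p).2 ^ 2)) : ℝ)) : ℂ) =
      ((p.1 : ℂ) * (Complex.exp (-μ * Real.sqrt (a ^ 2 + p.1 ^ 2)) /
      (Real.sqrt (a ^ 2 + p.1 ^ 2) : ℝ))) * (fun _ : ℝ => (1 : ℂ)) p.2 := by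
    intro p
    have : (polarCoord.symm p).1 ^ 2 + (polarCoord.symm p).2 ^ 2 = p.1 ^ 2 := by
      rw [polarCoord_symm_apply]
      simp only
      linear_combination p.1 ^ 2 * Real.sin_sq_add_cos_sq p.2
    rw [this, Complex.real_smul, mul_one]
  simp_rw [e]
  rw [Measure.volume_eq_prod, setIntegral_prod_mul (fun R : ℝ => (R : ℂ) *
    (Complex.exp (-μ * Real.sqrt (a ^ 2 + R ^ 2)) / (Real.sqrt (a ^ 2 + R ^ 2) : ℝ)))
    (fun _ : ℝ => (1 : ℂ)), integral_radial_yukawa hμ, setIntegral_const]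
  simp only [Measure.real, Real.volume_Ioo]
  rw [ENNReal.toReal_ofReal (by linarith [Real.pi_pos]), Complex.real_smul]
  push_cast; ring

lemma integral_exp_abs_fourier {μ : ℂ} (hμ : 0 < μ.re) (h : ℝ) :
    ∫ a : ℝ, Complex.exp (-μ * |a|) * Complex.exp (-Complex.I * (h * a)) =
      2 * μ / (μ ^ 2 + h ^ 2) := by
  have hr1 : (-(μ + Complex.I * h)).re < 0 := by simpa using hμ
  have hr2 : 0 < (μ - Complex.I * h).re := by simpa using hμ
  have e1 : ∀ a ∈ Set.Ioi (0 : ℝ), Complex.exp (-μ * |a|) * Complex.exp (-Complex.I * (h * a)) =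
      Complex.exp (-(μ + Complex.I * h) * a) := fun a ha => by
    rw [abs_of_pos ha, ← Complex.exp_add]; congr 1; ring
  have e2 : ∀ a ∈ Set.Iic (0 : ℝ), Complex.exp (-μ * |a|) * Complex.exp (-Complex.I * (h * a)) =
      Complex.exp ((μ - Complex.I * h) * a) := fun a ha => by
    rw [abs_of_nonpos ha, ← Complex.exp_add]; congr 1; push_cast; ring
  rw [← intervalIntegral.integral_Iic_add_Ioi (b := 0)
    ((integrableOn_exp_mul_complex_Iic hr2 0).congr_fun (fun a ha => (e2 a ha).symm)
      measurableSet_Iic)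
    ((integrableOn_exp_mul_complex_Ioi hr1 0).congr_fun (fun a ha => (e1 a ha).symm)
      measurableSet_Ioi), setIntegral_congr_fun measurableSet_Ioi e1,
    setIntegral_congr_fun measurableSet_Iic e2, integral_exp_mul_complex_Ioi hr1,
    integral_exp_mul_complex_Iic hr2]
  have n1 : μ + Complex.I * h ≠ 0 := fun h0 => by
    rw [h0] at hr1; simp at hr1
  have n2 : μ - Complex.I * h ≠ 0 := fun h0 => by
    rw [h0] at hr2; simp at hr2
  have n3 : μ ^ 2 + (h : ℂ) ^ 2 = (μ + Complex.I * h) * (μ - Complex.I * h) := by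
    linear_combination ((h : ℂ) ^ 2) * Complex.I_sq
  rw [n3]
  simp only [Complex.ofReal_zero, mul_zero, Complex.exp_zero]
  rw [neg_div_neg_eq]
  field_simp
  ring

lemma exp_radius_bound {c s : ℝ} (hc : 0 < c) (hs : 0 ≤ s) :
    Real.exp (-(c * s)) / s ≤ 2 / c * (Real.exp (-(c / 2 * s)) / s ^ 2) := by
  rcases hs.eq_or_lt with rfl | hs
  · simp
  have h1 : c / 2 * s ≤ Real.exp (c / 2 * s) := by
    linarith [Real.add_one_le_exp (c / 2 * s)]
  have h2 : Real.exp (-(c * s)) = Real.exp (-(c / 2 * s)) * Real.exp (-(c / 2 * s)) := by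
    rw [← Real.exp_add]; congr 1; ring
  have h3 : Real.exp (-(c / 2 * s)) * Real.exp (c / 2 * s) = 1 := by
    rw [← Real.exp_add]; simp
  have h4 : (c / 2 * s) * Real.exp (-(c / 2 * s)) ≤ 1 := by
    rw [← h3, mul_comm]; gcongr
  have h5 : Real.exp (-(c / 2 * s)) ≤ 2 / (c * s) := by
    rw [le_div_iff₀ (by positivity)]; linarith
  rw [h2]
  calc _ ≤ Real.exp (-(c / 2 * s)) * (2 / (c * s)) / s := by gcongr
    _ = _ := by field_simp

lemma integrable_yukawa {μ : ℂ} (hμ : 0 < μ.re) (η : ℂ) :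
    Integrable (fun X : ℂ × ℝ => Complex.exp (-μ * radius X) / (radius X : ℝ) *
      Complex.exp (-Complex.I * (((starRingEnd ℂ) η * X.1).re : ℝ))) := by
  have := measurable_radius
  refine ((integrable_exp_radius_div_sq (half_pos hμ)).const_mul (2 / μ.re)).mono'
    (Measurable.aestronglyMeasurable (by fun_prop)) ?_
  filter_upwards with X
  have h0 : 0 ≤ radius X := Real.sqrt_nonneg _
  have n1 : ∀ x : ℝ, ‖Complex.exp (-Complex.I * x)‖ = 1 := fun x => by
    rw [Complex.norm_exp]; simp
  rw [norm_mul, n1, mul_one, norm_div, Complex.norm_real, Complex.norm_exp, Real.norm_eq_abs,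
    abs_of_nonneg h0]
  have := exp_radius_bound hμ h0
  simpa using this

lemma integral_yukawa_real {μ : ℂ} (hμ : 0 < μ.re) (h : ℝ) :
    ∫ X : ℂ × ℝ, Complex.exp (-μ * radius X) / (radius X : ℝ) *
      Complex.exp (-Complex.I * (((starRingEnd ℂ) (h : ℂ) * X.1).re : ℝ)) =
      4 * π / (μ ^ 2 + h ^ 2) := by
  have hμ0 : μ ≠ 0 := fun h => by simp [h] at hμ
  set G : ℝ × (ℝ × ℝ) → ℂ := fun q => Complex.exp (-Complex.I * (h * q.1)) *
    (Complex.exp (-μ * Real.sqrt (q.1 ^ 2 + (q.2.1 ^ 2 + q.2.2 ^ 2))) /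
      (Real.sqrt (q.1 ^ 2 + (q.2.1 ^ 2 + q.2.2 ^ 2)) : ℝ)) with hG
  have mp : MeasurePreserving (Complex.measurableEquivRealProd.prodCongr
      (MeasurableEquiv.refl ℝ)) (volume : Measure (ℂ × ℝ)) (volume : Measure ((ℝ × ℝ) × ℝ)) :=
    Complex.volume_preserving_equiv_real_prod.prod (MeasurePreserving.id volume)
  have mp2 : MeasurePreserving (MeasurableEquiv.prodAssoc : (ℝ × ℝ) × ℝ ≃ᵐ ℝ × (ℝ × ℝ))
      (volume : Measure ((ℝ × ℝ) × ℝ)) (volume : Measure (ℝ × (ℝ × ℝ))) :=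
    measurePreserving_prodAssoc volume volume volume
  have mp3 := mp.trans mp2
  have e : (fun X : ℂ × ℝ => Complex.exp (-μ * radius X) / (radius X : ℝ) *
      Complex.exp (-Complex.I * (((starRingEnd ℂ) (h : ℂ) * X.1).re : ℝ))) =
      G ∘ ((Complex.measurableEquivRealProd.prodCongr (MeasurableEquiv.refl ℝ)).trans
        MeasurableEquiv.prodAssoc) := by
    funext X
    have : ‖X.1‖ ^ 2 + X.2 ^ 2 = X.1.re ^ 2 + (X.1.im ^ 2 + X.2 ^ 2) := by
      rw [Complex.sq_norm, Complex.normSq_apply]; ring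
    simp only [hG, Function.comp]
    rw [mul_comm, radius, this]
    have e0 : ((Complex.measurableEquivRealProd.prodCongr (MeasurableEquiv.refl ℝ)).trans
        MeasurableEquiv.prodAssoc) X = (X.1.re, (X.1.im, X.2)) := rfl
    rw [e0]
    congr 3
    simp
  have hGi : Integrable G := by
    have := integrable_yukawa hμ (h : ℂ)
    rw [e] at this
    exact (mp3.integrable_comp_emb (MeasurableEquiv.measurableEmbedding _)).1 this
  have h1 : (∫ X : ℂ × ℝ, Complex.exp (-μ * radius X) / (radius X : ℝ) *
      Complex.exp (-Complex.I * (((starRingEnd ℂ) (h : ℂ) * X.1).re : ℝ))) = ∫ q, G q := by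
    rw [e]; exact mp3.integral_comp' G
  rw [h1, Measure.volume_eq_prod, integral_prod _ hGi]
  simp only [hG]
  simp_rw [integral_const_mul, integral_plane_yukawa hμ]
  have e3 : ∀ a : ℝ, Complex.exp (-Complex.I * (h * a)) * (2 * π / μ * Complex.exp (-μ * |a|)) =
      2 * π / μ * (Complex.exp (-μ * |a|) * Complex.exp (-Complex.I * (h * a))) := fun a => by ring
  simp_rw [e3]
  rw [integral_const_mul, integral_exp_abs_fourier hμ]
  field_simp
  norm_num

lemma integral_yukawa {μ : ℂ} (hμ : 0 < μ.re) (η : ℂ) :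
    ∫ X : ℂ × ℝ, Complex.exp (-μ * radius X) / (radius X : ℝ) *
      Complex.exp (-Complex.I * (((starRingEnd ℂ) η * X.1).re : ℝ)) =
      4 * π / (μ ^ 2 + (‖η‖ : ℝ) ^ 2) := by
  obtain ⟨u, hu⟩ : ∃ u : Circle, (u : ℂ) * (‖η‖ : ℝ) = η := by
    refine ⟨Circle.exp η.arg, ?_⟩
    rw [Circle.coe_exp, mul_comm]; exact Complex.norm_mul_exp_arg_mul_I η
  have mp : MeasurePreserving ((rotation u).toHomeomorph.toMeasurableEquiv.prodCongr
      (MeasurableEquiv.refl ℝ)) (volume : Measure (ℂ × ℝ)) (volume : Measure (ℂ × ℝ)) :=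
    (LinearIsometryEquiv.measurePreserving (rotation u)).prod (MeasurePreserving.id volume)
  rw [← integral_yukawa_real hμ, ← mp.integral_comp']
  congr 1; funext X
  have e1 : ((rotation u).toHomeomorph.toMeasurableEquiv.prodCongr
      (MeasurableEquiv.refl ℝ)) X = ((u : ℂ) * X.1, X.2) := rfl
  rw [e1]
  have e2 : radius ((u : ℂ) * X.1, X.2) = radius X := by
    have hn : ‖(u : ℂ)‖ = 1 := mem_sphere_zero_iff_norm.1 u.2
    simp only [radius, norm_mul, hn, one_mul]
  rw [e2]
  congr 4
  have hu1 : (starRingEnd ℂ) (u : ℂ) * (u : ℂ) = 1 := by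
    rw [mul_comm, Complex.mul_conj, Circle.normSq_coe]; simp
  conv_lhs => rw [← hu]
  simp only [map_mul]
  rw [show (starRingEnd ℂ) (u : ℂ) * (starRingEnd ℂ) ((‖η‖ : ℝ) : ℂ) * ((u : ℂ) * X.1) =
    ((starRingEnd ℂ) (u : ℂ) * (u : ℂ)) * ((starRingEnd ℂ) ((‖η‖ : ℝ) : ℂ) * X.1) by ring, hu1,
    one_mul]

/-! ### The Fourier transform of the cylinder kernel -/

/-- Lebesgue measure on the cylinder `(-π, π) × ℂ`. -/
def stripMeasure : Measure (ℝ × ℂ) :=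
  (volume.restrict (Set.Ioo (-π) π)).prod volume

instance : SFinite stripMeasure := by unfold stripMeasure; infer_instance

lemma radius_nonneg (X : ℂ × ℝ) : 0 ≤ radius X := Real.sqrt_nonneg _

lemma resProfile_zero (κ t : ℝ) : resProfile κ t 0 = 0 := by
  unfold resProfile; simp

/-- The character on the cylinder. -/
def cylChar (l : ℤ) (η : ℂ) (p : ℝ × ℂ) : ℂ :=
  Complex.exp (-Complex.I * ((l : ℂ) + 1 / 2) * p.1) *
    Complex.exp (-Complex.I * (((starRingEnd ℂ) η * p.2).re : ℝ))

lemma norm_cylChar (l : ℤ) (η : ℂ) (p : ℝ × ℂ) : ‖cylChar l η p‖ = 1 := by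
  unfold cylChar
  rw [norm_mul, Complex.norm_exp, Complex.norm_exp]
  simp

lemma integrable_profile_char (κ : ℝ) (l : ℤ) (η : ℂ) :
    Integrable (fun q : ℝ × (ℂ × ℝ) => (resProfile κ q.1 (radius q.2) : ℂ) *
      cylChar l η (q.1, q.2.1)) ((volume.restrict (Set.Ioo (-π) π)).prod volume) := by
  have hr := measurable_radius
  have hp : Measurable (fun q : ℝ × (ℂ × ℝ) => resProfile κ q.1 (radius q.2)) :=
    Measurable.comp (g := fun p : ℝ × ℝ => resProfile κ p.1 p.2)
      (f := fun q : ℝ × (ℂ × ℝ) => (q.1, radius q.2)) (measurable_resProfile κ)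
      (measurable_fst.prodMk (Measurable.comp (g := radius) hr measurable_snd))
  have hc : Measurable (fun q : ℝ × (ℂ × ℝ) => cylChar l η (q.1, q.2.1)) := by
    unfold cylChar; fun_prop
  have hd := (((integrable_exp_radius_div_sq (c := 1 / 4) (by norm_num)).const_mul 90).comp_snd
    (volume.restrict (Set.Ioo (-π) π)))
  refine hd.mono' ((Complex.measurable_ofReal.comp hp).mul hc).aestronglyMeasurable ?_
  have hmem : ∀ᵐ t ∂(volume.restrict (Set.Ioo (-π) π)), t ∈ Set.Ioo (-π) π :=
    ae_restrict_mem measurableSet_Ioo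
  filter_upwards [Measure.quasiMeasurePreserving_fst.ae hmem] with q hq
  rw [norm_mul, norm_cylChar, mul_one, Complex.norm_real, Real.norm_eq_abs]
  rcases (radius_nonneg q.2).eq_or_lt with h | h
  · rw [← h, resProfile_zero]; simp
  · have := abs_resProfile_le (κ := κ) h (abs_le.2 ⟨hq.1.le, hq.2.le⟩)
    refine this.trans (le_of_eq ?_)
    rw [mul_div_assoc]; congr 4; ring

lemma integral_profile_char (κ : ℝ) (l : ℤ) (η : ℂ) :
    ∫ q : ℝ × (ℂ × ℝ), (resProfile κ q.1 (radius q.2) : ℂ) *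
      cylChar l η (q.1, q.2.1) ∂((volume.restrict (Set.Ioo (-π) π)).prod volume) =
      4 * π ^ 2 / (((l : ℂ) + 1 / 2 + Complex.I * κ) ^ 2 + (‖η‖ : ℝ) ^ 2) := by
  set μ : ℂ := if 0 ≤ l then ((l : ℂ) + 1 / 2) + Complex.I * κ
      else -(((l : ℂ) + 1 / 2) + Complex.I * κ) with hμ
  have hμre : 0 < μ.re := by
    rw [hμ]; split_ifs with h
    · have : (0 : ℝ) ≤ l := by exact_mod_cast h
      simp; linarith
    · have : (l : ℝ) + 1 ≤ 0 := by exact_mod_cast (by omega : l + 1 ≤ 0)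
      simp; linarith
  have hμ2 : μ ^ 2 = ((l : ℂ) + 1 / 2 + Complex.I * κ) ^ 2 := by
    rw [hμ]; split_ifs <;> ring
  rw [integral_prod_symm _ (integrable_profile_char κ l η)]
  have e : ∀ X : ℂ × ℝ, ∫ t in Set.Ioo (-π) π, (resProfile κ t (radius X) : ℂ) *
      cylChar l η (t, X.1) = π * (Complex.exp (-μ * radius X) / (radius X : ℝ) *
      Complex.exp (-Complex.I * (((starRingEnd ℂ) η * X.1).re : ℝ))) := by
    intro X
    unfold cylChar
    simp_rw [← mul_assoc]
    rw [integral_mul_const]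
    rcases (radius_nonneg X).eq_or_lt with h | h
    · rw [← h]; simp [resProfile_zero]
    · have := setIntegral_resProfile κ l h hμ
      rw [this]
      push_cast; ring
  simp_rw [e]
  rw [integral_const_mul, integral_yukawa hμre, hμ2]
  ring

lemma strip_assoc : MeasurePreserving (MeasurableEquiv.prodAssoc : (ℝ × ℂ) × ℝ ≃ᵐ ℝ × (ℂ × ℝ))
    (stripMeasure.prod volume) ((volume.restrict (Set.Ioo (-π) π)).prod volume) :=
  measurePreserving_prodAssoc _ volume volume

lemma integral_profile_eq_resKernel (κ : ℝ) (l : ℤ) (η : ℂ) (p : ℝ × ℂ) :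
    ∫ x : ℝ, (resProfile κ p.1 (radius (p.2, x)) : ℂ) * cylChar l η p =
      (resKernel κ p.1 ‖p.2‖ : ℂ) * cylChar l η p := by
  rw [integral_mul_const, resKernel, integral_complex_ofReal]; rfl

lemma integrable_resKernel_char (κ : ℝ) (l : ℤ) (η : ℂ) :
    Integrable (fun p : ℝ × ℂ => (resKernel κ p.1 ‖p.2‖ : ℂ) * cylChar l η p) stripMeasure := by
  have h := (strip_assoc.integrable_comp_emb (MeasurableEquiv.measurableEmbedding _)).2
    (integrable_profile_char κ l η)
  have h2 := h.integral_prod_left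
  refine h2.congr (Eventually.of_forall fun p => ?_)
  exact integral_profile_eq_resKernel κ l η p

lemma integral_resKernel_char (κ : ℝ) (l : ℤ) (η : ℂ) :
    ∫ p, (resKernel κ p.1 ‖p.2‖ : ℂ) * cylChar l η p ∂stripMeasure =
      4 * π ^ 2 / (((l : ℂ) + 1 / 2 + Complex.I * κ) ^ 2 + (‖η‖ : ℝ) ^ 2) := by
  rw [← integral_profile_char, ← strip_assoc.integral_comp']
  have h := (strip_assoc.integrable_comp_emb (MeasurableEquiv.measurableEmbedding _)).2
    (integrable_profile_char κ l η)
  refine Eq.trans ?_ (integral_prod _ h).symm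
  congr 1; funext p
  exact (integral_profile_eq_resKernel κ l η p).symm

/-- Completing squares in a positive-definite form in three variables. -/
theorem exists_square_coefficients (A : Matrix (Fin 3) (Fin 3) ℝ) (hs : A.IsSymm) (hp : A.PosDef) :
    ∃ γ q₂ q₃ p r₁ r₂ : ℝ, 0 < γ ∧ 0 < q₂ ∧ 0 < q₃ ∧
      A 0 0 = γ * (1 + q₂ ^ 2 * p ^ 2 + q₃ ^ 2 * r₁ ^ 2) ∧
      A 0 1 = γ * (q₂ ^ 2 * p + q₃ ^ 2 * r₁ * r₂) ∧
      A 0 2 = γ * (q₃ ^ 2 * r₁) ∧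
      A 1 1 = γ * (q₂ ^ 2 + q₃ ^ 2 * r₂ ^ 2) ∧
      A 1 2 = γ * (q₃ ^ 2 * r₂) ∧
      A 2 2 = γ * q₃ ^ 2 := by
  have h10 : A 1 0 = A 0 1 := hs.apply 0 1
  have h20 : A 2 0 = A 0 2 := hs.apply 0 2
  have h21 : A 2 1 = A 1 2 := hs.apply 1 2
  have key : ∀ x : Fin 3 → ℝ, x ≠ 0 →
      0 < A 0 0 * x 0 ^ 2 + A 1 1 * x 1 ^ 2 + A 2 2 * x 2 ^ 2 + 2 * A 0 1 * x 0 * x 1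
        + 2 * A 0 2 * x 0 * x 2 + 2 * A 1 2 * x 1 * x 2 := by
    intro x hx
    have := hp.dotProduct_mulVec_pos hx
    simp [Matrix.mulVec, dotProduct, Fin.sum_univ_three, h10, h20, h21] at this
    linarith
  have hf : 0 < A 2 2 := by
    have := key ![0, 0, 1] (fun h => by simpa using congrFun h 2)
    simpa using this
  set f := A 2 2
  set e := A 1 2
  set d := A 1 1
  set c := A 0 2
  set b := A 0 1
  set a := A 0 0
  have hα : 0 < d - e ^ 2 / f := by
    have := key ![0, 1, -e / f] (fun h => by simpa using congrFun h 1)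
    simp at this
    convert this using 1
    field_simp
    ring
  set α := d - e ^ 2 / f with hαd
  have hγ : 0 < a - c ^ 2 / f - (b - c * e / f) ^ 2 / α := by
    have := key ![1, -((b - c * e / f) / α), -(c / f) + e / f * ((b - c * e / f) / α)]
      (fun h => by simpa using congrFun h 0)
    simp at this
    have hd : d = α + e ^ 2 / f := by rw [hαd]; ring
    rw [hd, ← sub_pos] at this
    convert this using 1
    field_simp
    ring
  set γ := a - c ^ 2 / f - (b - c * e / f) ^ 2 / α with hγd
  have hq2 : Real.sqrt (α / γ) ^ 2 = α / γ := Real.sq_sqrt (by positivity)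
  have hq3 : Real.sqrt (f / γ) ^ 2 = f / γ := Real.sq_sqrt (by positivity)
  refine ⟨γ, √(α / γ), √(f / γ), (b - c * e / f) / α, c / f, e / f, hγ, by positivity,
    by positivity, ?_, ?_, ?_, ?_, ?_, ?_⟩
  · have ha : a = γ + c ^ 2 / f + (b - c * e / f) ^ 2 / α := by rw [hγd]; ring
    rw [hq2, hq3, ha]; field_simp
    try ring
  · rw [hq2, hq3]; field_simp
    try ring
  · rw [hq3]; field_simp
  · have hd : d = α + e ^ 2 / f := by rw [hαd]; ring
    rw [hq2, hq3, hd]; field_simp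
  · rw [hq3]; field_simp
  · rw [hq3]; field_simp

/-- A positive-definite form is, up to a factor, a sum of squares of triangular linear forms; the
second and third of these vanish on any vector which the matrix maps to the first axis. -/
theorem exists_triangular_squares (A : Matrix (Fin 3) (Fin 3) ℝ) (hs : A.IsSymm)
    (hp : A.PosDef) :
    ∃ γ q₂ q₃ p r₁ r₂ : ℝ, 0 < γ ∧ 0 < q₂ ∧ 0 < q₃ ∧
      (∀ v : Fin 3 → ℂ, ∑ i, ∑ l, v i * ((A i l : ℝ) : ℂ) * v l =
        γ * ((v 0) ^ 2 + (q₂ * (v 1 + p * v 0)) ^ 2 + (q₃ * (v 2 + r₁ * v 0 + r₂ * v 1)) ^ 2)) ∧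
      (∀ (a : Fin 3 → ℝ) (s₀ : ℝ), Matrix.vecMul a A = ![s₀, 0, 0] →
        a 0 * s₀ = qA A a ∧ a 1 + p * a 0 = 0 ∧ a 2 + r₁ * a 0 + r₂ * a 1 = 0) := by
  obtain ⟨γ, q₂, q₃, p, r₁, r₂, hγ, hq₂, hq₃, h00, h01, h02, h11, h12, h22⟩ :=
    exists_square_coefficients A hs hp
  have h10 : A 1 0 = A 0 1 := hs.apply 0 1
  have h20 : A 2 0 = A 0 2 := hs.apply 0 2
  have h21 : A 2 1 = A 1 2 := hs.apply 1 2
  refine ⟨γ, q₂, q₃, p, r₁, r₂, hγ, hq₂, hq₃, ?_, ?_⟩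
  · intro v
    simp only [Fin.sum_univ_three, h10, h20, h21, h00, h01, h02, h11, h12, h22]
    push_cast
    ring
  · intro a s₀ h
    have e0 := congrFun h 0
    have e1 := congrFun h 1
    have e2 := congrFun h 2
    simp [Matrix.vecMul, dotProduct, Fin.sum_univ_three] at e0 e1 e2
    have hz : a 2 + r₁ * a 0 + r₂ * a 1 = 0 := by
      have : γ * q₃ ^ 2 * (a 2 + r₁ * a 0 + r₂ * a 1) = 0 := by
        rw [h02, h12, h22] at e2; linear_combination e2
      exact (mul_eq_zero.mp this).resolve_left (by positivity)
    have hy : a 1 + p * a 0 = 0 := by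
      have : γ * q₂ ^ 2 * (a 1 + p * a 0) = 0 := by
        rw [h01, h11, h21, h12] at e1
        linear_combination e1 - γ * q₃ ^ 2 * r₂ * hz
      exact (mul_eq_zero.mp this).resolve_left (by positivity)
    refine ⟨?_, hy, hz⟩
    simp only [qA, Fin.sum_univ_three]
    linear_combination (-a 0) * e0 - a 1 * e1 - a 2 * e2

/-- The linear change of variables turning the phase of `cylChar` into a Euclidean one. -/
def cylEquiv (q₂ q₃ p r₁ r₂ : ℝ) (h₂ : q₂ ≠ 0) (h₃ : q₃ ≠ 0) : (ℝ × ℂ) ≃ₗ[ℝ] E3 where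
  toFun v := !₂[v.1 + q₂ * p * v.2.re + q₃ * r₁ * v.2.im, q₂ * v.2.re + q₃ * r₂ * v.2.im,
    q₃ * v.2.im]
  map_add' u v := by
    ext i; fin_cases i <;> simp <;> ring
  map_smul' c v := by
    ext i; fin_cases i <;> simp <;> ring
  invFun x := (x 0 - p * (x 1 - r₂ * x 2) - r₁ * x 2, ⟨(x 1 - r₂ * x 2) / q₂, x 2 / q₃⟩)
  left_inv v := by
    refine Prod.ext ?_ (Complex.ext ?_ ?_) <;> simp <;> field_simp <;> ring
  right_inv x := by
    ext i; fin_cases i <;> simp <;> field_simp <;> ring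

/-- The dual frequency of the cylinder variable. -/
def cylFreq (q₂ q₃ p r₁ r₂ : ℝ) (ξ : Fin 3 → ℝ) : ℂ :=
  ⟨q₂ * (ξ 1 + p * ξ 0), q₃ * (ξ 2 + r₁ * ξ 0 + r₂ * ξ 1)⟩

theorem ewave_mul_cylChar {q₂ q₃ p r₁ r₂ : ℝ} (h₂ : q₂ ≠ 0) (h₃ : q₃ ≠ 0) (β : Fin 3 → ℝ)
    (hβ : β 0 = 1 / 2) (n : Fin 3 → ℤ) (x : E3) (v : ℝ × ℂ) :
    ewave n x * cylChar (n 0) (cylFreq q₂ q₃ p r₁ r₂ (fun i => n i + β i)) v =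
      Complex.exp (-Complex.I * ((∑ i, β i * cylEquiv q₂ q₃ p r₁ r₂ h₂ h₃ v i : ℝ) : ℂ)) *
        ewave n (x - cylEquiv q₂ q₃ p r₁ r₂ h₂ h₃ v) := by
  simp only [ewave, cylChar, ← Complex.exp_add]
  congr 1
  simp [cylEquiv, cylFreq, Fin.sum_univ_three, hβ, Complex.mul_re]
  ring

theorem enorm_resolvent_le_lintegral {q₂ q₃ p r₁ r₂ : ℝ} (h₂ : q₂ ≠ 0) (h₃ : q₃ ≠ 0)
    (β : Fin 3 → ℝ) (hβ : β 0 = 1 / 2) (κ : ℝ) (c : (Fin 3 → ℤ) →₀ ℂ) (x : E3) :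
    ‖∑ n ∈ c.support, c n * ewave n x * (4 * (π : ℂ) ^ 2 / (((n 0 : ℂ) + 1 / 2 + Complex.I * κ) ^ 2
        + ((‖cylFreq q₂ q₃ p r₁ r₂ (fun i => n i + β i)‖ : ℝ) : ℂ) ^ 2))‖ₑ ≤
      ∫⁻ v, ENNReal.ofReal |resKernel κ v.1 ‖v.2‖| *
        ‖∑ n ∈ c.support, c n * ewave n (x - cylEquiv q₂ q₃ p r₁ r₂ h₂ h₃ v)‖ₑ ∂stripMeasure := by
  have e : ∑ n ∈ c.support, c n * ewave n x * (4 * (π : ℂ) ^ 2 /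
      (((n 0 : ℂ) + 1 / 2 + Complex.I * κ) ^ 2
        + ((‖cylFreq q₂ q₃ p r₁ r₂ (fun i => n i + β i)‖ : ℝ) : ℂ) ^ 2)) =
      ∫ v, ∑ n ∈ c.support, c n * ewave n x * ((resKernel κ v.1 ‖v.2‖ : ℂ) *
        cylChar (n 0) (cylFreq q₂ q₃ p r₁ r₂ (fun i => n i + β i)) v) ∂stripMeasure := by
    rw [integral_finsetSum _ (fun n _ => (integrable_resKernel_char κ _ _).const_mul _)]
    refine Finset.sum_congr rfl fun n _ => ?_
    rw [integral_const_mul, integral_resKernel_char]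
  rw [e]
  refine (enorm_integral_le_lintegral_enorm _).trans (lintegral_mono fun v => ?_)
  have e2 : ∑ n ∈ c.support, c n * ewave n x * ((resKernel κ v.1 ‖v.2‖ : ℂ) *
        cylChar (n 0) (cylFreq q₂ q₃ p r₁ r₂ (fun i => n i + β i)) v) =
      (resKernel κ v.1 ‖v.2‖ : ℂ) *
      (Complex.exp (-Complex.I * ((∑ i, β i * cylEquiv q₂ q₃ p r₁ r₂ h₂ h₃ v i : ℝ) : ℂ)) *
        ∑ n ∈ c.support, c n * ewave n (x - cylEquiv q₂ q₃ p r₁ r₂ h₂ h₃ v)) := by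
    rw [Finset.mul_sum, Finset.mul_sum]
    refine Finset.sum_congr rfl fun n _ => ?_
    linear_combination c n * (resKernel κ v.1 ‖v.2‖ : ℂ) * ewave_mul_cylChar h₂ h₃ β hβ n x v
  have e3 : ‖Complex.exp (-Complex.I *
      ((∑ i, β i * cylEquiv q₂ q₃ p r₁ r₂ h₂ h₃ v i : ℝ) : ℂ))‖ₑ = 1 := by
    rw [← ofReal_norm, Complex.norm_exp]
    simp
  show ‖∑ n ∈ c.support, c n * ewave n x * ((resKernel κ v.1 ‖v.2‖ : ℂ) *
        cylChar (n 0) (cylFreq q₂ q₃ p r₁ r₂ (fun i => n i + β i)) v)‖ₑ ≤ _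
  rw [e2, enorm_mul, enorm_mul, e3, one_mul]
  refine le_of_eq ?_
  congr 1
  rw [← ofReal_norm, Complex.norm_real, Real.norm_eq_abs]

instance : (volume : Measure (ℝ × ℂ)).IsAddHaarMeasure :=
  inferInstanceAs (Measure.prod volume volume).IsAddHaarMeasure

/-- The exponentially damped Newtonian kernel. -/
def yukawa (c : ℝ) (y : E3) : ℝ≥0∞ := ENNReal.ofReal (Real.exp (-(c * ‖y‖)) / ‖y‖)

theorem measurable_yukawa (c : ℝ) : Measurable (yukawa c) := by
  unfold yukawa; fun_prop

theorem exists_resKernel_le_yukawa (L : (ℝ × ℂ) ≃ₗ[ℝ] E3) :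
    ∃ C c : ℝ, 0 < C ∧ 0 < c ∧ ∀ (κ : ℝ) (v : ℝ × ℂ), |v.1| ≤ π → v.2 ≠ 0 →
      ENNReal.ofReal |resKernel κ v.1 ‖v.2‖| ≤ ENNReal.ofReal C * yukawa c (L v) := by
  set L' := L.toContinuousLinearEquiv with hL'
  set K : ℝ := ‖(L' : (ℝ × ℂ) →L[ℝ] E3)‖ + 1 with hK
  have hK0 : 0 < K := by positivity
  refine ⟨400 * Real.exp 1 * K, 1 / (4 * K), by positivity, by positivity, fun κ v ht hr => ?_⟩
  have hr' : 0 < ‖v.2‖ := norm_pos_iff.mpr hr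
  unfold yukawa
  rw [← ENNReal.ofReal_mul (by positivity)]
  refine ENNReal.ofReal_le_ofReal ((abs_resKernel_le hr' ht).trans ?_)
  set R := Real.sqrt (‖v.2‖ ^ 2 + v.1 ^ 2) with hR
  have hR0 : 0 < R := by positivity
  have hv0 : L v ≠ 0 := by
    intro h
    have : v = 0 := by simpa using h
    exact hr (by simp [this])
  have hLv : 0 < ‖L v‖ := norm_pos_iff.mpr hv0
  have hvR : ‖v‖ ≤ R := by
    rw [Prod.norm_def]
    refine max_le ?_ ?_
    · rw [Real.norm_eq_abs]; exact Real.abs_le_sqrt (by nlinarith [sq_nonneg ‖v.2‖])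
    · exact Real.le_sqrt_of_sq_le (by nlinarith [sq_nonneg v.1])
  have hLR : ‖L v‖ ≤ K * R := by
    calc ‖L v‖ = ‖(L' : (ℝ × ℂ) →L[ℝ] E3) v‖ := rfl
      _ ≤ ‖(L' : (ℝ × ℂ) →L[ℝ] E3)‖ * ‖v‖ := ContinuousLinearMap.le_opNorm _ _
      _ ≤ K * R := by gcongr; rw [hK]; linarith
  have hRr : R ≤ ‖v.2‖ + π := by
    rw [hR, Real.sqrt_le_iff]
    refine ⟨by positivity, ?_⟩
    nlinarith [abs_nonneg v.1, sq_abs v.1, mul_nonneg hr'.le Real.pi_pos.le]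
  have he : Real.exp (-(‖v.2‖ / 4)) ≤ Real.exp 1 * Real.exp (-(1 / (4 * K) * ‖L v‖)) := by
    rw [← Real.exp_add, Real.exp_le_exp]
    have : 1 / (4 * K) * ‖L v‖ ≤ R / 4 := by
      rw [one_div_mul_eq_div, div_le_div_iff₀ (by positivity) (by norm_num)]
      linarith
    linarith [Real.pi_lt_d2]
  have hi : 1 / R ≤ K / ‖L v‖ := by
    rw [div_le_div_iff₀ hR0 hLv]; linarith
  calc 400 * Real.exp (-(‖v.2‖ / 4)) / R = 400 * Real.exp (-(‖v.2‖ / 4)) * (1 / R) := by ring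
    _ ≤ 400 * (Real.exp 1 * Real.exp (-(1 / (4 * K) * ‖L v‖))) * (K / ‖L v‖) := by gcongr
    _ = _ := by ring

open Measure in
theorem exists_lintegral_comp_le (L : (ℝ × ℂ) ≃ₗ[ℝ] E3) :
    ∃ C : ℝ≥0, ∀ F : E3 → ℝ≥0∞, Measurable F → ∫⁻ v, F (L v) = C * ∫⁻ y, F y := by
  have hc : Continuous L := L.toContinuousLinearEquiv.continuous
  have : (Measure.map L (volume : Measure (ℝ × ℂ))).IsAddHaarMeasure :=
    ContinuousLinearEquiv.isAddHaarMeasure_map L.toContinuousLinearEquiv volume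
  obtain ⟨C, h⟩ : ∃ C : ℝ≥0, Measure.map L (volume : Measure (ℝ × ℂ)) = C • volume :=
    ⟨_, isAddLeftInvariant_eq_smul (Measure.map L (volume : Measure (ℝ × ℂ))) (volume : Measure E3)⟩
  refine ⟨C, fun F hF => ?_⟩
  rw [← lintegral_map hF hc.measurable, h, lintegral_smul_measure]
  rfl

theorem continuous_ewave (n : Fin 3 → ℤ) : Continuous (ewave n) := by
  unfold ewave; fun_prop

theorem ae_stripMeasure : ∀ᵐ v ∂stripMeasure, |v.1| ≤ π ∧ v.2 ≠ 0 := by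
  unfold stripMeasure
  refine Filter.Eventually.and ?_ ?_
  · have h : ∀ᵐ t ∂(volume.restrict (Set.Ioo (-π) π)), |t| ≤ π := by
      filter_upwards [ae_restrict_mem measurableSet_Ioo] with t ht
      exact abs_le.mpr ⟨ht.1.le, ht.2.le⟩
    exact Measure.quasiMeasurePreserving_fst.ae h
  · have h : ∀ᵐ z : ℂ, z ≠ 0 := by
      simp [ae_iff]
    exact Measure.quasiMeasurePreserving_snd.ae h

theorem stripMeasure_le : stripMeasure ≤ volume :=
  Measure.prod_mono Measure.restrict_le_self le_rfl

/-- The resolvent at the shifted frequency is dominated by a damped Newtonian potential. -/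
theorem exists_resolvent_le_yukawa (A : Matrix (Fin 3) (Fin 3) ℝ) (hs : A.IsSymm)
    (hp : A.PosDef) :
    ∃ (C : ℝ≥0) (σ : ℝ), 0 < σ ∧ ∀ (a b : Fin 3 → ℝ) (s₀ : ℝ), norm3 a = 1 →
      Matrix.vecMul a A = ![s₀, 0, 0] → ∀ (ρ : ℝ) (c : (Fin 3 → ℤ) →₀ ℂ) (x : E3),
      ‖∑ n ∈ c.support, c n * ewave n x /
                (∑ i, ∑ l,
                  ((n i : ℂ) + ((((1 / a 0) * (1/2 - b 0) : ℝ) : ℂ)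
                      + ((ρ : ℝ) : ℂ) * Complex.I) * ((a i : ℝ) : ℂ) + ((b i : ℝ) : ℂ)) *
                    ((A i l : ℝ) : ℂ) *
                  ((n l : ℂ) + ((((1 / a 0) * (1/2 - b 0) : ℝ) : ℂ)
                      + ((ρ : ℝ) : ℂ) * Complex.I) * ((a l : ℝ) : ℂ) + ((b l : ℝ) : ℂ)))‖ₑ ≤
        C * ∫⁻ y, yukawa σ y * ‖∑ n ∈ c.support, c n * ewave n (x - y)‖ₑ := by
  obtain ⟨γ, q₂, q₃, p, r₁, r₂, hγ, hq₂, hq₃, hform, hvan⟩ := exists_triangular_squares A hs hp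
  set L := cylEquiv q₂ q₃ p r₁ r₂ hq₂.ne' hq₃.ne' with hL
  obtain ⟨C₁, σ, hC₁, hσ, hdom⟩ := exists_resKernel_le_yukawa L
  obtain ⟨C₂, hC₂⟩ := exists_lintegral_comp_le L
  refine ⟨Real.toNNReal (1 / (4 * π ^ 2 * γ)) * (Real.toNNReal C₁ * C₂), σ, hσ, ?_⟩
  intro a b s₀ ha hA ρ c x
  obtain ⟨has, ha1, ha2⟩ := hvan a s₀ hA
  have ha0 : a 0 ≠ 0 := by
    intro h0
    have h1 : a 1 = 0 := by rw [h0] at ha1; linarith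
    have h2 : a 2 = 0 := by rw [h0, h1] at ha2; linarith
    simp [norm3, Fin.sum_univ_three, h0, h1, h2] at ha
  set δ : ℝ := (1 / a 0) * (1/2 - b 0) with hδ
  set β : Fin 3 → ℝ := fun i => b i + δ * a i with hβ
  have hβ0 : β 0 = 1 / 2 := by simp only [hβ, hδ]; field_simp; ring
  have hden : ∀ n : Fin 3 → ℤ, (∑ i, ∑ l,
      ((n i : ℂ) + ((δ : ℂ) + (ρ : ℂ) * Complex.I) * (a i : ℂ) + (b i : ℂ)) * (A i l : ℂ) *
      ((n l : ℂ) + ((δ : ℂ) + (ρ : ℂ) * Complex.I) * (a l : ℂ) + (b l : ℂ))) =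
      γ * (((n 0 : ℂ) + 1 / 2 + Complex.I * ((ρ * a 0 : ℝ) : ℂ)) ^ 2 +
        ((‖cylFreq q₂ q₃ p r₁ r₂ (fun i => n i + β i)‖ : ℝ) : ℂ) ^ 2) := by
    intro n
    rw [hform (fun i => (n i : ℂ) + ((δ : ℂ) + (ρ : ℂ) * Complex.I) * (a i : ℂ) + (b i : ℂ))]
    have hnorm : (‖cylFreq q₂ q₃ p r₁ r₂ (fun i => n i + β i)‖ : ℝ) ^ 2 =
        (q₂ * ((n 1 + β 1) + p * (n 0 + β 0))) ^ 2 +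
        (q₃ * ((n 2 + β 2) + r₁ * (n 0 + β 0) + r₂ * (n 1 + β 1))) ^ 2 := by
      rw [← Complex.normSq_eq_norm_sq, Complex.normSq_apply]
      simp only [cylFreq]; ring
    have hnorm' := congrArg (fun t : ℝ => (t : ℂ)) hnorm
    push_cast at hnorm'
    rw [hnorm']
    have e0 : (b 0 : ℂ) + δ * a 0 = 1 / 2 := by
      have := congrArg (fun t : ℝ => (t : ℂ)) hβ0
      simpa [hβ] using this
    have e1 : (a 1 : ℂ) + p * a 0 = 0 := by exact_mod_cast ha1
    have e2 : (a 2 : ℂ) + r₁ * a 0 + r₂ * a 1 = 0 := by exact_mod_cast ha2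
    have f0 : (n 0 : ℂ) + ((δ : ℂ) + (ρ : ℂ) * Complex.I) * (a 0 : ℂ) + (b 0 : ℂ) =
      (n 0 : ℂ) + 1 / 2 + Complex.I * ((ρ * a 0 : ℝ) : ℂ) := by
      push_cast; linear_combination e0
    have f1 : ((n 1 : ℂ) + ((δ : ℂ) + (ρ : ℂ) * Complex.I) * (a 1 : ℂ) + (b 1 : ℂ)) +
        p * ((n 0 : ℂ) + ((δ : ℂ) + (ρ : ℂ) * Complex.I) * (a 0 : ℂ) + (b 0 : ℂ)) =
        (n 1 + β 1 : ℂ) + p * (n 0 + β 0) := by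
      simp only [hβ]; push_cast; linear_combination (ρ * Complex.I) * e1
    have f2 : ((n 2 : ℂ) + ((δ : ℂ) + (ρ : ℂ) * Complex.I) * (a 2 : ℂ) + (b 2 : ℂ)) +
        r₁ * ((n 0 : ℂ) + ((δ : ℂ) + (ρ : ℂ) * Complex.I) * (a 0 : ℂ) + (b 0 : ℂ)) +
        r₂ * ((n 1 : ℂ) + ((δ : ℂ) + (ρ : ℂ) * Complex.I) * (a 1 : ℂ) + (b 1 : ℂ)) =
        (n 2 + β 2 : ℂ) + r₁ * (n 0 + β 0) + r₂ * (n 1 + β 1) := by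
      simp only [hβ]; push_cast; linear_combination (ρ * Complex.I) * e2
    rw [f1, f2, f0]
    ring
  have hsum : ∑ n ∈ c.support, c n * ewave n x / (∑ i, ∑ l,
      ((n i : ℂ) + ((δ : ℂ) + (ρ : ℂ) * Complex.I) * (a i : ℂ) + (b i : ℂ)) * (A i l : ℂ) *
      ((n l : ℂ) + ((δ : ℂ) + (ρ : ℂ) * Complex.I) * (a l : ℂ) + (b l : ℂ))) =
      ((1 / (4 * π ^ 2 * γ) : ℝ) : ℂ) * ∑ n ∈ c.support, c n * ewave n x * (4 * (π : ℂ) ^ 2 /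
        (((n 0 : ℂ) + 1 / 2 + Complex.I * ((ρ * a 0 : ℝ) : ℂ)) ^ 2
        + ((‖cylFreq q₂ q₃ p r₁ r₂ (fun i => n i + β i)‖ : ℝ) : ℂ) ^ 2)) := by
    rw [Finset.mul_sum]
    refine Finset.sum_congr rfl fun n _ => ?_
    rw [hden n]
    have hγ' : (γ : ℂ) ≠ 0 := by exact_mod_cast hγ.ne'
    have hπ' : (π : ℂ) ≠ 0 := by exact_mod_cast Real.pi_pos.ne'
    push_cast
    rw [← div_div, div_eq_mul_inv (c n * ewave n x / γ), div_eq_mul_inv (4 * (π : ℂ) ^ 2)]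
    field_simp
  rw [hsum, enorm_mul]
  have hconst : ‖((1 / (4 * π ^ 2 * γ) : ℝ) : ℂ)‖ₑ =
      ((Real.toNNReal (1 / (4 * π ^ 2 * γ)) : ℝ≥0) : ℝ≥0∞) := by
    rw [← ofReal_norm, Complex.norm_real, Real.norm_of_nonneg (by positivity)]; rfl
  rw [hconst, ENNReal.coe_mul, mul_assoc (ENNReal.ofNNReal _)]
  refine mul_le_mul_right ?_ _
  refine (enorm_resolvent_le_lintegral hq₂.ne' hq₃.ne' β hβ0 (ρ * a 0) c x).trans ?_
  have hm : Measurable fun y : E3 => yukawa σ y * ‖∑ n ∈ c.support, c n * ewave n (x - y)‖ₑ := by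
    refine (measurable_yukawa σ).mul (Measurable.enorm ?_)
    refine Finset.measurable_fun_sum _ fun n _ => ?_
    exact ((continuous_ewave n).measurable.comp (measurable_const.sub measurable_id)).const_mul _
  calc _ ≤ ∫⁻ v, ENNReal.ofReal C₁ * (yukawa σ (L v) *
        ‖∑ n ∈ c.support, c n * ewave n (x - L v)‖ₑ) ∂stripMeasure := by
        refine lintegral_mono_ae ?_
        filter_upwards [ae_stripMeasure] with v hv
        rw [← mul_assoc]
        gcongr
        exact hdom _ v hv.1 hv.2
    _ ≤ ∫⁻ v, ENNReal.ofReal C₁ * (yukawa σ (L v) *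
        ‖∑ n ∈ c.support, c n * ewave n (x - L v)‖ₑ) := lintegral_mono' stripMeasure_le le_rfl
    _ = ENNReal.ofReal C₁ * ∫⁻ v, (yukawa σ (L v) *
        ‖∑ n ∈ c.support, c n * ewave n (x - L v)‖ₑ) := by
        rw [lintegral_const_mul]
        exact hm.comp L.toContinuousLinearEquiv.continuous.measurable
    _ = _ := by
        rw [hC₂ (fun y => yukawa σ y * ‖∑ n ∈ c.support, c n * ewave n (x - y)‖ₑ) hm,
          ENNReal.coe_mul, mul_assoc]
        rfl

/-- The bilinear form `∑ λ_j F_j G_j` over the descendants of a node of a tree up to depth `d`. -/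
def treeForm {ι : Type*} (ch : ι → Finset ι) (lam F G : ι → ℝ) : ℕ → ι → ℝ
  | 0, _ => 0
  | d + 1, i => lam i * (F i * G i) + ∑ j ∈ ch i, treeForm ch lam F G d j

theorem treeForm_nonneg {ι : Type*} {ch : ι → Finset ι} {lam F G : ι → ℝ} (hl : ∀ i, 0 ≤ lam i)
    (hF : ∀ i, 0 ≤ F i) (hG : ∀ i, 0 ≤ G i) (d : ℕ) (i : ι) : 0 ≤ treeForm ch lam F G d i := by
  induction d generalizing i with
  | zero => simp [treeForm]
  | succ d ih =>
    simp only [treeForm]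
    have := Finset.sum_nonneg (s := ch i) (fun j _ => ih j)
    have := mul_nonneg (hl i) (mul_nonneg (hF i) (hG i))
    linarith

theorem two_mul_treeForm_le {ι : Type*} {ch : ι → Finset ι} {lam F G : ι → ℝ}
    (hl : ∀ i, 0 ≤ lam i) {t : ℝ} (ht : 0 < t) (d : ℕ) (i : ι) :
    2 * treeForm ch lam F G d i ≤
      t * treeForm ch lam F F d i + t⁻¹ * treeForm ch lam G G d i := by
  induction d generalizing i with
  | zero => simp [treeForm]
  | succ d ih =>
    simp only [treeForm]
    have h1 := Finset.sum_le_sum (s := ch i) (fun j _ => ih j)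
    rw [Finset.sum_add_distrib, ← Finset.mul_sum, ← Finset.mul_sum, ← Finset.mul_sum] at h1
    have h2 : 2 * (F i * G i) ≤ t * (F i * F i) + t⁻¹ * (G i * G i) := by
      have h3 : 0 ≤ t⁻¹ * (t * F i - G i) ^ 2 := by positivity
      have h4 : t⁻¹ * (t * F i - G i) ^ 2 =
          t * (F i * F i) + t⁻¹ * (G i * G i) - 2 * (F i * G i) := by
        field_simp; ring
      linarith
    have h5 := mul_le_mul_of_nonneg_left h2 (hl i)
    nlinarith

/-- The dyadic Carleson embedding theorem, in its Bellman-function form. -/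
theorem treeForm_add_le {ι : Type*} {ch : ι → Finset ι} {lam V H P : ι → ℝ} {N : ℝ} (hN : 0 < N)
    (hl : ∀ i, 0 ≤ lam i) (hV : ∀ i, 0 < V i) (hVs : ∀ i, V i = ∑ j ∈ ch i, V j)
    (hHs : ∀ i, H i = ∑ j ∈ ch i, H j) (hPs : ∀ i, P i = ∑ j ∈ ch i, P j)
    (hHP : ∀ i, H i ^ 2 ≤ P i * V i)
    (htest : ∀ d i, treeForm ch lam V V d i ≤ N * V i) (d : ℕ) (i : ι) :
    treeForm ch lam H H d i + 4 * N * (H i ^ 2 / (V i + treeForm ch lam V V d i / N)) ≤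
      4 * N * P i := by
  induction d generalizing i with
  | zero =>
    simp only [treeForm, zero_div, add_zero, zero_add]
    have : H i ^ 2 / V i ≤ P i := by
      rw [div_le_iff₀ (hV i)]; exact hHP i
    gcongr
  | succ d ih =>
    have hM := fun j => treeForm_nonneg (ch := ch) hl (fun i => (hV i).le) (fun i => (hV i).le) d j
    have hpos : ∀ j, 0 < V j + treeForm ch lam V V d j / N := fun j =>
      add_pos_of_pos_of_nonneg (hV j) (div_nonneg (hM j) hN.le)
    have h1 := Finset.sum_le_sum (s := ch i) (fun j _ => ih j)
    rw [Finset.sum_add_distrib, ← Finset.mul_sum, ← Finset.mul_sum, ← hPs] at h1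
    have h2 := Finset.sq_sum_div_le_sum_sq_div (ch i) H
      (g := fun j => V j + treeForm ch lam V V d j / N) (fun j _ => hpos j)
    rw [← hHs, Finset.sum_add_distrib, ← hVs, ← Finset.sum_div] at h2
    have ht := htest (d + 1) i
    simp only [treeForm] at ht ⊢
    set m := ∑ j ∈ ch i, treeForm ch lam V V d j with hm
    have hm0 : 0 ≤ m := Finset.sum_nonneg fun j _ => hM j
    set X := V i + m / N with hX
    have hv := hV i
    have hX0 : 0 < X := add_pos_of_pos_of_nonneg hv (div_nonneg hm0 hN.le)
    set Y := V i + (lam i * (V i * V i) + m) / N with hY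
    have hl0 := mul_nonneg (hl i) (mul_nonneg hv.le hv.le)
    have hXY : X ≤ Y := by
      rw [hX, hY]; gcongr; linarith
    have hY2 : Y ≤ 2 * V i := by
      have : (lam i * (V i * V i) + m) / N ≤ V i := by
        rw [div_le_iff₀ hN]; linarith
      linarith
    have hYX : Y - X = lam i * (V i * V i) / N := by
      rw [hX, hY]; ring
    have h3 : lam i * (H i * H i) + 4 * N * (H i ^ 2 / Y) ≤ 4 * N * (H i ^ 2 / X) := by
      have hY0 : 0 < Y := hX0.trans_le hXY
      have e : 4 * N * (H i ^ 2 / X) - 4 * N * (H i ^ 2 / Y) =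
          4 * N * H i ^ 2 * (Y - X) / (X * Y) := by
        field_simp
      have e2 : 4 * N * H i ^ 2 * (Y - X) / (X * Y) =
          lam i * H i ^ 2 * (4 * V i ^ 2 / (X * Y)) := by
        rw [hYX]; field_simp
      have e3 : 1 ≤ 4 * V i ^ 2 / (X * Y) := by
        rw [one_le_div (by positivity)]
        nlinarith
      have e4 : 0 ≤ lam i * H i ^ 2 := mul_nonneg (hl i) (sq_nonneg _)
      nlinarith
    have h4 := mul_le_mul_of_nonneg_left h2 (show 0 ≤ 4 * N by positivity)
    linarith

theorem treeForm_self_le {ι : Type*} {ch : ι → Finset ι} {lam V H P : ι → ℝ} {N : ℝ} (hN : 0 < N)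
    (hl : ∀ i, 0 ≤ lam i) (hV : ∀ i, 0 < V i) (hVs : ∀ i, V i = ∑ j ∈ ch i, V j)
    (hHs : ∀ i, H i = ∑ j ∈ ch i, H j) (hPs : ∀ i, P i = ∑ j ∈ ch i, P j)
    (hHP : ∀ i, H i ^ 2 ≤ P i * V i)
    (htest : ∀ d i, treeForm ch lam V V d i ≤ N * V i) (d : ℕ) (i : ι) :
    treeForm ch lam H H d i ≤ 4 * N * P i := by
  have h := treeForm_add_le hN hl hV hVs hHs hPs hHP htest d i
  have hM := treeForm_nonneg (ch := ch) hl (fun i => (hV i).le) (fun i => (hV i).le) d i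
  have : 0 ≤ 4 * N * (H i ^ 2 / (V i + treeForm ch lam V V d i / N)) :=
    mul_nonneg (by positivity)
      (div_nonneg (sq_nonneg _) (add_nonneg (hV i).le (div_nonneg hM hN.le)))
  linarith

theorem sq_lintegral_mul_le {α : Type*} [MeasurableSpace α] (μ : Measure α) {f g : α → ℝ≥0∞}
    (hf : AEMeasurable f μ) (hg : AEMeasurable g μ) :
    (∫⁻ x, f x * g x ∂μ) ^ 2 ≤ (∫⁻ x, f x ^ 2 ∂μ) * ∫⁻ x, g x ^ 2 ∂μ := by
  have h := ENNReal.lintegral_mul_le_Lp_mul_Lq μ Real.HolderConjugate.two_two hf hg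
  have h2 := pow_le_pow_left' h 2
  refine h2.trans (le_of_eq ?_)
  rw [mul_pow, ← ENNReal.rpow_natCast, ← ENNReal.rpow_natCast, ← ENNReal.rpow_mul,
    ← ENNReal.rpow_mul]
  norm_num

/-- The positive operator `f ↦ ∑ λ_j 1_{Q j} ∫_{Q j} f dν` over the descendants of a node. -/
def treeOp {α ι : Type*} [MeasurableSpace α] (ν : Measure α) (ch : ι → Finset ι) (Q : ι → Set α)
    (lam : ι → ℝ) (f : α → ℝ≥0∞) : ℕ → ι → α → ℝ≥0∞
  | 0, _, _ => 0
  | d + 1, i, x => ENNReal.ofReal (lam i) * (∫⁻ y in Q i, f y ∂ν) +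
      ∑ j ∈ ch i, (Q j).indicator (treeOp ν ch Q lam f d j) x

section tree

variable {α ι : Type*} [MeasurableSpace α] {ν : Measure α} {ch : ι → Finset ι} {Q : ι → Set α}
  {lam : ι → ℝ}

theorem measurable_treeOp (hQ : ∀ i, MeasurableSet (Q i)) (f : α → ℝ≥0∞) (d : ℕ) (i : ι) :
    Measurable (treeOp ν ch Q lam f d i) := by
  induction d generalizing i with
  | zero => exact measurable_const
  | succ d ih =>
    exact measurable_const.add (Finset.measurable_fun_sum _ fun j _ => (ih j).indicator (hQ j))

theorem exists_treeOp_le (f : α → ℝ≥0∞) (hf : ∀ i, ∫⁻ y in Q i, f y ∂ν ≠ ⊤) (d : ℕ) (i : ι) :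
    ∃ c : ℝ≥0∞, c ≠ ⊤ ∧ ∀ x, treeOp ν ch Q lam f d i x ≤ c := by
  induction d generalizing i with
  | zero => exact ⟨0, by simp, fun x => le_rfl⟩
  | succ d ih =>
    choose c hc hcx using ih
    refine ⟨ENNReal.ofReal (lam i) * (∫⁻ y in Q i, f y ∂ν) + ∑ j ∈ ch i, c j, ?_, fun x => ?_⟩
    · exact ENNReal.add_ne_top.mpr ⟨ENNReal.mul_ne_top ENNReal.ofReal_ne_top (hf i),
        ENNReal.sum_ne_top.mpr fun j _ => hc j⟩
    · simp only [treeOp]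
      gcongr with j _
      exact (Set.indicator_le_self _ _ _).trans (hcx j x)

theorem lintegral_treeOp_mul (hQ : ∀ i, MeasurableSet (Q i)) (hsub : ∀ i, ∀ j ∈ ch i, Q j ⊆ Q i)
    (hl : ∀ i, 0 ≤ lam i) {f g : α → ℝ≥0∞} (hg : Measurable g)
    (hf' : ∀ i, ∫⁻ y in Q i, f y ∂ν ≠ ⊤) (hg' : ∀ i, ∫⁻ y in Q i, g y ∂ν ≠ ⊤)
    (d : ℕ) (i : ι) :
    ∫⁻ x in Q i, treeOp ν ch Q lam f d i x * g x ∂ν =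
      ENNReal.ofReal (treeForm ch lam (fun j => (∫⁻ y in Q j, f y ∂ν).toReal)
        (fun j => (∫⁻ y in Q j, g y ∂ν).toReal) d i) := by
  induction d generalizing i with
  | zero => simp [treeOp, treeForm]
  | succ d ih =>
    simp only [treeOp, treeForm]
    have hm := fun j => measurable_treeOp (ν := ν) (ch := ch) (lam := lam) hQ f d j
    have e1 : ∀ x, (ENNReal.ofReal (lam i) * (∫⁻ y in Q i, f y ∂ν) +
        ∑ j ∈ ch i, (Q j).indicator (treeOp ν ch Q lam f d j) x) * g x =
        ENNReal.ofReal (lam i) * (∫⁻ y in Q i, f y ∂ν) * g x +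
        ∑ j ∈ ch i, (Q j).indicator (fun x => treeOp ν ch Q lam f d j x * g x) x := by
      intro x
      rw [add_mul, Finset.sum_mul]
      congr 1
      refine Finset.sum_congr rfl fun j _ => ?_
      by_cases hx : x ∈ Q j <;> simp [hx]
    simp only [e1]
    have hnn : ∀ j, 0 ≤ treeForm ch lam (fun j => (∫⁻ y in Q j, f y ∂ν).toReal)
        (fun j => (∫⁻ y in Q j, g y ∂ν).toReal) d j := fun j =>
      treeForm_nonneg hl (fun _ => ENNReal.toReal_nonneg) (fun _ => ENNReal.toReal_nonneg) d j
    rw [lintegral_add_left (by fun_prop), lintegral_const_mul _ hg, lintegral_finsetSum,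
      ENNReal.ofReal_add, ENNReal.ofReal_mul (hl i), ENNReal.ofReal_mul ENNReal.toReal_nonneg,
      ENNReal.ofReal_toReal (hf' i), ENNReal.ofReal_toReal (hg' i), mul_assoc,
      ENNReal.ofReal_sum_of_nonneg]
    · congr 1
      refine Finset.sum_congr rfl fun j hj => ?_
      rw [lintegral_indicator (hQ j), Measure.restrict_restrict (hQ j),
        Set.inter_eq_left.mpr (hsub i j hj), ih]
    · exact fun j _ => hnn j
    · exact mul_nonneg (hl i) (mul_nonneg ENNReal.toReal_nonneg ENNReal.toReal_nonneg)
    · exact Finset.sum_nonneg fun j _ => hnn j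
    · exact fun j _ => ((hm j).mul hg).indicator (hQ j)

theorem toReal_setLIntegral_eq_sum (hQ : ∀ i, MeasurableSet (Q i))
    (hU : ∀ i, Q i = ⋃ j ∈ ch i, Q j) (hD : ∀ i, (ch i : Set ι).PairwiseDisjoint Q)
    {f : α → ℝ≥0∞} (hf : ∀ i, ∫⁻ y in Q i, f y ∂ν ≠ ⊤) (i : ι) :
    (∫⁻ y in Q i, f y ∂ν).toReal = ∑ j ∈ ch i, (∫⁻ y in Q j, f y ∂ν).toReal := by
  conv_lhs => rw [hU i]
  rw [lintegral_biUnion_finset (hD i) (fun j _ => hQ j), ENNReal.toReal_sum fun j _ => hf j]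

/-- A positive dyadic operator satisfying the testing condition is bounded on `L²`. -/
theorem lintegral_treeOp_sq_le (hQ : ∀ i, MeasurableSet (Q i))
    (hU : ∀ i, Q i = ⋃ j ∈ ch i, Q j) (hD : ∀ i, (ch i : Set ι).PairwiseDisjoint Q)
    (hl : ∀ i, 0 ≤ lam i) (hν : ∀ i, ν (Q i) ≠ ⊤) (hν0 : ∀ i, ν (Q i) ≠ 0) {N : ℝ} (hN : 0 < N)
    (htest : ∀ d i, ∫⁻ x in Q i, treeOp ν ch Q lam 1 d i x ∂ν ≤ ENNReal.ofReal N * ν (Q i))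
    {f : α → ℝ≥0∞} (hf : Measurable f) (hf2 : ∀ i, ∫⁻ x in Q i, f x ^ 2 ∂ν ≠ ⊤) (d : ℕ) (i : ι) :
    ∫⁻ x in Q i, treeOp ν ch Q lam f d i x ^ 2 ∂ν ≤
      ENNReal.ofReal (16 * N ^ 2) * ∫⁻ x in Q i, f x ^ 2 ∂ν := by
  have hsub : ∀ i, ∀ j ∈ ch i, Q j ⊆ Q i := fun i j hj => by
    rw [hU i]; exact Set.subset_biUnion_of_mem (u := Q) hj
  have hCS : ∀ {h : α → ℝ≥0∞}, Measurable h → ∀ i, (∫⁻ x in Q i, h x ∂ν) ^ 2 ≤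
      (∫⁻ x in Q i, h x ^ 2 ∂ν) * ν (Q i) := by
    intro h hh i
    have := sq_lintegral_mul_le (ν.restrict (Q i)) hh.aemeasurable
      (measurable_const (a := (1 : ℝ≥0∞))).aemeasurable
    simpa using this
  have hL1 : ∀ {h : α → ℝ≥0∞}, Measurable h → (∀ i, ∫⁻ x in Q i, h x ^ 2 ∂ν ≠ ⊤) →
      ∀ i, ∫⁻ x in Q i, h x ∂ν ≠ ⊤ := by
    intro h hh hh2 i hi
    have := hCS hh i
    rw [hi] at this
    exact (ENNReal.mul_ne_top (hh2 i) (hν i)) (top_le_iff.mp (by simpa using this))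
  have hone : ∀ i, ∫⁻ x in Q i, (1 : α → ℝ≥0∞) x ∂ν ≠ ⊤ := fun i => by simpa using hν i
  have hν1 : ∀ i, ∫⁻ x in Q i, (1 : α → ℝ≥0∞) x ∂ν = ν (Q i) := fun i => by simp
  have htest' : ∀ d i, treeForm ch lam (fun j => (∫⁻ y in Q j, (1 : α → ℝ≥0∞) y ∂ν).toReal)
      (fun j => (∫⁻ y in Q j, (1 : α → ℝ≥0∞) y ∂ν).toReal) d i ≤
      N * (∫⁻ y in Q i, (1 : α → ℝ≥0∞) y ∂ν).toReal := by
    intro d i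
    have h1 := lintegral_treeOp_mul (ν := ν) (ch := ch) (lam := lam) hQ hsub hl
      (f := 1) (g := 1) measurable_one hone hone d i
    simp only [Pi.one_apply, mul_one] at h1
    have h2 := htest d i
    rw [h1] at h2
    simp only [Pi.one_apply] at *
    rw [← ENNReal.ofReal_le_ofReal_iff (by positivity), ENNReal.ofReal_mul hN.le,
      ENNReal.ofReal_toReal (hone i), hν1 i]
    exact h2
  have hself : ∀ {h : α → ℝ≥0∞}, Measurable h → (∀ i, ∫⁻ x in Q i, h x ^ 2 ∂ν ≠ ⊤) → ∀ i,
      treeForm ch lam (fun j => (∫⁻ y in Q j, h y ∂ν).toReal)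
        (fun j => (∫⁻ y in Q j, h y ∂ν).toReal) d i ≤
        4 * N * (∫⁻ x in Q i, h x ^ 2 ∂ν).toReal := by
    intro h hh hh2 i
    refine treeForm_self_le (P := fun j => (∫⁻ x in Q j, h x ^ 2 ∂ν).toReal) hN hl
      (fun j => ?_) (toReal_setLIntegral_eq_sum hQ hU hD hone)
      (toReal_setLIntegral_eq_sum hQ hU hD (hL1 hh hh2))
      (toReal_setLIntegral_eq_sum hQ hU hD hh2) (fun j => ?_) htest' d i
    · rw [hν1]; exact ENNReal.toReal_pos (hν0 j) (hν j)
    · rw [hν1, ← ENNReal.toReal_mul, ← ENNReal.toReal_pow]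
      exact ENNReal.toReal_mono (ENNReal.mul_ne_top (hh2 j) (hν j)) (hCS hh j)
  set g := treeOp ν ch Q lam f d i with hg
  have hgm : Measurable g := measurable_treeOp hQ f d i
  obtain ⟨c, hc, hgc⟩ := exists_treeOp_le (ν := ν) (ch := ch) (lam := lam) f (hL1 hf hf2) d i
  have hg2 : ∀ j, ∫⁻ x in Q j, g x ^ 2 ∂ν ≠ ⊤ := by
    intro j
    refine ne_top_of_le_ne_top (ENNReal.mul_ne_top (ENNReal.pow_ne_top (n := 2) hc) (hν j)) ?_
    calc ∫⁻ x in Q j, g x ^ 2 ∂ν ≤ ∫⁻ x in Q j, c ^ 2 ∂ν :=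
          lintegral_mono fun x => pow_le_pow_left' (hgc x) 2
      _ = c ^ 2 * ν (Q j) := by simp
  have h1 := lintegral_treeOp_mul (ν := ν) (ch := ch) (lam := lam) hQ hsub hl hgm
    (hL1 hf hf2) (hL1 hgm hg2) d i
  have h2 := two_mul_treeForm_le (ch := ch) (F := fun j => (∫⁻ y in Q j, f y ∂ν).toReal)
    (G := fun j => (∫⁻ y in Q j, g y ∂ν).toReal) hl (show 0 < 4 * N by positivity) d i
  have h3 := hself hf hf2 i
  have h4 := hself hgm hg2 i
  have h5 : ∫⁻ x in Q i, g x ^ 2 ∂ν = ENNReal.ofReal (treeForm ch lam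
      (fun j => (∫⁻ y in Q j, f y ∂ν).toReal) (fun j => (∫⁻ y in Q j, g y ∂ν).toReal) d i) := by
    rw [← h1]
    exact lintegral_congr fun x => sq (g x)
  have h6 : (∫⁻ x in Q i, g x ^ 2 ∂ν).toReal = treeForm ch lam
      (fun j => (∫⁻ y in Q j, f y ∂ν).toReal) (fun j => (∫⁻ y in Q j, g y ∂ν).toReal) d i := by
    rw [h5, ENNReal.toReal_ofReal]
    exact treeForm_nonneg hl (fun _ => ENNReal.toReal_nonneg) (fun _ => ENNReal.toReal_nonneg) d i
  rw [← h6] at h2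
  set L := (∫⁻ x in Q i, g x ^ 2 ∂ν).toReal with hL
  set P := (∫⁻ x in Q i, f x ^ 2 ∂ν).toReal with hP
  have h7 : L ≤ 16 * N ^ 2 * P := by
    have a1 := mul_le_mul_of_nonneg_left h3 (show 0 ≤ 4 * N by positivity)
    have a2 := mul_le_mul_of_nonneg_left h4 (show 0 ≤ (4 * N)⁻¹ by positivity)
    rw [inv_mul_cancel_left₀ (by positivity)] at a2
    nlinarith
  rw [← ENNReal.ofReal_toReal (hg2 i), ← ENNReal.ofReal_toReal (hf2 i),
    ← ENNReal.ofReal_mul (by positivity)]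
  exact ENNReal.ofReal_le_ofReal h7

end tree

/-- The index of the dyadic cube of side `2π / 2 ^ k` containing a point. -/
def cellIdx (k : ℕ) (x : E3) : Fin 3 → ℤ := fun i => ⌊2 ^ k * (x i / (2 * π))⌋

/-- The half-open dyadic cube of side `2π / 2 ^ k` with a given index. -/
def dyadicCell (q : ℕ × (Fin 3 → ℤ)) : Set E3 := cellIdx q.1 ⁻¹' {q.2}

/-- The indices of the eight dyadic subcubes of a dyadic cube. -/
def dyadicChildren (q : ℕ × (Fin 3 → ℤ)) : Finset (ℕ × (Fin 3 → ℤ)) :=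
  Finset.univ.image fun e : Fin 3 → Fin 2 => (q.1 + 1, fun i => 2 * q.2 i + (e i : ℕ))

theorem measurable_cellIdx (k : ℕ) : Measurable (cellIdx k) := by
  refine measurable_pi_lambda _ fun i => Int.measurable_floor.comp ?_
  fun_prop

theorem measurableSet_dyadicCell (q : ℕ × (Fin 3 → ℤ)) : MeasurableSet (dyadicCell q) :=
  measurable_cellIdx _ (measurableSet_singleton _)

theorem mem_dyadicCell {q : ℕ × (Fin 3 → ℤ)} {x : E3} :
    x ∈ dyadicCell q ↔ cellIdx q.1 x = q.2 := Iff.rfl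

theorem cellIdx_succ (k : ℕ) (x : E3) :
    ∃ e : Fin 3 → Fin 2, cellIdx (k + 1) x = fun i => 2 * cellIdx k x i + (e i : ℕ) := by
  have h : ∀ i, ∃ e : Fin 2, cellIdx (k + 1) x i = 2 * cellIdx k x i + (e : ℕ) := by
    intro i
    simp only [cellIdx]
    have e1 : (2 : ℝ) ^ (k + 1) * (x i / (2 * π)) = 2 * (2 ^ k * (x i / (2 * π))) := by ring
    rw [e1]
    set y := (2 : ℝ) ^ k * (x i / (2 * π))
    have h1 := Int.floor_le y
    have h2 := Int.lt_floor_add_one y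
    by_cases hy : 2 * y < 2 * ⌊y⌋ + 1
    · refine ⟨0, ?_⟩
      rw [Int.floor_eq_iff]
      push_cast
      constructor <;> simp <;> linarith
    · refine ⟨1, ?_⟩
      rw [Int.floor_eq_iff]
      push_cast
      constructor <;> simp <;> linarith
  choose e he using h
  exact ⟨e, funext he⟩

theorem dyadicCell_eq_biUnion (q : ℕ × (Fin 3 → ℤ)) :
    dyadicCell q = ⋃ j ∈ dyadicChildren q, dyadicCell j := by
  ext x
  obtain ⟨e, he⟩ := cellIdx_succ q.1 x
  simp only [Set.mem_iUnion, dyadicChildren, Finset.mem_image, Finset.mem_univ, true_and,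
    exists_prop, mem_dyadicCell]
  constructor
  · intro hx
    exact ⟨_, ⟨e, rfl⟩, by rw [he, hx]⟩
  · rintro ⟨_, ⟨e', rfl⟩, hx⟩
    dsimp only at hx
    rw [he] at hx
    ext i
    have := congrFun hx i
    have h1 := (e i).isLt
    have h2 := (e' i).isLt
    omega

theorem pairwiseDisjoint_dyadicChildren (q : ℕ × (Fin 3 → ℤ)) :
    (dyadicChildren q : Set (ℕ × (Fin 3 → ℤ))).PairwiseDisjoint dyadicCell := by
  intro i hi j hj hij
  refine Set.disjoint_left.mpr fun x hx hx' => hij ?_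
  simp only [dyadicChildren, Finset.coe_image, Finset.coe_univ, Set.image_univ,
    Set.mem_range] at hi hj
  obtain ⟨e, rfl⟩ := hi
  obtain ⟨e', rfl⟩ := hj
  rw [mem_dyadicCell] at hx hx'
  dsimp only at hx hx' ⊢
  rw [← hx, ← hx']

/-- The dyadic cube of level `k` containing `x`. -/
def cellAt (k : ℕ) (x : E3) : Set E3 := dyadicCell (k, cellIdx k x)

theorem mem_cellAt {k : ℕ} {x y : E3} : y ∈ cellAt k x ↔ cellIdx k y = cellIdx k x := Iff.rfl

theorem cellAt_subset {q : ℕ × (Fin 3 → ℤ)} {x : E3} (hx : x ∈ dyadicCell q) (m : ℕ) :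
    cellAt (q.1 + m) x ⊆ dyadicCell q := by
  intro y hy
  have key : ∀ m k, cellIdx (k + m) y = cellIdx (k + m) x → cellIdx k y = cellIdx k x := by
    intro m
    induction m with
    | zero => intro k h; exact h
    | succ m ih =>
      intro k h
      rw [← add_assoc] at h
      refine ih k ?_
      obtain ⟨e, he⟩ := cellIdx_succ (k + m) x
      obtain ⟨e', he'⟩ := cellIdx_succ (k + m) y
      rw [he, he'] at h
      ext i
      have := congrFun h i
      have h1 := (e i).isLt
      have h2 := (e' i).isLt
      omega
  rw [mem_dyadicCell] at hx ⊢
  rw [← hx]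
  exact key m q.1 hy

theorem treeOp_dyadic_apply (ν : Measure E3) (f : E3 → ℝ≥0∞) (d : ℕ) (q : ℕ × (Fin 3 → ℤ))
    {x : E3} (hx : x ∈ dyadicCell q) :
    treeOp ν dyadicChildren dyadicCell (fun q => (2 : ℝ) ^ q.1) f d q x =
      ∑ m ∈ Finset.range d, (2 : ℝ≥0∞) ^ (q.1 + m) * ∫⁻ y in cellAt (q.1 + m) x, f y ∂ν := by
  induction d generalizing q with
  | zero => simp [treeOp]
  | succ d ih =>
    rw [Finset.sum_range_succ']
    simp only [treeOp, add_zero]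
    rw [add_comm]
    congr 1
    · have hx' := hx
      rw [dyadicCell_eq_biUnion] at hx'
      simp only [Set.mem_iUnion, exists_prop] at hx'
      obtain ⟨j, hj, hxj⟩ := hx'
      rw [Finset.sum_eq_single_of_mem j hj]
      · rw [Set.indicator_of_mem hxj, ih j hxj]
        have : j.1 = q.1 + 1 := by
          simp only [dyadicChildren, Finset.mem_image] at hj
          obtain ⟨e, -, rfl⟩ := hj
          rfl
        refine Finset.sum_congr rfl fun m _ => ?_
        have e : j.1 + m = q.1 + (m + 1) := by omega
        rw [e]
      · intro b hb hbj
        refine Set.indicator_of_notMem (fun hxb => ?_) _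
        exact Set.disjoint_left.mp (pairwiseDisjoint_dyadicChildren q hb hj hbj) hxb hxj
    · rw [ENNReal.ofReal_pow (by norm_num), ENNReal.ofReal_ofNat]
      have : cellAt q.1 x = dyadicCell q := by
        rw [cellAt, mem_dyadicCell.mp hx]
      rw [this]

theorem edist_le_of_cellIdx_eq {k : ℕ} {x y : E3} (h : cellIdx k y = cellIdx k x) :
    edist x y ≤ ENNReal.ofReal (6 * π / 2 ^ k) := by
  rw [edist_dist]
  refine ENNReal.ofReal_le_ofReal ?_
  have hc : ∀ i, |x i - y i| ≤ 2 * π / 2 ^ k := by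
    intro i
    have h1 := Int.abs_sub_lt_one_of_floor_eq_floor (congrFun h i)
    rw [show (2 : ℝ) ^ k * (y i / (2 * π)) - 2 ^ k * (x i / (2 * π)) =
      2 ^ k / (2 * π) * (y i - x i) by ring, abs_mul, abs_of_pos (by positivity), abs_sub_comm,
      div_mul_eq_mul_div, div_lt_one (by positivity)] at h1
    rw [le_div_iff₀ (by positivity)]
    linarith
  rw [EuclideanSpace.dist_eq, Real.sqrt_le_iff]
  refine ⟨by positivity, ?_⟩
  rw [Fin.sum_univ_three]
  simp only [Real.dist_eq]
  have e : 6 * π / 2 ^ k = 3 * (2 * π / 2 ^ k) := by ring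
  rw [e]
  have hp : 0 ≤ 2 * π / 2 ^ k := by positivity
  nlinarith [hc 0, hc 1, hc 2, abs_nonneg (x 0 - y 0), abs_nonneg (x 1 - y 1),
    abs_nonneg (x 2 - y 2)]

theorem volume_hyperplane_eq_zero (i : Fin 3) (c : ℝ) : volume {x : E3 | x i = c} = 0 := by
  have h := (PiLp.volume_preserving_ofLp (Fin 3)).measure_preimage
    (s := {f : Fin 3 → ℝ | f i = c}) (MeasurableSet.nullMeasurableSet
      (measurableSet_eq_fun (measurable_pi_apply i) measurable_const))
  have h2 := Measure.pi_hyperplane (fun _ : Fin 3 => (volume : Measure ℝ)) i c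
  rw [← volume_pi] at h2
  rw [h2] at h
  exact h

/-- The center of a dyadic cube. -/
def cellCenter (q : ℕ × (Fin 3 → ℤ)) : E3 :=
  WithLp.toLp 2 fun i => (q.2 i + 1 / 2) * (2 * π / 2 ^ q.1)

theorem mem_dyadicCell_iff_coord {q : ℕ × (Fin 3 → ℤ)} {x : E3} : x ∈ dyadicCell q ↔
    ∀ i, q.2 i * (2 * π / 2 ^ q.1) ≤ x i ∧ x i < (q.2 i + 1) * (2 * π / 2 ^ q.1) := by
  rw [mem_dyadicCell, funext_iff]
  refine forall_congr' fun i => ?_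
  simp only [cellIdx]
  have e : (2 : ℝ) ^ q.1 * (x i / (2 * π)) = x i / (2 * π / 2 ^ q.1) := by
    field_simp
  rw [e, Int.floor_eq_iff, le_div_iff₀ (by positivity), div_lt_iff₀ (by positivity)]

theorem dyadicCell_subset_cube3 (q : ℕ × (Fin 3 → ℤ)) :
    dyadicCell q ⊆ cube3 (cellCenter q) (2 * π / 2 ^ q.1) := by
  intro x hx i
  have := mem_dyadicCell_iff_coord.mp hx i
  simp only [cellCenter]
  rw [abs_le]
  constructor <;> linarith

theorem dyadicCell_ae_eq_cube3 (q : ℕ × (Fin 3 → ℤ)) :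
    dyadicCell q =ᵐ[volume] cube3 (cellCenter q) (2 * π / 2 ^ q.1) := by
  have h : ∀ᵐ x : E3, ∀ i, x i ≠ (q.2 i + 1) * (2 * π / 2 ^ q.1) := by
    rw [ae_all_iff]
    intro i
    have := volume_hyperplane_eq_zero i ((q.2 i + 1) * (2 * π / 2 ^ q.1))
    simpa [ae_iff] using this
  filter_upwards [h] with x hx
  refine propext ⟨fun h => dyadicCell_subset_cube3 q h, fun h => ?_⟩
  refine mem_dyadicCell_iff_coord.mpr fun i => ?_
  have h1 := abs_le.mp (h i)
  simp only [cellCenter] at h1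
  refine ⟨by linarith [h1.1], lt_of_le_of_ne (by linarith [h1.2]) (hx i)⟩

/-- The local Kerman–Sawyer bound over all cubes of side less than `4π`. -/
def KSBound (w : E3 → ℝ≥0∞) (N : ℝ) : Prop :=
  ∀ (z : E3) (r : ℝ), 0 < r → r < 4 * π →
    ∫⁻ x in cube3 z r, ∫⁻ y in cube3 z r, w x * w y / edist x y ≤
      ENNReal.ofReal N * ∫⁻ x in cube3 z r, w x

theorem KSBound.lintegral_dyadicCell_le {w : E3 → ℝ≥0∞} {N : ℝ} (h : KSBound w N) (q : ℕ × (Fin 3 → ℤ)) :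
    ∫⁻ x in dyadicCell q, ∫⁻ y in dyadicCell q, w x * w y / edist x y ≤
      ENNReal.ofReal N * ∫⁻ x in dyadicCell q, w x := by
  have e := dyadicCell_ae_eq_cube3 q
  rw [Measure.restrict_congr_set e]
  refine h _ _ (by positivity) ?_
  rw [div_lt_iff₀ (by positivity)]
  have : (1 : ℝ) ≤ 2 ^ q.1 := one_le_pow₀ (by norm_num)
  nlinarith [Real.pi_pos]

theorem sum_indicator_cellAt_le (k d : ℕ) (x y : E3) :
    ∑ m ∈ Finset.range d, (2 : ℝ≥0∞) ^ (k + m) * (cellAt (k + m) x).indicator 1 y ≤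
      ENNReal.ofReal (12 * π) / edist x y := by
  rw [ENNReal.le_div_iff_mul_le (Or.inr (by simp [Real.pi_pos]))
    (Or.inr ENNReal.ofReal_ne_top)]
  induction d with
  | zero => simp
  | succ d ih =>
    by_cases hy : y ∈ cellAt (k + d) x
    · have h1 : ∑ m ∈ Finset.range (d + 1),
          (2 : ℝ≥0∞) ^ (k + m) * (cellAt (k + m) x).indicator 1 y ≤ 2 ^ (k + d + 1) := by
        calc _ ≤ ∑ m ∈ Finset.range (d + 1), (2 : ℝ≥0∞) ^ (k + m) := by
              refine Finset.sum_le_sum fun m _ => ?_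
              refine mul_le_of_le_one_right' ?_
              exact Set.indicator_le_self' (by simp) y
          _ ≤ 2 ^ (k + d + 1) := by
              have : ∀ d : ℕ, ∑ m ∈ Finset.range d, (2 : ℝ≥0∞) ^ (k + m) ≤ 2 ^ (k + d) := by
                intro d
                induction d with
                | zero => simp
                | succ d ih =>
                  rw [Finset.sum_range_succ, ← add_assoc, pow_succ, mul_two]
                  gcongr
              exact this (d + 1)
      calc _ ≤ 2 ^ (k + d + 1) * ENNReal.ofReal (6 * π / 2 ^ (k + d)) := by
            gcongr
            exact edist_le_of_cellIdx_eq (mem_cellAt.mp hy)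
        _ = ENNReal.ofReal (12 * π) := by
            rw [show (2 : ℝ≥0∞) = ENNReal.ofReal 2 by simp, ← ENNReal.ofReal_pow (by norm_num),
              ← ENNReal.ofReal_mul (by positivity)]
            congr 1
            field_simp
            ring
    · rw [Finset.sum_range_succ, Set.indicator_of_notMem hy, mul_zero, add_zero]
      exact ih

theorem KSBound.treeOp_testing {w : E3 → ℝ≥0∞} (hw : Measurable w) {N : ℝ} (h : KSBound w N)
    (d : ℕ) (q : ℕ × (Fin 3 → ℤ)) :
    ∫⁻ x in dyadicCell q, treeOp (volume.withDensity w) dyadicChildren dyadicCell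
        (fun q => (2 : ℝ) ^ q.1) 1 d q x ∂(volume.withDensity w) ≤
      ENNReal.ofReal (12 * π * N) * (volume.withDensity w) (dyadicCell q) := by
  have hQ := measurableSet_dyadicCell q
  have hm := measurable_treeOp (ν := volume.withDensity w) (ch := dyadicChildren)
    (lam := fun q => (2 : ℝ) ^ q.1) measurableSet_dyadicCell (1 : E3 → ℝ≥0∞) d q
  rw [setLIntegral_withDensity_eq_setLIntegral_mul _ hw hm hQ, withDensity_apply _ hQ]
  have hmd : ∀ x : E3, Measurable fun y => w y / edist x y := fun x =>
    hw.div (measurable_const.edist measurable_id)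
  have hpt : ∀ x ∈ dyadicCell q, treeOp (volume.withDensity w) dyadicChildren
      dyadicCell (fun q => (2 : ℝ) ^ q.1) 1 d q x ≤
      ENNReal.ofReal (12 * π) * ∫⁻ y in dyadicCell q, w y / edist x y := by
    intro x hx
    rw [treeOp_dyadic_apply _ _ _ _ hx]
    have e1 : ∀ m, ∫⁻ y in cellAt (q.1 + m) x, (1 : E3 → ℝ≥0∞) y ∂(volume.withDensity w) =
        ∫⁻ y in dyadicCell q, (cellAt (q.1 + m) x).indicator 1 y * w y := by
      intro m
      have hc : MeasurableSet (cellAt (q.1 + m) x) := measurableSet_dyadicCell _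
      rw [setLIntegral_withDensity_eq_setLIntegral_mul _ hw measurable_one hc]
      have : ∀ y, (cellAt (q.1 + m) x).indicator 1 y * w y =
          (cellAt (q.1 + m) x).indicator w y := fun y => by
        by_cases hy : y ∈ cellAt (q.1 + m) x <;> simp [hy]
      simp only [this]
      rw [lintegral_indicator hc, Measure.restrict_restrict hc,
        Set.inter_eq_left.mpr (cellAt_subset hx m)]
      simp
    simp only [e1]
    have hmi : ∀ m, Measurable fun y => (cellAt (q.1 + m) x).indicator (1 : E3 → ℝ≥0∞) y * w y :=
      fun m => (measurable_one.indicator (measurableSet_dyadicCell _)).mul hw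
    simp only [← lintegral_const_mul _ (hmi _)]
    rw [← lintegral_finsetSum _ (fun m _ => (hmi m).const_mul _), ← lintegral_const_mul _
      (hmd x)]
    refine lintegral_mono fun y => ?_
    show ∑ m ∈ Finset.range d, (2 : ℝ≥0∞) ^ (q.1 + m) *
      ((cellAt (q.1 + m) x).indicator 1 y * w y) ≤ ENNReal.ofReal (12 * π) * (w y / edist x y)
    simp only [← mul_assoc]
    rw [← Finset.sum_mul]
    refine (mul_le_mul_left (sum_indicator_cellAt_le q.1 d x y) _).trans (le_of_eq ?_)
    rw [div_eq_mul_inv, div_eq_mul_inv]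
    ring
  calc _ ≤ ∫⁻ x in dyadicCell q, ENNReal.ofReal (12 * π) *
          ∫⁻ y in dyadicCell q, w x * w y / edist x y := by
        refine setLIntegral_mono' hQ fun x hx => ?_
        refine (mul_le_mul_right (hpt x hx) _).trans (le_of_eq ?_)
        rw [← mul_assoc, mul_comm (w x), mul_assoc, ← lintegral_const_mul _
          (hmd x)]
        simp only [mul_div_assoc]
    _ = ENNReal.ofReal (12 * π) * ∫⁻ x in dyadicCell q,
          ∫⁻ y in dyadicCell q, w x * w y / edist x y := by
        rw [lintegral_const_mul' _ _ ENNReal.ofReal_ne_top]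
    _ ≤ ENNReal.ofReal (12 * π) * (ENNReal.ofReal N * ∫⁻ x in dyadicCell q, w x) := by
        gcongr
        exact h.lintegral_dyadicCell_le q
    _ = _ := by
        rw [← mul_assoc, ← ENNReal.ofReal_mul (by positivity)]

theorem dyadicCell_mem_nhds (q : ℕ × (Fin 3 → ℤ)) : dyadicCell q ∈ nhds (cellCenter q) := by
  have h : ∀ i : Fin 3, ∀ᶠ x : E3 in nhds (cellCenter q),
      q.2 i * (2 * π / 2 ^ q.1) < x i ∧ x i < (q.2 i + 1) * (2 * π / 2 ^ q.1) := by
    intro i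
    have hc : Continuous fun x : E3 => x i := by fun_prop
    have hp : 0 < 2 * π / 2 ^ q.1 := by positivity
    refine (hc.continuousAt.eventually_const_lt ?_).and (hc.continuousAt.eventually_lt_const ?_) <;>
    · simp only [cellCenter]
      nlinarith
  filter_upwards [eventually_all.mpr h] with x hx
  exact mem_dyadicCell_iff_coord.mpr fun i => ⟨(hx i).1.le, (hx i).2⟩

theorem Ω3_eq_dyadicCell : Ω3 = dyadicCell (0, 0) := by
  ext x
  rw [mem_dyadicCell_iff_coord]
  simp [Ω3]

theorem cellCenter_mem (q : ℕ × (Fin 3 → ℤ)) : cellCenter q ∈ dyadicCell q :=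
  mem_of_mem_nhds (dyadicCell_mem_nhds q)

theorem dyadicCell_subset_level_zero (q : ℕ × (Fin 3 → ℤ)) :
    dyadicCell q ⊆ dyadicCell (0, cellIdx 0 (cellCenter q)) := by
  have h := cellAt_subset (q := (0, cellIdx 0 (cellCenter q))) (x := cellCenter q) rfl q.1
  simp only [zero_add] at h
  rwa [cellAt, mem_dyadicCell.mp (cellCenter_mem q)] at h

theorem ae_ne_top_of_lintegral_dyadicCell {w : E3 → ℝ≥0∞} (hw : Measurable w)
    (hwfin : ∀ n, ∫⁻ x in dyadicCell (0, n), w x ≠ ⊤) : ∀ᵐ x, w x ≠ ⊤ := by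
  have h : ∀ n, ∀ᵐ x : E3, x ∈ dyadicCell (0, n) → w x < ⊤ := fun n =>
    (ae_restrict_iff' (measurableSet_dyadicCell _)).mp (ae_lt_top hw (hwfin n))
  filter_upwards [ae_all_iff.mpr h] with x hx
  exact (hx (cellIdx 0 x) rfl).ne

/-- The dyadic model of the Newtonian potential. -/
def dyadicOp (f : E3 → ℝ≥0∞) (x : E3) : ℝ≥0∞ :=
  ∑' m : ℕ, 2 ^ m * ∫⁻ y in cellAt m x, f y

/-- The two-weight bound for the dyadic Newtonian potential on the fundamental cell. -/
theorem KSBound.lintegral_dyadicOp_sq_le {w : E3 → ℝ≥0∞} (hw : Measurable w) (hw0 : ∀ x, w x ≠ 0)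
    (hwfin : ∀ n, ∫⁻ x in dyadicCell (0, n), w x ≠ ⊤) {N : ℝ} (hN : 0 < N) (h : KSBound w N)
    {f : E3 → ℝ≥0∞} (hf : Measurable f)
    (hf2 : ∀ n, ∫⁻ x in dyadicCell (0, n), f x ^ 2 * (w x)⁻¹ ≠ ⊤) :
    ∫⁻ x in Ω3, dyadicOp f x ^ 2 * w x ≤
      ENNReal.ofReal (16 * (12 * π * N) ^ 2) * ∫⁻ x in Ω3, f x ^ 2 * (w x)⁻¹ := by
  have hwt := ae_ne_top_of_lintegral_dyadicCell hw hwfin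
  set ν := volume.withDensity w with hνdef
  set g : E3 → ℝ≥0∞ := fun x => f x * (w x)⁻¹ with hg
  have hgm : Measurable g := hf.mul hw.inv
  have hsq : ∀ q, ∫⁻ x in dyadicCell q, g x ^ 2 ∂ν =
      ∫⁻ x in dyadicCell q, f x ^ 2 * (w x)⁻¹ := by
    intro q
    rw [setLIntegral_withDensity_eq_setLIntegral_mul _ hw (hgm.pow_const 2)
      (measurableSet_dyadicCell q)]
    refine lintegral_congr_ae (ae_restrict_of_ae ?_)
    filter_upwards [hwt] with x hx
    simp only [Pi.mul_apply, hg]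
    rw [mul_pow, sq (w x)⁻¹, mul_left_comm, ← mul_assoc (w x), ENNReal.mul_inv_cancel (hw0 x) hx,
      one_mul]
  have hone : ∀ m x, ∫⁻ y in cellAt m x, g y ∂ν = ∫⁻ y in cellAt m x, f y := by
    intro m x
    rw [cellAt, setLIntegral_withDensity_eq_setLIntegral_mul _ hw hgm (measurableSet_dyadicCell _)]
    refine lintegral_congr_ae (ae_restrict_of_ae ?_)
    filter_upwards [hwt] with x hx
    simp only [Pi.mul_apply, hg]
    rw [mul_left_comm, ENNReal.mul_inv_cancel (hw0 x) hx, mul_one]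
  have hmain := fun d => lintegral_treeOp_sq_le (ν := ν) (ch := dyadicChildren)
    (lam := fun q => (2 : ℝ) ^ q.1) measurableSet_dyadicCell dyadicCell_eq_biUnion
    pairwiseDisjoint_dyadicChildren (fun q => by positivity)
    (fun q => by
      rw [hνdef, withDensity_apply _ (measurableSet_dyadicCell q)]
      exact ne_top_of_le_ne_top (hwfin _) (lintegral_mono_set (dyadicCell_subset_level_zero q)))
    (fun q => by
      rw [hνdef, withDensity_apply _ (measurableSet_dyadicCell q), Ne,
        lintegral_eq_zero_iff hw]
      intro h0
      have h1 : ∀ᵐ x ∂(volume.restrict (dyadicCell q)), False := by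
        filter_upwards [h0] with x hx using hw0 x hx
      rw [eventually_false_iff_eq_bot, ae_eq_bot, Measure.restrict_eq_zero] at h1
      exact (Measure.measure_pos_of_mem_nhds volume (dyadicCell_mem_nhds q)).ne' h1)
    (show 0 < 12 * π * N by positivity)
    (fun d q => h.treeOp_testing hw d q) hgm
    (fun q => by
      rw [hsq]
      exact ne_top_of_le_ne_top (hf2 _) (lintegral_mono_set (dyadicCell_subset_level_zero q))) d (0, 0)
  have hsqΩ := hsq (0, 0)
  simp only [← Ω3_eq_dyadicCell] at hmain hsqΩ
  simp only [hsqΩ] at hmain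
  have hΩm : MeasurableSet Ω3 := Ω3_eq_dyadicCell ▸ measurableSet_dyadicCell _
  set F : ℕ → E3 → ℝ≥0∞ := fun d x => treeOp ν dyadicChildren dyadicCell
    (fun q => (2 : ℝ) ^ q.1) g d (0, 0) x with hF
  have hFm : ∀ d, Measurable (F d) := fun d => measurable_treeOp measurableSet_dyadicCell g d (0, 0)
  have hFx : ∀ x ∈ Ω3, Tendsto (fun d => F d x) atTop (nhds (dyadicOp f x)) := by
    intro x hx
    have e : ∀ d, F d x = ∑ m ∈ Finset.range d, 2 ^ m * ∫⁻ y in cellAt m x, f y := by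
      intro d
      simp only [hF]
      rw [treeOp_dyadic_apply ν g d (0, 0) (Ω3_eq_dyadicCell ▸ hx)]
      simp only [zero_add, hone]
    simp only [e]
    exact ENNReal.tendsto_nat_tsum _
  calc ∫⁻ x in Ω3, dyadicOp f x ^ 2 * w x
      ≤ ∫⁻ x in Ω3, liminf (fun d => F d x ^ 2 * w x) atTop := by
        refine lintegral_mono_ae ?_
        filter_upwards [ae_restrict_of_ae hwt, ae_restrict_mem hΩm] with x hx hxΩ
        exact (ENNReal.Tendsto.mul_const (ENNReal.Tendsto.pow (hFx x hxΩ))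
          (Or.inr hx)).liminf_eq.ge
    _ ≤ liminf (fun d => ∫⁻ x in Ω3, F d x ^ 2 * w x) atTop :=
        lintegral_liminf_le fun d => ((hFm d).pow_const 2).mul hw
    _ ≤ ENNReal.ofReal (16 * (12 * π * N) ^ 2) * ∫⁻ x in Ω3, f x ^ 2 * (w x)⁻¹ := by
        refine liminf_le_of_le (by isBoundedDefault) fun b hb => ?_
        obtain ⟨d, hd⟩ := hb.exists
        refine hd.trans (le_trans (le_of_eq ?_) (hmain d))
        rw [setLIntegral_withDensity_eq_setLIntegral_mul _ hw ((hFm d).pow_const 2) hΩm]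
        exact lintegral_congr fun x => mul_comm _ _

/-- The vector `2πn`. -/
def latVec (n : Fin 3 → ℤ) : E3 := (WithLp.equiv 2 (Fin 3 → ℝ)).symm (fun i => 2 * π * n i)

theorem latVec_apply (n : Fin 3 → ℤ) (i : Fin 3) : latVec n i = 2 * π * n i := rfl

/-- The lattice `(2πℤ)³`. -/
def periodLattice : AddSubgroup E3 :=
  AddMonoidHom.range (AddMonoidHom.mk' latVec (by
    intro a b; ext i; simp only [latVec_apply, PiLp.add_apply, Pi.add_apply]; push_cast; ring))

instance : Countable periodLattice := by
  have : Function.Surjective (fun n : Fin 3 → ℤ => (⟨latVec n, n, rfl⟩ : periodLattice)) := by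
    rintro ⟨_, n, rfl⟩; exact ⟨n, rfl⟩
  exact this.countable

theorem isAddFundamentalDomain_shift (t : E3) :
    IsAddFundamentalDomain periodLattice {x : E3 | x + t ∈ Ω3} volume := by
  have hpi := Real.pi_pos
  refine IsAddFundamentalDomain.mk' ?_ ?_
  · rw [Ω3_eq_dyadicCell]
    exact ((measurable_add_const t) (measurableSet_dyadicCell _)).nullMeasurableSet
  · intro x
    have key : ∀ n : Fin 3 → ℤ, latVec n + x + t ∈ Ω3 ↔ ∀ i, n i = -⌊(x i + t i) / (2 * π)⌋ := by
      intro n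
      simp only [Ω3, Set.mem_ofPred_eq, PiLp.add_apply, latVec_apply]
      refine forall_congr' fun i => ?_
      rw [eq_neg_iff_add_eq_zero, add_comm (n i), ← Int.floor_add_intCast, Int.floor_eq_zero_iff,
        Set.mem_Ico]
      have e : 2 * π * (n i) + x i + t i = ((x i + t i) / (2 * π) + n i) * (2 * π) := by
        field_simp; ring
      rw [e]
      constructor
      · rintro ⟨h1, h2⟩
        constructor <;> nlinarith
      · rintro ⟨h1, h2⟩
        constructor <;> nlinarith
    refine ⟨⟨latVec fun i => -⌊(x i + t i) / (2 * π)⌋, _, rfl⟩, ?_, ?_⟩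
    · exact (key _).2 fun i => rfl
    · rintro ⟨_, n, rfl⟩ h
      have := (key n).1 h
      have : n = fun i => -⌊(x i + t i) / (2 * π)⌋ := funext this
      subst this; rfl

theorem Periodic3.vadd {α : Type*} {G : E3 → α} (hG : Periodic3 G) (g : periodLattice) (x : E3) :
    G (g +ᵥ x) = G x := by
  obtain ⟨_, n, rfl⟩ := g
  have := hG x n
  rw [← this, add_comm]; rfl

theorem Periodic3.setLIntegral_shift {G : E3 → ℝ≥0∞} (hG : Periodic3 G) (t : E3) :
    ∫⁻ x in {x : E3 | x + t ∈ Ω3}, G x = ∫⁻ x in Ω3, G x := by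
  have h0 : {x : E3 | x + 0 ∈ Ω3} = Ω3 := by simp
  have h := (isAddFundamentalDomain_shift t).setLIntegral_eq (isAddFundamentalDomain_shift 0) G
    fun g x => hG.vadd g x
  rwa [h0] at h

theorem measurableSet_Ω3 : MeasurableSet Ω3 := by
  rw [Ω3_eq_dyadicCell]; exact measurableSet_dyadicCell _

/-- The integral of a periodic function over a period cell is translation invariant. -/
theorem Periodic3.lintegral_add {G : E3 → ℝ≥0∞} (hG : Periodic3 G) (t : E3) :
    ∫⁻ x in Ω3, G (x + t) = ∫⁻ x in Ω3, G x := by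
  rw [← hG.setLIntegral_shift (-t)]
  rw [← lintegral_indicator measurableSet_Ω3, ← lintegral_indicator (by
    exact (measurable_add_const (-t)) measurableSet_Ω3),
    ← lintegral_add_right_eq_self (Set.indicator {x | x + -t ∈ Ω3} G) t]
  refine lintegral_congr fun x => ?_
  simp only [Set.indicator, Set.mem_ofPred_eq, add_neg_cancel_right]

theorem mem_cell_zero_iff (n : Fin 3 → ℤ) (x : E3) :
    x ∈ dyadicCell (0, n) ↔ x + latVec (-n) ∈ Ω3 := by
  rw [mem_dyadicCell_iff_coord]
  simp only [Ω3, Set.mem_ofPred_eq, PiLp.add_apply, latVec_apply]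
  refine forall_congr' fun i => ?_
  simp only [pow_zero, div_one, Pi.neg_apply]
  push_cast
  constructor <;> rintro ⟨h1, h2⟩ <;> constructor <;> linarith

theorem Periodic3.lintegral_dyadicCell_zero {G : E3 → ℝ≥0∞} (hG : Periodic3 G) (n : Fin 3 → ℤ) :
    ∫⁻ x in dyadicCell (0, n), G x = ∫⁻ x in Ω3, G x := by
  rw [← hG.setLIntegral_shift (latVec (-n))]
  congr 2
  ext x; exact mem_cell_zero_iff n x

theorem measurableSet_cube3 (z : E3) (r : ℝ) : MeasurableSet (cube3 z r) := by
  have : cube3 z r = ⋂ i, {x : E3 | |x i - z i| ≤ r / 2} := by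
    ext x; simp [cube3]
  rw [this]
  exact MeasurableSet.iInter fun i => measurableSet_le (by fun_prop) measurable_const

theorem lintegral_cube3_add (F : E3 → ℝ≥0∞) (z v : E3) (r : ℝ) :
    ∫⁻ x in cube3 (z + v) r, F x = ∫⁻ x in cube3 z r, F (x + v) := by
  rw [← lintegral_indicator (measurableSet_cube3 _ _), ← lintegral_indicator
    (measurableSet_cube3 _ _), ← lintegral_add_right_eq_self (Set.indicator (cube3 (z + v) r) F) v]
  refine lintegral_congr fun x => ?_
  have : x + v ∈ cube3 (z + v) r ↔ x ∈ cube3 z r := by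
    simp only [cube3, Set.mem_ofPred_eq, PiLp.add_apply, add_sub_add_right_eq_sub]
  by_cases hx : x ∈ cube3 z r
  · rw [Set.indicator_of_mem hx, Set.indicator_of_mem (this.2 hx)]
  · rw [Set.indicator_of_notMem hx, Set.indicator_of_notMem (fun h => hx (this.1 h))]

theorem lintegral_lintegral_cube3_add (w : E3 → ℝ≥0∞) (z v : E3) (r : ℝ) :
    ∫⁻ x in cube3 (z + v) r, ∫⁻ y in cube3 (z + v) r, w x * w y / edist x y =
      ∫⁻ x in cube3 z r, ∫⁻ y in cube3 z r, w (x + v) * w (y + v) / edist x y := by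
  rw [lintegral_cube3_add]
  refine lintegral_congr fun x => ?_
  rw [lintegral_cube3_add]
  refine lintegral_congr fun y => ?_
  rw [edist_add_right]

theorem KSBound.translate {w : E3 → ℝ≥0∞} {N : ℝ} (h : KSBound w N) (t : E3) :
    KSBound (fun x => w (x - t)) N := by
  intro z r hr hr'
  have := h (z - t) r hr hr'
  have e : z = z - t + t := by simp
  rw [e, lintegral_lintegral_cube3_add, lintegral_cube3_add]
  simpa using this

theorem ksNormT_ne_zero {w : E3 → ℝ≥0∞} {c : ℝ} (hc : 0 < c) (hwc : ∀ x, ENNReal.ofReal c ≤ w x)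
    (hw : ∫⁻ x in Ω3, w x < ⊤) : ksNormT w ≠ 0 := by
  have hpi := Real.pi_gt_three
  set z : E3 := mk3 1 1 1 with hz
  have hzi : ∀ i, z i = 1 := by intro i; fin_cases i <;> rfl
  have hzΩ : z ∈ Ω3 := fun i => by rw [hzi]; constructor <;> linarith
  have hsub : cube3 z 1 ⊆ Ω3 := by
    intro x hx i
    have := abs_le.1 (hx i)
    rw [hzi] at this
    constructor <;> linarith [this.1, this.2]
  have hvol : volume (cube3 z 1) ≠ 0 := by
    refine (Measure.measure_pos_of_mem_nhds (x := z) _ ?_).ne'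
    refine Filter.mem_of_superset (Metric.ball_mem_nhds z (by norm_num : (0:ℝ) < 1 / 2)) ?_
    intro x hx i
    have h1 := PiLp.norm_apply_le (x - z) i
    rw [Metric.mem_ball, dist_eq_norm] at hx
    rw [PiLp.sub_apply, Real.norm_eq_abs] at h1
    exact h1.trans hx.le
  intro h0
  have h1 : ksRatio w z 1 = 0 := by
    refine le_antisymm ?_ bot_le
    rw [← h0]
    exact le_iSup_of_le z <| le_iSup_of_le hzΩ <| le_iSup_of_le 1 <| le_iSup_of_le one_pos <|
      le_iSup_of_le (by linarith) le_rfl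
  rw [ksRatio, mul_eq_zero, ENNReal.inv_eq_zero] at h1
  rcases h1 with h1 | h1
  · exact (((lintegral_mono_set hsub).trans_lt hw).ne) h1
  · have h2 : ∫⁻ x in cube3 z 1, ∫⁻ y in cube3 z 1,
        ENNReal.ofReal c * ENNReal.ofReal c / ENNReal.ofReal (6 * π / 2 ^ 0) ≤ 0 := by
      rw [← h1]
      refine setLIntegral_mono' (measurableSet_cube3 _ _) fun x hx => ?_
      refine setLIntegral_mono' (measurableSet_cube3 _ _) fun y hy => ?_
      gcongr
      · exact hwc x
      · exact hwc y
      · have hx' := hsub hx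
        have hy' := hsub hy
        rw [Ω3_eq_dyadicCell, mem_dyadicCell] at hx' hy'
        exact edist_le_of_cellIdx_eq (hy'.trans hx'.symm)
    rw [setLIntegral_const, setLIntegral_const, nonpos_iff_eq_zero] at h2
    have hc' : ENNReal.ofReal c ≠ 0 := by simpa using hc
    refine absurd h2 (mul_ne_zero (mul_ne_zero (ENNReal.div_ne_zero.2 ⟨?_, ?_⟩) hvol) hvol)
    · exact mul_ne_zero hc' hc'
    · exact ENNReal.ofReal_ne_top

theorem exists_add_latVec_mem (z : E3) : ∃ n, z + latVec n ∈ Ω3 := by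
  refine ⟨-cellIdx 0 z, ?_⟩
  exact (mem_cell_zero_iff (cellIdx 0 z) z).1 rfl

theorem kSBound_of_ksNormT {w : E3 → ℝ≥0∞} {c : ℝ} (hc : 0 < c)
    (hwc : ∀ x, ENNReal.ofReal c ≤ w x) (hper : Periodic3 w)
    (h0 : ksNormT w ≠ 0) (ht : ksNormT w ≠ ⊤) : KSBound w (ksNormT w).toReal := by
  have key : ∀ z ∈ Ω3, ∀ r : ℝ, 0 < r → r < 4 * π →
      ∫⁻ x in cube3 z r, ∫⁻ y in cube3 z r, w x * w y / edist x y ≤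
        ksNormT w * ∫⁻ x in cube3 z r, w x := by
    intro z hz r hr hr'
    have hle : ksRatio w z r ≤ ksNormT w :=
      le_iSup_of_le z <| le_iSup_of_le hz <| le_iSup_of_le r <| le_iSup_of_le hr <|
        le_iSup_of_le hr' le_rfl
    by_cases hJ : ∫⁻ x in cube3 z r, w x = ⊤
    · rw [hJ, ENNReal.mul_top h0]; exact le_top
    by_cases hJ0 : ∫⁻ x in cube3 z r, w x = 0
    · have h1 : ENNReal.ofReal c * volume (cube3 z r) ≤ 0 := by
        rw [← hJ0, ← setLIntegral_const]
        exact lintegral_mono hwc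
      have h2 : volume (cube3 z r) = 0 := by simpa [hc.not_ge] using h1
      simp [Measure.restrict_eq_zero.2 h2]
    · rw [mul_comm]
      exact (ENNReal.inv_mul_le_iff hJ0 hJ).1 hle
  intro z r hr hr'
  rw [ENNReal.ofReal_toReal ht]
  obtain ⟨n, hn⟩ := exists_add_latVec_mem z
  have := key _ hn r hr hr'
  rw [lintegral_lintegral_cube3_add, lintegral_cube3_add] at this
  have hp : ∀ x, w (x + latVec n) = w x := fun x => hper x n
  simpa only [hp] using this

/-- The one-third trick: two nearby reals share a dyadic interval of one of two grids. -/
theorem floor_eq_or_floor_add_third_eq {U V : ℝ} (k : ℕ) (h : |U - V| ≤ 1 / 3) :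
    ⌊U⌋ = ⌊V⌋ ∨ ⌊U + 2 ^ k / 3⌋ = ⌊V + 2 ^ k / 3⌋ := by
  wlog hUV : U ≤ V generalizing U V
  · rcases this (by rwa [abs_sub_comm]) (le_of_not_ge hUV) with h | h
    · exact Or.inl h.symm
    · exact Or.inr h.symm
  by_contra! hne
  obtain ⟨h1, h2⟩ := hne
  have l1 := lt_of_le_of_ne (Int.floor_le_floor hUV) h1
  have l2 := lt_of_le_of_ne (Int.floor_le_floor (show U + 2 ^ k / 3 ≤ V + 2 ^ k / 3 by linarith)) h2
  rw [Int.floor_lt] at l1 l2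
  have m1 := Int.floor_le V
  have m2 := Int.floor_le (V + 2 ^ k / 3)
  have habs := (abs_le.1 h).1
  set j := ⌊V⌋
  set j' := ⌊V + 2 ^ k / 3⌋
  have b1 : ((3 * (j' - j) - 2 ^ k : ℤ) : ℝ) < 1 := by push_cast; linarith
  have b2 : (-1 : ℝ) < ((3 * (j' - j) - 2 ^ k : ℤ) : ℝ) := by push_cast; linarith
  have b1' : 3 * (j' - j) - 2 ^ k < 1 := by exact_mod_cast b1
  have b2' : -1 < 3 * (j' - j) - 2 ^ k := by exact_mod_cast b2
  have hdvd : (3 : ℤ) ∣ 2 ^ k := ⟨j' - j, by omega⟩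
  have := Int.prime_three.dvd_of_dvd_pow hdvd
  omega

/-- The eight translation vectors with coordinates in `{0, 2π/3}`. -/
def thirdShift (e : Fin 3 → Bool) : E3 := WithLp.toLp 2 fun i => if e i then 2 * π / 3 else 0

theorem exists_common_cell {x y : E3} (hxy : x ≠ y) (h : ∀ i, |x i - y i| ≤ 2 * π / 3) :
    ∃ (k : ℕ) (e : Fin 3 → Bool), y + thirdShift e ∈ cellAt k (x + thirdShift e) ∧
      1 / ‖x - y‖ ≤ 2 ^ k := by
  have hpi := Real.pi_gt_three
  set δ : ℝ := ‖WithLp.ofLp (x - y)‖ with hδ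
  have hδ0 : 0 < δ := by
    rw [hδ, norm_pos_iff]
    intro h0
    exact hxy (sub_eq_zero.1 (by ext i; exact congrFun h0 i))
  have hδi : ∀ i, |x i - y i| ≤ δ := fun i => norm_le_pi_norm (WithLp.ofLp (x - y)) i
  have hδ1 : δ ≤ ‖x - y‖ :=
    (pi_norm_le_iff_of_nonneg (norm_nonneg _)).2 fun i => PiLp.norm_apply_le (x - y) i
  have hδ2 : δ ≤ 2 * π / 3 := (pi_norm_le_iff_of_nonneg (by positivity)).2 h
  obtain ⟨k, hk1, hk2⟩ := exists_nat_pow_near (x := 2 * π / (3 * δ)) (y := 2)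
    (by rw [le_div_iff₀ (by positivity)]; linarith) one_lt_two
  have hco : ∀ i, ∃ e : Bool,
      ⌊2 ^ k * ((y i + if e then 2 * π / 3 else 0) / (2 * π))⌋ =
      ⌊2 ^ k * ((x i + if e then 2 * π / 3 else 0) / (2 * π))⌋ := by
    intro i
    have hb : |2 ^ k * (y i / (2 * π)) - 2 ^ k * (x i / (2 * π))| ≤ 1 / 3 := by
      rw [show (2 : ℝ) ^ k * (y i / (2 * π)) - 2 ^ k * (x i / (2 * π)) =
        2 ^ k / (2 * π) * (y i - x i) by ring, abs_mul, abs_of_pos (by positivity), abs_sub_comm,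
        div_mul_eq_mul_div, div_le_div_iff₀ (by positivity) (by norm_num)]
      rw [le_div_iff₀ (by positivity)] at hk1
      have := mul_le_mul_of_nonneg_left (hδi i) (by positivity : (0 : ℝ) ≤ 2 ^ k)
      linarith
    rcases floor_eq_or_floor_add_third_eq k hb with h | h
    · exact ⟨false, by simpa using h⟩
    · refine ⟨true, ?_⟩
      have e1 : ∀ u : ℝ, (2 : ℝ) ^ k * ((u + 2 * π / 3) / (2 * π)) =
          2 ^ k * (u / (2 * π)) + 2 ^ k / 3 := by
        intro u; field_simp
      simpa only [if_true, e1] using h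
  choose e he using hco
  refine ⟨k, e, mem_cellAt.2 (funext he), ?_⟩
  calc 1 / ‖x - y‖ ≤ 1 / δ := one_div_le_one_div_of_le hδ0 hδ1
    _ ≤ 2 ^ k := by
      rw [div_lt_iff₀ (by positivity), pow_succ] at hk2
      rw [div_le_iff₀ hδ0]
      have : 0 < 2 ^ k * δ := by positivity
      nlinarith

theorem yukawa_le {σ : ℝ} (hσ : 0 < σ) (x y : E3) :
    yukawa σ (x - y) ≤ (∑ e, ∑' k : ℕ, 2 ^ k *
      (cellAt k (x + thirdShift e)).indicator 1 (y + thirdShift e)) +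
      ENNReal.ofReal (Real.exp (-(σ * ‖x - y‖))) := by
  have hpi := Real.pi_gt_three
  by_cases hxy : x = y
  · simp [yukawa, hxy]
  by_cases h : ∀ i, |x i - y i| ≤ 2 * π / 3
  · refine le_add_right ?_
    obtain ⟨k, e, hk, hle⟩ := exists_common_cell hxy h
    calc yukawa σ (x - y) ≤ 2 ^ k := by
          rw [yukawa]
          have : (2 : ℝ≥0∞) ^ k = ENNReal.ofReal (2 ^ k) := by
            rw [ENNReal.ofReal_pow (by norm_num)]; simp
          rw [this]
          refine ENNReal.ofReal_le_ofReal (le_trans ?_ hle)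
          gcongr
          exact Real.exp_le_one_iff.2 (by have := norm_nonneg (x - y); nlinarith)
      _ = 2 ^ k * (cellAt k (x + thirdShift e)).indicator 1 (y + thirdShift e) := by
          rw [Set.indicator_of_mem hk]; simp
      _ ≤ ∑' k : ℕ, 2 ^ k * (cellAt k (x + thirdShift e)).indicator 1 (y + thirdShift e) :=
          ENNReal.le_tsum k
      _ ≤ _ := Finset.single_le_sum (f := fun e => ∑' k : ℕ, 2 ^ k *
            (cellAt k (x + thirdShift e)).indicator (1 : E3 → ℝ≥0∞) (y + thirdShift e))
            (fun _ _ => bot_le) (Finset.mem_univ e)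
  · push Not at h
    obtain ⟨i, hi⟩ := h
    refine le_add_left ?_
    rw [yukawa]
    refine ENNReal.ofReal_le_ofReal (div_le_self (Real.exp_pos _).le ?_)
    have := PiLp.norm_apply_le (x - y) i
    rw [PiLp.sub_apply, Real.norm_eq_abs] at this
    linarith

theorem lintegral_yukawa_le {σ : ℝ} (hσ : 0 < σ) {Ψ : E3 → ℝ≥0∞} (hΨ : Measurable Ψ) (x : E3) :
    ∫⁻ y, yukawa σ y * Ψ (x - y) ≤
      (∑ e, dyadicOp (fun z => Ψ (z - thirdShift e)) (x + thirdShift e)) +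
        ∫⁻ y, ENNReal.ofReal (Real.exp (-(σ * ‖x - y‖))) * Ψ y := by
  have hI : ∀ (e : Fin 3 → Bool) (k : ℕ), Measurable fun y : E3 =>
      (cellAt k (x + thirdShift e)).indicator (1 : E3 → ℝ≥0∞) (y + thirdShift e) := fun e k =>
    (measurable_one.indicator (measurableSet_dyadicCell _)).comp (measurable_add_const _)
  have hIΨ : ∀ (e : Fin 3 → Bool) (k : ℕ), Measurable fun y : E3 =>
      (cellAt k (x + thirdShift e)).indicator (1 : E3 → ℝ≥0∞) (y + thirdShift e) * Ψ y :=
    fun e k => (hI e k).mul hΨ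
  calc ∫⁻ y, yukawa σ y * Ψ (x - y) = ∫⁻ y, yukawa σ (x - y) * Ψ y := by
        rw [← lintegral_sub_left_eq_self _ x]; simp
    _ ≤ ∫⁻ y, ((∑ e, ∑' k : ℕ, 2 ^ k *
          ((cellAt k (x + thirdShift e)).indicator 1 (y + thirdShift e) * Ψ y)) +
          ENNReal.ofReal (Real.exp (-(σ * ‖x - y‖))) * Ψ y) := by
        refine lintegral_mono fun y => ?_
        refine (mul_le_mul_left (yukawa_le hσ x y) _).trans_eq ?_
        rw [add_mul, Finset.sum_mul]
        simp_rw [← ENNReal.tsum_mul_right, mul_assoc]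
    _ = _ := by
        rw [lintegral_add_left, lintegral_finsetSum]
        · congr 1
          refine Finset.sum_congr rfl fun e _ => ?_
          rw [lintegral_tsum]
          · refine tsum_congr fun k => ?_
            rw [lintegral_const_mul _ (hIΨ e k), ← lintegral_indicator
              (show MeasurableSet (cellAt k (x + thirdShift e)) from measurableSet_dyadicCell _),
              ← lintegral_add_right_eq_self (Set.indicator (cellAt k (x + thirdShift e)) _)
                (thirdShift e)]
            congr 1
            refine lintegral_congr fun y => ?_
            by_cases hy : y + thirdShift e ∈ cellAt k (x + thirdShift e)
            · rw [Set.indicator_of_mem hy, Set.indicator_of_mem hy]; simp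
            · rw [Set.indicator_of_notMem hy, Set.indicator_of_notMem hy, zero_mul]
          · exact fun k => ((hIΨ e k).const_mul _).aemeasurable
        · exact fun e _ => Measurable.tsum fun k => (hIΨ e k).const_mul _
        · exact Finset.measurable_sum _ fun e _ =>
            Measurable.tsum fun k => (hIΨ e k).const_mul _

theorem lintegral_exp_neg_norm_ne_top {σ : ℝ} (hσ : 0 < σ) :
    ∫⁻ y : E3, ENNReal.ofReal (Real.exp (-(σ * ‖y‖))) ≠ ⊤ := by
  have h : ∫⁻ y : E3, ENNReal.ofReal ((1 + ‖y‖) ^ (-(4 : ℝ))) < ⊤ :=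
    finite_integral_one_add_norm (by norm_num)
  have hle : ∀ y : E3, ENNReal.ofReal (Real.exp (-(σ * ‖y‖))) ≤
      ENNReal.ofReal (24 / σ ^ 4 * Real.exp σ) * ENNReal.ofReal ((1 + ‖y‖) ^ (-(4 : ℝ))) := by
    intro y
    rw [← ENNReal.ofReal_mul (by positivity)]
    refine ENNReal.ofReal_le_ofReal ?_
    have hy := norm_nonneg y
    have h1 := Real.pow_div_factorial_le_exp (σ * (1 + ‖y‖)) (by positivity) 4
    rw [show ((Nat.factorial 4 : ℕ) : ℝ) = 24 by norm_num [Nat.factorial], mul_add, mul_one,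
      Real.exp_add, ← mul_one_add, mul_pow] at h1
    rw [Real.exp_neg, Real.rpow_neg (by positivity), show (4 : ℝ) = ((4 : ℕ) : ℝ) by norm_num,
      Real.rpow_natCast, inv_le_iff_one_le_mul₀ (Real.exp_pos _)]
    rw [div_le_iff₀ (by norm_num)] at h1
    have h4 : 0 < σ ^ 4 * (1 + ‖y‖) ^ 4 := by positivity
    calc (1 : ℝ) ≤ (Real.exp σ * Real.exp (σ * ‖y‖) * 24) / (σ ^ 4 * (1 + ‖y‖) ^ 4) :=
          (one_le_div h4).2 h1
      _ = _ := by field_simp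
  refine ((lintegral_mono hle).trans_lt ?_).ne
  rw [lintegral_const_mul' _ _ ENNReal.ofReal_ne_top]
  exact ENNReal.mul_lt_top ENNReal.ofReal_lt_top h

theorem volume_Ω3_ne_zero : volume Ω3 ≠ 0 := by
  rw [Ω3_eq_dyadicCell]
  exact (Measure.measure_pos_of_mem_nhds _ (dyadicCell_mem_nhds (0, 0))).ne'

theorem norm_sub_le_of_mem_Ω3 {x y : E3} (hx : x ∈ Ω3) (hy : y ∈ Ω3) : ‖x - y‖ ≤ 6 * π := by
  rw [Ω3_eq_dyadicCell, mem_dyadicCell] at hx hy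
  have := edist_le_of_cellIdx_eq (k := 0) (hx.trans hy.symm)
  rw [edist_dist, pow_zero, div_one, ENNReal.ofReal_le_ofReal_iff (by positivity),
    dist_comm, dist_eq_norm] at this
  exact this

theorem volume_Ω3_ne_top : volume Ω3 ≠ ⊤ := by
  have hb : Bornology.IsBounded Ω3 := Metric.isBounded_iff.2
    ⟨6 * π, fun x hx y hy => by rw [dist_eq_norm]; exact norm_sub_le_of_mem_Ω3 hx hy⟩
  exact hb.measure_lt_top.ne

theorem Periodic3.lintegral_exp_mul_le {σ : ℝ} (hσ : 0 < σ) {Ψ : E3 → ℝ≥0∞} (hΨ : Measurable Ψ)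
    (hper : Periodic3 Ψ) {x : E3} (hx : x ∈ Ω3) :
    ∫⁻ y, ENNReal.ofReal (Real.exp (-(σ * ‖x - y‖))) * Ψ y ≤
      (volume Ω3)⁻¹ * (ENNReal.ofReal (Real.exp (σ * (6 * π))) *
        (∫⁻ y : E3, ENNReal.ofReal (Real.exp (-(σ * ‖y‖))))) * ∫⁻ y in Ω3, Ψ y := by
  set F : E3 → ℝ≥0∞ := fun x => ∫⁻ y, ENNReal.ofReal (Real.exp (-(σ * ‖x - y‖))) * Ψ y with hF
  have hcomp : ∀ u ∈ Ω3, F x ≤ ENNReal.ofReal (Real.exp (σ * (6 * π))) * F u := by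
    intro u hu
    rw [hF]
    simp only
    rw [← lintegral_const_mul' _ _ ENNReal.ofReal_ne_top]
    refine lintegral_mono fun y => ?_
    rw [← mul_assoc, ← ENNReal.ofReal_mul (Real.exp_pos _).le, ← Real.exp_add]
    gcongr
    have h1 := norm_sub_le_of_mem_Ω3 hu hx
    have h2 := norm_sub_le_norm_sub_add_norm_sub u x y
    nlinarith
  have hmE : Measurable fun y : E3 => ENNReal.ofReal (Real.exp (-(σ * ‖y‖))) := by fun_prop
  have hInt : ∫⁻ u in Ω3, F u =
      (∫⁻ y : E3, ENNReal.ofReal (Real.exp (-(σ * ‖y‖)))) * ∫⁻ y in Ω3, Ψ y := by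
    have e1 : ∀ u, F u = ∫⁻ y, ENNReal.ofReal (Real.exp (-(σ * ‖y‖))) * Ψ (u - y) := by
      intro u
      rw [hF]; simp only
      rw [← lintegral_sub_left_eq_self _ u]; simp
    simp_rw [e1]
    rw [lintegral_lintegral_swap (by
      refine Measurable.aemeasurable ?_
      exact (hmE.comp measurable_snd).mul (hΨ.comp (measurable_fst.sub measurable_snd)))]
    rw [← lintegral_mul_const _ hmE]
    refine lintegral_congr fun y => ?_
    rw [lintegral_const_mul' _ _ ENNReal.ofReal_ne_top, ← hper.lintegral_add (-y)]
    simp_rw [sub_eq_add_neg]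
  have h := setLIntegral_mono' (μ := volume) measurableSet_Ω3 hcomp
  rw [setLIntegral_const, lintegral_const_mul' _ _ ENNReal.ofReal_ne_top, hInt] at h
  calc F x = (volume Ω3)⁻¹ * (F x * volume Ω3) := by
        rw [mul_comm (F x), ← mul_assoc,
          ENNReal.inv_mul_cancel volume_Ω3_ne_zero volume_Ω3_ne_top, one_mul]
    _ ≤ _ := mul_le_mul_right h _
    _ = _ := by simp only [mul_assoc]

theorem cellIdx_add_latVec (k : ℕ) (x : E3) (n : Fin 3 → ℤ) :
    cellIdx k (x + latVec n) = cellIdx k x + fun i => 2 ^ k * n i := by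
  ext i
  have hpi := Real.pi_pos
  simp only [cellIdx, PiLp.add_apply, latVec_apply, Pi.add_apply]
  rw [← Int.floor_add_intCast]
  congr 1
  push_cast
  field_simp

theorem Periodic3.dyadicOp {f : E3 → ℝ≥0∞} (hf : Periodic3 f) : Periodic3 (dyadicOp f) := by
  intro x n
  change _root_.dyadicOp f (x + latVec n) = _
  refine tsum_congr fun m => ?_
  congr 1
  have hm : ∀ x, MeasurableSet (cellAt m x) := fun x => measurableSet_dyadicCell _
  rw [← lintegral_indicator (hm _), ← lintegral_indicator (hm _),
    ← lintegral_add_right_eq_self (Set.indicator (cellAt m (x + latVec n)) _) (latVec n)]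
  refine lintegral_congr fun y => ?_
  have hiff : y + latVec n ∈ cellAt m (x + latVec n) ↔ y ∈ cellAt m x := by
    rw [mem_cellAt, mem_cellAt, cellIdx_add_latVec, cellIdx_add_latVec]
    exact add_left_inj _
  by_cases hy : y ∈ cellAt m x
  · rw [Set.indicator_of_mem hy, Set.indicator_of_mem (hiff.2 hy)]; exact hf y n
  · rw [Set.indicator_of_notMem hy, Set.indicator_of_notMem (fun h => hy (hiff.1 h))]

theorem measurable_dyadicOp (f : E3 → ℝ≥0∞) : Measurable (dyadicOp f) := by
  refine Measurable.tsum fun m => Measurable.const_mul ?_ _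
  exact (Measurable.of_discrete (f := fun q : Fin 3 → ℤ => ∫⁻ y in dyadicCell (m, q), f y)).comp
    (measurable_cellIdx m)

theorem lintegral_Ω3_le_dyadicOp (f : E3 → ℝ≥0∞) {x : E3} (hx : x ∈ Ω3) :
    ∫⁻ y in Ω3, f y ≤ dyadicOp f x := by
  refine le_trans (le_of_eq ?_) (ENNReal.le_tsum 0)
  rw [Ω3_eq_dyadicCell] at hx ⊢
  rw [pow_zero, one_mul, cellAt, mem_dyadicCell.1 hx]

theorem Periodic3.sub_const {α : Type*} {f : E3 → α} (hf : Periodic3 f) (t : E3) :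
    Periodic3 fun x => f (x - t) := by
  intro x n
  simp only
  rw [add_sub_right_comm]
  exact hf _ n

theorem exists_lintegral_yukawa_le_sum {σ : ℝ} (hσ : 0 < σ) :
    ∃ K : ℝ≥0, ∀ Ψ : E3 → ℝ≥0∞, Measurable Ψ → Periodic3 Ψ → ∀ x ∈ Ω3,
      ∫⁻ y, yukawa σ y * Ψ (x - y) ≤
        K * ∑ e, dyadicOp (fun z => Ψ (z - thirdShift e)) (x + thirdShift e) := by
  set M := (volume Ω3)⁻¹ * (ENNReal.ofReal (Real.exp (σ * (6 * π))) *
        (∫⁻ y : E3, ENNReal.ofReal (Real.exp (-(σ * ‖y‖))))) with hM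
  have hMt : M ≠ ⊤ := ENNReal.mul_ne_top (ENNReal.inv_ne_top.2 volume_Ω3_ne_zero)
    (ENNReal.mul_ne_top ENNReal.ofReal_ne_top (lintegral_exp_neg_norm_ne_top hσ))
  refine ⟨1 + M.toNNReal, fun Ψ hΨ hper x hx => ?_⟩
  push_cast
  rw [ENNReal.coe_toNNReal hMt, add_mul, one_mul]
  refine (lintegral_yukawa_le hσ hΨ x).trans (add_le_add le_rfl ?_)
  refine (hper.lintegral_exp_mul_le hσ hΨ hx).trans (mul_le_mul_right ?_ _)
  have h0 : thirdShift (fun _ => false) = 0 := by ext i; simp [thirdShift]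
  have h1 := Finset.single_le_sum
    (f := fun e => dyadicOp (fun z => Ψ (z - thirdShift e)) (x + thirdShift e))
    (fun _ _ => bot_le) (Finset.mem_univ fun _ => false)
  refine le_trans ?_ h1
  simp only [h0, sub_zero, add_zero]
  exact lintegral_Ω3_le_dyadicOp Ψ hx

theorem sq_sum_le_mul_sum_sq {ι : Type*} (s : Finset ι) (f : ι → ℝ≥0∞) :
    (∑ i ∈ s, f i) ^ 2 ≤ (s.card : ℝ≥0∞) ^ 2 * ∑ i ∈ s, f i ^ 2 := by
  rcases s.eq_empty_or_nonempty with rfl | hs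
  · simp
  obtain ⟨j, hj, hmax⟩ := s.exists_max_image f hs
  calc (∑ i ∈ s, f i) ^ 2 ≤ (s.card • f j) ^ 2 := by
        gcongr; exact Finset.sum_le_card_nsmul _ _ _ hmax
    _ = (s.card : ℝ≥0∞) ^ 2 * f j ^ 2 := by rw [nsmul_eq_mul, mul_pow]
    _ ≤ _ := by
        gcongr
        exact Finset.single_le_sum (f := fun i => f i ^ 2) (fun _ _ => bot_le) hj

theorem lintegral_dyadicOp_shift_sq_le {w : E3 → ℝ≥0∞} (hw : Measurable w) (hper : Periodic3 w)
    (hw0 : ∀ x, w x ≠ 0) (hwfin : ∫⁻ x in Ω3, w x ≠ ⊤) {N : ℝ} (hN : 0 < N) (h : KSBound w N)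
    {f : E3 → ℝ≥0∞} (hf : Measurable f) (hfper : Periodic3 f)
    (hf2 : ∫⁻ x in Ω3, f x ^ 2 * (w x)⁻¹ ≠ ⊤) (t : E3) :
    ∫⁻ x in Ω3, dyadicOp (fun z => f (z - t)) (x + t) ^ 2 * w x ≤
      ENNReal.ofReal (16 * (12 * π * N) ^ 2) * ∫⁻ x in Ω3, f x ^ 2 * (w x)⁻¹ := by
  have hwt := hper.sub_const t
  have hft := hfper.sub_const t
  have hG : Periodic3 fun x => f x ^ 2 * (w x)⁻¹ := fun x n => by simp only [hfper x n, hper x n]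
  have hGt := hG.sub_const t
  have e1 : ∫⁻ x in Ω3, f (x - t) ^ 2 * (w (x - t))⁻¹ = ∫⁻ x in Ω3, f x ^ 2 * (w x)⁻¹ := by
    simp_rw [sub_eq_add_neg]
    exact hG.lintegral_add (-t)
  have e2 : ∫⁻ x in Ω3, w (x - t) = ∫⁻ x in Ω3, w x := by
    simp_rw [sub_eq_add_neg]
    exact hper.lintegral_add (-t)
  have hD : Periodic3 fun x => dyadicOp (fun z => f (z - t)) x ^ 2 * w (x - t) := fun x n => by
    have h1 := hft.dyadicOp x n
    have h2 := hwt x n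
    simp only at h1 h2 ⊢
    rw [h1, h2]
  have e3 := hD.lintegral_add t
  simp only [add_sub_cancel_right] at e3
  rw [e3, ← e1]
  refine (h.translate t).lintegral_dyadicOp_sq_le (w := fun x => w (x - t))
    (hw.comp (measurable_sub_const t))
    (fun x => hw0 _) (fun n => ?_) hN (hf.comp (measurable_sub_const t)) fun n => ?_
  · rw [hwt.lintegral_dyadicCell_zero, e2]; exact hwfin
  · rw [hGt.lintegral_dyadicCell_zero, e1]; exact hf2

theorem lintegral_yukawa_sq_le {σ : ℝ} (hσ : 0 < σ) :
    ∃ K : ℝ≥0, ∀ w : E3 → ℝ≥0∞, Measurable w → Periodic3 w →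
      (∃ c : ℝ, 0 < c ∧ ∀ x, ENNReal.ofReal c ≤ w x) → ∫⁻ x in Ω3, w x < ⊤ → ksNormT w < ⊤ →
      ∀ f : E3 → ℝ≥0∞, Measurable f → Periodic3 f →
      ∫⁻ x in Ω3, (∫⁻ y, yukawa σ y * f (x - y)) ^ 2 * w x ≤
        K * ksNormT w ^ 2 * ∫⁻ x in Ω3, f x ^ 2 * (w x)⁻¹ := by
  obtain ⟨K, hK⟩ := exists_lintegral_yukawa_le_sum hσ
  refine ⟨1 + K ^ 2 * 8 ^ 2 * 8 * (16 * (12 * Real.toNNReal π) ^ 2),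
    fun w hw hper ⟨c, hc, hwc⟩ hwfin hks f hf hfper => ?_⟩
  have hN0 := ksNormT_ne_zero hc hwc hwfin
  have hKS := kSBound_of_ksNormT hc hwc hper hN0 hks.ne
  have hN : 0 < (ksNormT w).toReal := ENNReal.toReal_pos hN0 hks.ne
  have hw0 : ∀ x, w x ≠ 0 := fun x => ((ENNReal.ofReal_pos.2 hc).trans_le (hwc x)).ne'
  by_cases hf2 : ∫⁻ x in Ω3, f x ^ 2 * (w x)⁻¹ = ⊤
  · rw [hf2, ENNReal.mul_top]
    · exact le_top
    · refine mul_ne_zero ?_ (pow_ne_zero 2 hN0)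
      push_cast
      exact (lt_of_lt_of_le one_pos le_self_add).ne'
  have hm : ∀ e : Fin 3 → Bool, Measurable fun x =>
      dyadicOp (fun z => f (z - thirdShift e)) (x + thirdShift e) ^ 2 * w x := fun e =>
    (((measurable_dyadicOp _).comp (measurable_add_const _)).pow_const 2).mul hw
  calc ∫⁻ x in Ω3, (∫⁻ y, yukawa σ y * f (x - y)) ^ 2 * w x
      ≤ ∫⁻ x in Ω3, ((K : ℝ≥0∞) ^ 2 * 8 ^ 2) * ∑ e,
          dyadicOp (fun z => f (z - thirdShift e)) (x + thirdShift e) ^ 2 * w x := by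
        refine setLIntegral_mono' measurableSet_Ω3 fun x hx => ?_
        rw [← Finset.sum_mul, ← mul_assoc]
        refine mul_le_mul_left ?_ _
        calc _ ≤ _ := pow_le_pow_left₀ bot_le (hK f hf hfper x hx) 2
          _ ≤ _ := by
            rw [mul_pow, mul_assoc]
            refine mul_le_mul_right ((sq_sum_le_mul_sum_sq _ _).trans_eq ?_) _
            simp
    _ = ((K : ℝ≥0∞) ^ 2 * 8 ^ 2) * ∑ e, ∫⁻ x in Ω3,
          dyadicOp (fun z => f (z - thirdShift e)) (x + thirdShift e) ^ 2 * w x := by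
        rw [lintegral_const_mul _ (Finset.measurable_sum _ fun e _ => hm e),
          lintegral_finsetSum _ fun e _ => hm e]
    _ ≤ ((K : ℝ≥0∞) ^ 2 * 8 ^ 2) * ∑ e : Fin 3 → Bool,
          ENNReal.ofReal (16 * (12 * π * (ksNormT w).toReal) ^ 2) *
            ∫⁻ x in Ω3, f x ^ 2 * (w x)⁻¹ := by
        gcongr with e
        exact lintegral_dyadicOp_shift_sq_le hw hper hw0 hwfin.ne hN hKS hf hfper hf2 _
    _ = ((K : ℝ≥0∞) ^ 2 * 8 ^ 2 * 8 * (16 * (12 * ENNReal.ofReal π) ^ 2)) * ksNormT w ^ 2 *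
            ∫⁻ x in Ω3, f x ^ 2 * (w x)⁻¹ := by
        rw [Finset.sum_const, nsmul_eq_mul, ENNReal.ofReal_mul (by norm_num), ENNReal.ofReal_pow
          (by positivity), ENNReal.ofReal_mul (by positivity), ENNReal.ofReal_mul (by norm_num),
          ENNReal.ofReal_toReal hks.ne]
        simp
        ring
    _ ≤ _ := by
        refine mul_le_mul_left (mul_le_mul_left ?_ _) _
        push_cast
        exact le_add_self

theorem periodic3_ewave (n : Fin 3 → ℤ) : Periodic3 (ewave n) := by
  intro x m
  change ewave n (x + latVec m) = _
  rw [ewave, ewave, Complex.exp_eq_exp_iff_exists_int]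
  refine ⟨∑ i, n i * m i, ?_⟩
  simp only [PiLp.add_apply, latVec_apply, Fin.sum_univ_three]
  push_cast
  ring

/-- Weighted `L²` resolvent estimate
`‖H₀(δ₀+iρ)⁻¹ψ‖_{L²(𝕋³,w dx)} ≤ C‖w‖_{F(𝕋³)}‖ψ‖_{L²(𝕋³,w⁻¹dx)}` (squared form),
for weights with a one-dimensional Muckenhoupt `A₂` condition in the `x₁` direction. -/
theorem stmt19 :
    ∀ A : Matrix (Fin 3) (Fin 3) ℝ, A.IsSymm → A.PosDef →
    ∀ CA2 : ℝ≥0,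
      ∃ C : ℝ≥0, 0 < C ∧
        ∀ a b : Fin 3 → ℝ, ∀ s₀ : ℝ, 0 < s₀ →
          norm3 a = 1 → Matrix.vecMul a A = ![s₀, 0, 0] →
          norm3 b < Real.sqrt 3 → (∑ i, a i * b i) = 0 →
        ∀ w : E3 → ℝ≥0∞, Measurable w → Periodic3 w →
          (∃ c_w : ℝ, 0 < c_w ∧ ∀ x, ENNReal.ofReal c_w ≤ w x) →
          (∫⁻ x in Ω3, w x) < ⊤ → ksNormT w < ⊤ →
          (∀ᵐ p : ℝ × ℝ, ∀ s t : ℝ, s < t →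
            ((ENNReal.ofReal (t - s))⁻¹ * ∫⁻ u in Set.Ioo s t, w (mk3 u p.1 p.2)) *
              ((ENNReal.ofReal (t - s))⁻¹ * ∫⁻ u in Set.Ioo s t, (w (mk3 u p.1 p.2))⁻¹)
              ≤ CA2) →
        ∀ ρ : ℝ, 1 ≤ |ρ| →
        ∀ c : (Fin 3 → ℤ) →₀ ℂ,
          (∫⁻ x in Ω3,
            (‖∑ n ∈ c.support, c n * ewave n x /
                (∑ i, ∑ l,
                  ((n i : ℂ) + ((((1 / a 0) * (1/2 - b 0) : ℝ) : ℂ)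
                      + ((ρ : ℝ) : ℂ) * Complex.I) * ((a i : ℝ) : ℂ) + ((b i : ℝ) : ℂ)) *
                    ((A i l : ℝ) : ℂ) *
                  ((n l : ℂ) + ((((1 / a 0) * (1/2 - b 0) : ℝ) : ℂ)
                      + ((ρ : ℝ) : ℂ) * Complex.I) * ((a l : ℝ) : ℂ) + ((b l : ℝ) : ℂ)))‖₊
              : ℝ≥0∞) ^ 2 * w x) ≤
            C * (ksNormT w) ^ 2 *
              ∫⁻ x in Ω3,
                (‖∑ n ∈ c.support, c n * ewave n x‖₊ : ℝ≥0∞) ^ 2 * (w x)⁻¹ := by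
  intro A hs hp _
  obtain ⟨C₀, σ, hσ, hC₀⟩ := exists_resolvent_le_yukawa A hs hp
  obtain ⟨K, hK⟩ := lintegral_yukawa_sq_le hσ
  refine ⟨C₀ ^ 2 * K + 1, by positivity, ?_⟩
  intro a b s₀ _ ha haA _ _ w hw hper hwc hwfin hks _ ρ _ c
  have hψ : Continuous fun x : E3 => ∑ n ∈ c.support, c n * ewave n x :=
    continuous_finsetSum _ fun n _ => continuous_const.mul (continuous_ewave n)
  have hf : Measurable fun x : E3 => ‖∑ n ∈ c.support, c n * ewave n x‖ₑ :=
    hψ.enorm.measurable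
  have hfper : Periodic3 fun x : E3 => ‖∑ n ∈ c.support, c n * ewave n x‖ₑ := by
    intro x m
    simp only [periodic3_ewave _ x m]
  have h := hK w hw hper hwc hwfin hks _ hf hfper
  calc _ ≤ ∫⁻ x in Ω3, (C₀ : ℝ≥0∞) ^ 2 *
        ((∫⁻ y, yukawa σ y * ‖∑ n ∈ c.support, c n * ewave n (x - y)‖ₑ) ^ 2 * w x) := by
        refine lintegral_mono fun x => ?_
        rw [← mul_assoc, ← mul_pow]
        exact mul_le_mul_left (pow_le_pow_left₀ bot_le (hC₀ a b s₀ ha haA ρ c x) 2) _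
    _ = (C₀ : ℝ≥0∞) ^ 2 * ∫⁻ x in Ω3,
        (∫⁻ y, yukawa σ y * ‖∑ n ∈ c.support, c n * ewave n (x - y)‖ₑ) ^ 2 * w x :=
        lintegral_const_mul' _ _ (by finiteness)
    _ ≤ (C₀ : ℝ≥0∞) ^ 2 * _ := mul_le_mul_right h _
    _ = ((C₀ ^ 2 * K : ℝ≥0) : ℝ≥0∞) * ksNormT w ^ 2 *
        ∫⁻ x in Ω3, ‖∑ n ∈ c.support, c n * ewave n x‖ₑ ^ 2 * (w x)⁻¹ := by
        push_cast
        simp only [mul_assoc]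
    _ ≤ _ := mul_le_mul_left (mul_le_mul_left (ENNReal.coe_le_coe.2 le_self_add) _) _
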